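/- Let ε > 0, let a ∈ 𝒮(ℝ^N) be a symmetric-matrix-valued kernel with a(z) positive semidefinite, a(−z) = a(z), a(z)z·z = 0, and let f be the global weak solution of the regularized problem ∂_t f + v_i ∂_{x_i} f = ∂_{v_j}( ā^f_{ij} ∂_{v_i} f − b̄^f_j f(1−f) ) + εΔ_v f with Schwartz, Gaussian-sandwiched initial data f₀, constructed as the limit of the iterative scheme (satisfying the Gaussian sandwich bounds and the weighted gradient bound on each (0,T)). Then for almost every t > 0 the entropy inequality holds: ∬ s(t,x,v) dxdv + (1/2)∫₀ᵗ ∬ d(τ,x,v) dxdv dτ ≤ ∬ s(0,x,v) dxdv, where s(t,x,v) = f log f + (1−f) log(1−f) and d(t,x,v) = ∫ ⟨ a(v−v*) ( ∇_v f/(f(1−f)) − ∇_{v*} f_*/(f_*(1−f_*)) ), ( ∇_v f/(f(1−f)) − ∇_{v*} f_*/(f_*(1−f_*)) ) ⟩ f(1−f) f_*(1−f_*) dv*, with f = f(t,x,v), f_* = f(t,x,v*). -/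

import Mathlib

open MeasureTheory Real Filter Set Metric

noncomputable section

/-- velocity space -/
abbrev En (N : ℕ) := EuclideanSpace ℝ (Fin N)

/-- time derivative of a test function on `ℝ_t × ℝ^N_x × ℝ^N_v` -/
def pT {N : ℕ} (φ : ℝ × En N × En N → ℝ) (p : ℝ × En N × En N) : ℝ :=
  fderiv ℝ φ p ((1 : ℝ), (0 : En N), (0 : En N))

/-- `∂_{x_i}` of a test function -/
def pX {N : ℕ} (i : Fin N) (φ : ℝ × En N × En N → ℝ) (p : ℝ × En N × En N) : ℝ :=
  fderiv ℝ φ p ((0 : ℝ), EuclideanSpace.single i 1, (0 : En N))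

/-- `∂_{v_i}` of a test function -/
def pV {N : ℕ} (i : Fin N) (φ : ℝ × En N × En N → ℝ) (p : ℝ × En N × En N) : ℝ :=
  fderiv ℝ φ p ((0 : ℝ), (0 : En N), EuclideanSpace.single i 1)

/-- test functions in `𝒟((0,∞) × ℝ^{2N}_{x,v})` -/
def IsTest {N : ℕ} (φ : ℝ × En N × En N → ℝ) : Prop :=
  ContDiff ℝ (⊤ : ℕ∞) φ ∧ HasCompactSupport φ ∧ tsupport φ ⊆ {p : ℝ × En N × En N | 0 < p.1}

/-- a compact box `(a,b] × B_R × B_R` in `(0,∞) × ℝ^{2N}` -/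
def Qloc {N : ℕ} (a b R : ℝ) : Set (ℝ × En N × En N) :=
  Set.Ioc a b ×ˢ (closedBall (0 : En N) R ×ˢ closedBall (0 : En N) R)

/-- `g ∈ L²_loc((0,∞)×ℝ^N_x ; H¹_loc(ℝ^N_v))`, with `Dg` its weak `v`-gradient. -/
def LocH1v {N : ℕ} (g : ℝ × En N × En N → ℝ) (Dg : Fin N → ℝ × En N × En N → ℝ) : Prop :=
  Measurable g ∧ (∀ i, Measurable (Dg i)) ∧
  (∀ a b R : ℝ, 0 < a → a < b → 0 < R →
      IntegrableOn (fun p => g p ^ 2 + ∑ i, Dg i p ^ 2) (Qloc a b R)) ∧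
  (∀ (i : Fin N) (φ : ℝ × En N × En N → ℝ), IsTest φ →
      ∫ p, g p * pV i φ p = -∫ p, Dg i p * φ p)

/-- `∂_{z_j} a_{ij}` for a Schwartz kernel entry -/
def dSch {N : ℕ} (a : Fin N → Fin N → SchwartzMap (En N) ℝ) (i j : Fin N) (z : En N) : ℝ :=
  fderiv ℝ (a i j : En N → ℝ) z (EuclideanSpace.single j 1)

/-- `ā^f_{ij} = a_{ij} *_v (f(1−f))` -/
def abarS {N : ℕ} (a : Fin N → Fin N → SchwartzMap (En N) ℝ)
    (f : ℝ × En N × En N → ℝ) (i j : Fin N) (p : ℝ × En N × En N) : ℝ :=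
  ∫ w : En N, a i j (p.2.2 - w) * (f (p.1, p.2.1, w) * (1 - f (p.1, p.2.1, w)))

/-- `b̄^f_i = (∂_{v_j} a_{ij}) *_v f` -/
def bbarS {N : ℕ} (a : Fin N → Fin N → SchwartzMap (En N) ℝ)
    (f : ℝ × En N × En N → ℝ) (i : Fin N) (p : ℝ × En N × En N) : ℝ :=
  ∫ w : En N, (∑ j, dSch a i j (p.2.2 - w)) * f (p.1, p.2.1, w)

/-- weak formulation of the regularized problem
`∂ₜf + v·∇ₓf = ∂_{v_j}( ā^f_{ij} ∂_{v_i} f − b̄^f_j f(1−f) ) + ε Δ_v f`,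
where `Df` is the weak `v`-gradient of `f`. -/
def IsWeakReg {N : ℕ} (ε : ℝ) (a : Fin N → Fin N → SchwartzMap (En N) ℝ)
    (f : ℝ × En N × En N → ℝ) (Df : Fin N → ℝ × En N × En N → ℝ) : Prop :=
  ∀ φ : ℝ × En N × En N → ℝ, IsTest φ →
    (-∫ p, f p * pT φ p) - ∫ p, f p * ∑ i, p.2.2 i * pX i φ p
      = -∫ p, ∑ j, ((∑ i, abarS a f i j p * Df i p) + ε * Df j p
          - bbarS a f j p * (f p * (1 - f p))) * pV j φ p

/-- convergence to the initial data in `𝒟'(ℝ^{2N}_{x,v})` as `t → 0⁺` -/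
def TakesInitialData {N : ℕ} (f : ℝ × En N × En N → ℝ) (f₀ : En N × En N → ℝ) : Prop :=
  ∀ ψ : En N × En N → ℝ, ContDiff ℝ (⊤ : ℕ∞) ψ → HasCompactSupport ψ →
    Tendsto (fun t => ∫ z : En N × En N, f (t, z.1, z.2) * ψ z)
      (nhdsWithin 0 (Set.Ioi 0)) (nhds (∫ z : En N × En N, f₀ z * ψ z))

/-- `f ∈ C((0,∞); 𝒟'(ℝ^{2N}_{x,v}))` -/
def ContInDistributions {N : ℕ} (f : ℝ × En N × En N → ℝ) : Prop :=
  ∀ ψ : En N × En N → ℝ, ContDiff ℝ (⊤ : ℕ∞) ψ → HasCompactSupport ψ →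
    ContinuousOn (fun t => ∫ z : En N × En N, f (t, z.1, z.2) * ψ z) (Set.Ioi 0)

lemma memLp_two_locallyIntegrable {E : Type*} [NormedAddCommGroup E] [NormedSpace ℝ E]
    [FiniteDimensional ℝ E] [MeasureSpace E] [(volume : Measure E).IsAddHaarMeasure] {u : E → ℝ}
    (hu : MemLp u 2) : LocallyIntegrable u :=
  hu.locallyIntegrable (by norm_num)

section Mollification

variable {E : Type*} [NormedAddCommGroup E] [MeasureSpace E]

/-- The convolution `u * ρ`. -/
def moll (ρ u : E → ℝ) (z : E) : ℝ := ∫ y, u y * ρ (z - y)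

lemma moll_eq_convolution (ρ u : E → ℝ) :
    moll ρ u = MeasureTheory.convolution u ρ (ContinuousLinearMap.mul ℝ ℝ) volume := rfl

variable [BorelSpace E]

lemma integrable_mul_comp_sub {ρ u : E → ℝ} (hρ : Continuous ρ) (hc : HasCompactSupport ρ)
    (hu : LocallyIntegrable u) (z : E) : Integrable fun y => u y * ρ (z - y) := by
  have h := hu.integrable_smul_left_of_hasCompactSupport
    (g := fun y => ρ (z - y)) (hρ.comp (continuous_const.sub continuous_id))
    (hc.comp_homeomorph (Homeomorph.subLeft z))
  simpa [smul_eq_mul, mul_comm] using h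

variable [NormedSpace ℝ E]

/-- Smooth compactly supported probability densities. -/
structure IsMoll (ρ : E → ℝ) : Prop where
  contDiff : ContDiff ℝ (⊤ : ℕ∞) ρ
  hasCompactSupport : HasCompactSupport ρ
  nonneg : ∀ z, 0 ≤ ρ z
  integral_eq_one : ∫ z, ρ z = 1

lemma contDiff_moll {ρ u : E → ℝ} (hρ : ContDiff ℝ (⊤ : ℕ∞) ρ) (hc : HasCompactSupport ρ)
    (hu : LocallyIntegrable u) : ContDiff ℝ (⊤ : ℕ∞) (moll ρ u) := by
  rw [moll_eq_convolution]
  exact hc.contDiff_convolution_right _ hu hρ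

lemma IsMoll.contDiff_moll {ρ u : E → ℝ} (h : IsMoll ρ) (hu : LocallyIntegrable u) :
    ContDiff ℝ (⊤ : ℕ∞) (moll ρ u) :=
  _root_.contDiff_moll h.contDiff h.hasCompactSupport hu

variable [(volume : Measure E).IsAddHaarMeasure]

lemma IsMoll.integrable {ρ : E → ℝ} (h : IsMoll ρ) : Integrable ρ :=
  h.contDiff.continuous.integrable_of_hasCompactSupport h.hasCompactSupport

variable [FiniteDimensional ℝ E]

lemma fderiv_moll {ρ u : E → ℝ} (hρ : ContDiff ℝ (⊤ : ℕ∞) ρ) (hc : HasCompactSupport ρ)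
    (hu : LocallyIntegrable u) (z e : E) :
    fderiv ℝ (moll ρ u) z e = moll (fun w => fderiv ℝ ρ w e) u z := by
  have h := hc.hasFDerivAt_convolution_right (μ := volume) (ContinuousLinearMap.mul ℝ ℝ) hu
    (hρ.of_le (by simp)) z
  rw [moll_eq_convolution, h.fderiv, MeasureTheory.convolution_precompR_apply _ hu (hc.fderiv ℝ)
    (hρ.continuous_fderiv (by simp))]
  rfl

lemma IsMoll.integral_comp_sub {ρ : E → ℝ} (h : IsMoll ρ) (z : E) : ∫ y, ρ (z - y) = 1 := by
  rw [integral_sub_left_eq_self, h.integral_eq_one]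

lemma IsMoll.integrable_comp_sub {ρ : E → ℝ} (h : IsMoll ρ) (z : E) :
    Integrable fun y => ρ (z - y) := h.integrable.comp_sub_left z

lemma sq_integral_le_of_density {X : Type*} [MeasurableSpace X] {μ : Measure X} {u ρ : X → ℝ}
    (hρ0 : ∀ y, 0 ≤ ρ y) (hρ : Integrable ρ μ) (h1 : ∫ y, ρ y ∂μ = 1)
    (hu : Integrable (fun y => u y * ρ y) μ) (hu2 : Integrable (fun y => u y ^ 2 * ρ y) μ) :
    (∫ y, u y * ρ y ∂μ) ^ 2 ≤ ∫ y, u y ^ 2 * ρ y ∂μ := by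
  set m := ∫ y, u y * ρ y ∂μ
  have h : 0 ≤ ∫ y, (u y - m) ^ 2 * ρ y ∂μ :=
    integral_nonneg fun y => mul_nonneg (sq_nonneg _) (hρ0 y)
  have e : (fun y => (u y - m) ^ 2 * ρ y)
      = fun y => (u y ^ 2 * ρ y - 2 * m * (u y * ρ y)) + m ^ 2 * ρ y := by
    ext y; ring
  have i1 : Integrable (fun y => u y ^ 2 * ρ y - 2 * m * (u y * ρ y)) μ :=
    hu2.sub (hu.const_mul _)
  rw [e, integral_add i1 (hρ.const_mul _), integral_sub hu2 (hu.const_mul _), integral_const_mul,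
    integral_const_mul, h1] at h
  change 0 ≤ _ - 2 * m * m + m ^ 2 * 1 at h
  nlinarith

lemma sq_moll_le {ρ u : E → ℝ} (h : IsMoll ρ) (hu : MemLp u 2) (z : E) :
    moll ρ u z ^ 2 ≤ moll ρ (fun y => u y ^ 2) z :=
  sq_integral_le_of_density (fun _ => h.nonneg _) (h.integrable_comp_sub z)
    (h.integral_comp_sub z)
    (integrable_mul_comp_sub h.contDiff.continuous h.hasCompactSupport
      (memLp_two_locallyIntegrable hu) z)
    (integrable_mul_comp_sub h.contDiff.continuous h.hasCompactSupport
      hu.integrable_sq.locallyIntegrable z)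

lemma IsMoll.integral_moll {ρ u : E → ℝ} (h : IsMoll ρ) (hu : Integrable u) :
    ∫ z, moll ρ u z = ∫ z, u z := by
  rw [moll_eq_convolution, integral_convolution _ hu h.integrable, h.integral_eq_one]
  simp

lemma IsMoll.integrable_moll {ρ u : E → ℝ} (h : IsMoll ρ) (hu : Integrable u) :
    Integrable (moll ρ u) := 
  hu.integrable_convolution (ContinuousLinearMap.mul ℝ ℝ) h.integrable

lemma IsMoll.memLp_moll {ρ u : E → ℝ} (h : IsMoll ρ) (hu : MemLp u 2) : MemLp (moll ρ u) 2 := by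
  have hc := (h.contDiff_moll (memLp_two_locallyIntegrable hu)).continuous
  rw [memLp_two_iff_integrable_sq hc.aestronglyMeasurable]
  refine (h.integrable_moll hu.integrable_sq).mono' (hc.pow 2).aestronglyMeasurable ?_
  filter_upwards with z
  rw [norm_of_nonneg (sq_nonneg _)]
  exact sq_moll_le h hu z

lemma IsMoll.integral_sq_moll_le {ρ u : E → ℝ} (h : IsMoll ρ) (hu : MemLp u 2) :
    ∫ z, moll ρ u z ^ 2 ≤ ∫ z, u z ^ 2 := by
  rw [← h.integral_moll hu.integrable_sq]
  exact integral_mono (h.memLp_moll hu).integrable_sq (h.integrable_moll hu.integrable_sq)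
    (sq_moll_le h hu)

lemma moll_eq_integral_translate (ρ u : E → ℝ) (z : E) :
    moll ρ u z = ∫ y, u (z - y) * ρ y := by
  rw [moll, ← integral_sub_left_eq_self _ _ z]; simp

lemma tendsto_integral_sq_translate {u : E → ℝ} (hu : MemLp u 2) :
    Tendsto (fun y => ∫ z, (u (z - y) - u z) ^ 2) (nhds 0) (nhds 0) := by
  have : Fact ((1 : ENNReal) ≤ 2) := ⟨by norm_num⟩
  let g : E → C(E, E) := fun y => ⟨fun z => z - y, by fun_prop⟩
  have hgm : ∀ y, MeasurePreserving (g y) volume volume := fun y =>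
    measurePreserving_sub_right volume y
  have hg : Continuous g := ContinuousMap.continuous_of_continuous_uncurry _ (by
    change Continuous fun p : E × E => p.2 - p.1
    fun_prop)
  have h1 : Tendsto (fun y => Lp.compMeasurePreserving (g y) (hgm y) (hu.toLp u)) (nhds 0)
      (nhds (Lp.compMeasurePreserving (g 0) (hgm 0) (hu.toLp u))) :=
    Filter.Tendsto.compMeasurePreservingLp tendsto_const_nhds hg.continuousAt hgm (hgm 0)
      (by norm_num)
  rw [tendsto_iff_norm_sub_tendsto_zero] at h1
  have h2 := h1.pow 2
  simp only [ne_eq, OfNat.ofNat_ne_zero, not_false_eq_true, zero_pow] at h2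
  refine h2.congr fun y => ?_
  rw [← real_inner_self_eq_norm_sq, L2.inner_def]
  refine integral_congr_ae ?_
  have hy := Lp.coeFn_compMeasurePreserving (hu.toLp u) (hgm y)
  have h0 := Lp.coeFn_compMeasurePreserving (hu.toLp u) (hgm 0)
  have hy' := (hgm y).quasiMeasurePreserving.ae_eq_comp hu.coeFn_toLp
  have h0' := (hgm 0).quasiMeasurePreserving.ae_eq_comp hu.coeFn_toLp
  filter_upwards [Lp.coeFn_sub (Lp.compMeasurePreserving (g y) (hgm y) (hu.toLp u))
    (Lp.compMeasurePreserving (g 0) (hgm 0) (hu.toLp u)), hy, h0, hy', h0'] with z a1 a2 a3 a4 a5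
  rw [a1]
  simp only [Pi.sub_apply, a2, a3, a4, a5]
  simp [g, sq]

lemma IsMoll.tendsto_moll {ρ : ℕ → E → ℝ} (h : ∀ n, IsMoll (ρ n)) {δ : ℕ → ℝ}
    (hδ : Tendsto δ atTop (nhds 0)) (hs : ∀ n z, ρ n z ≠ 0 → ‖z‖ ≤ δ n) {u : E → ℝ}
    (hu : MemLp u 2) :
    Tendsto (fun n => ∫ z, (moll (ρ n) u z - u z) ^ 2) atTop (nhds 0) := by
  have hL := memLp_two_locallyIntegrable hu
  have htr : ∀ y, MemLp (fun z => u (z - y)) 2 := fun y =>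
    hu.comp_measurePreserving (measurePreserving_sub_right volume y)
  have hdi : ∀ y, Integrable fun z => (u (z - y) - u z) ^ 2 := fun y =>
    ((htr y).sub hu).integrable_sq
  have key : ∀ n, ∫ z, (moll (ρ n) u z - u z) ^ 2 ≤ ∫ y, (∫ z, (u (z - y) - u z) ^ 2) * ρ n y := by
    intro n
    have hmeas : AEStronglyMeasurable (fun p : E × E => (u (p.1 - p.2) - u p.1) ^ 2 * ρ n p.2)
        (volume.prod volume) := by
      have a1 : AEStronglyMeasurable (fun p : E × E => u (p.1 - p.2)) (volume.prod volume) :=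
        hu.1.comp_quasiMeasurePreserving (quasiMeasurePreserving_sub _ _)
      have a2 : AEStronglyMeasurable (fun p : E × E => u p.1) (volume.prod volume) := hu.1.comp_fst
      have a3 : AEStronglyMeasurable (fun p : E × E => ρ n p.2) (volume.prod volume) :=
        ((h n).contDiff.continuous.comp continuous_snd).aestronglyMeasurable
      exact ((a1.sub a2).pow 2).mul a3
    have hint : Integrable (fun p : E × E => (u (p.1 - p.2) - u p.1) ^ 2 * ρ n p.2)
        (volume.prod volume) := by
      rw [integrable_prod_iff' hmeas]
      refine ⟨Eventually.of_forall fun y => (hdi y).mul_const (ρ n y), ?_⟩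
      have hb : Integrable fun y => (4 * ∫ z, u z ^ 2) * ρ n y := (h n).integrable.const_mul _
      refine hb.mono' hmeas.norm.prod_swap.integral_prod_right' ?_
      filter_upwards with y
      have e : ∀ z, ‖(u (z - y) - u z) ^ 2 * ρ n y‖ = (u (z - y) - u z) ^ 2 * ρ n y := fun z =>
        norm_of_nonneg (mul_nonneg (sq_nonneg _) ((h n).nonneg y))
      simp only [e]
      rw [norm_of_nonneg (integral_nonneg fun z => mul_nonneg (sq_nonneg _) ((h n).nonneg y)),
        integral_mul_const]
      refine mul_le_mul_of_nonneg_right ?_ ((h n).nonneg y)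
      calc ∫ z, (u (z - y) - u z) ^ 2 ≤ ∫ z, (2 * u (z - y) ^ 2 + 2 * u z ^ 2) :=
            integral_mono (hdi y)
              (((htr y).integrable_sq.const_mul 2).add (hu.integrable_sq.const_mul 2))
              fun z => by nlinarith [sq_nonneg (u (z - y) + u z)]
        _ = 4 * ∫ z, u z ^ 2 := by
            rw [integral_add ((htr y).integrable_sq.const_mul 2) (hu.integrable_sq.const_mul 2),
              integral_const_mul, integral_const_mul,
              integral_sub_right_eq_self (fun z => u z ^ 2) y]
            ring
    rw [show (∫ y, (∫ z, (u (z - y) - u z) ^ 2) * ρ n y)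
        = ∫ y, ∫ z, (u (z - y) - u z) ^ 2 * ρ n y by simp_rw [integral_mul_const],
      ← integral_integral_swap hint]
    refine integral_mono_ae (((h n).memLp_moll hu).sub hu).integrable_sq hint.integral_prod_left ?_
    filter_upwards [hint.prod_right_ae] with z hz
    have i1 : Integrable fun y => u (z - y) * ρ n y := by
      have := (integrable_mul_comp_sub (h n).contDiff.continuous (h n).hasCompactSupport hL
        z).comp_sub_left z
      simpa using this
    have e1 : moll (ρ n) u z - u z = ∫ y, (u (z - y) - u z) * ρ n y := by
      simp only [sub_mul]
      rw [integral_sub i1 ((h n).integrable.const_mul _), integral_const_mul,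
        (h n).integral_eq_one, moll_eq_integral_translate, mul_one]
    rw [e1]
    refine sq_integral_le_of_density (h n).nonneg (h n).integrable (h n).integral_eq_one ?_ hz
    simp only [sub_mul]
    exact i1.sub ((h n).integrable.const_mul _)
  rw [Metric.tendsto_atTop]
  intro ε hε
  have ht := tendsto_integral_sq_translate hu
  rw [Metric.tendsto_nhds_nhds] at ht
  obtain ⟨η, hη, hη'⟩ := ht (ε / 2) (by positivity)
  obtain ⟨n0, hn0⟩ := (Metric.tendsto_atTop.1 hδ) η hη
  refine ⟨n0, fun n hn => ?_⟩
  have hd : δ n < η := lt_of_abs_lt (by simpa [Real.dist_eq] using hn0 n hn)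
  rw [Real.dist_eq, sub_zero, abs_of_nonneg (integral_nonneg fun z => sq_nonneg _)]
  have hb : ∀ y, (∫ z, (u (z - y) - u z) ^ 2) * ρ n y ≤ ε / 2 * ρ n y := by
    intro y
    by_cases hy : ρ n y = 0
    · simp [hy]
    refine mul_le_mul_of_nonneg_right ?_ ((h n).nonneg y)
    have := hη' (x := y) (by simpa using (hs n y hy).trans_lt hd)
    rw [Real.dist_eq, sub_zero] at this
    exact (le_abs_self _).trans this.le
  calc _ ≤ _ := key n
    _ ≤ ∫ y, ε / 2 * ρ n y := integral_mono_of_nonneg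
        (Eventually.of_forall fun y => mul_nonneg (integral_nonneg fun z => sq_nonneg _)
          ((h n).nonneg y)) ((h n).integrable.const_mul _) (Eventually.of_forall hb)
    _ = ε / 2 := by rw [integral_const_mul, (h n).integral_eq_one, mul_one]
    _ < ε := by linarith

end Mollification

section CauchySchwarz

variable {X : Type*} [MeasurableSpace X] {μ : Measure X}

lemma memLp_two_integrable_mul {f g : X → ℝ} (hf : MemLp f 2 μ) (hg : MemLp g 2 μ) :
    Integrable (fun x => f x * g x) μ := hf.integrable_mul hg

lemma sq_integral_mul_le {f g : X → ℝ} (hf : MemLp f 2 μ) (hg : MemLp g 2 μ) :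
    (∫ x, f x * g x ∂μ) ^ 2 ≤ (∫ x, f x ^ 2 ∂μ) * ∫ x, g x ^ 2 ∂μ := by
  have hfg := memLp_two_integrable_mul hf hg
  have h : ∀ s : ℝ, 0 ≤ (∫ x, g x ^ 2 ∂μ) * (s * s) + (2 * ∫ x, f x * g x ∂μ) * s
      + ∫ x, f x ^ 2 ∂μ := by
    intro s
    have h0 : 0 ≤ ∫ x, (f x + s * g x) ^ 2 ∂μ := integral_nonneg fun x => sq_nonneg _
    have e : (fun x => (f x + s * g x) ^ 2)
        = fun x => (f x ^ 2 + 2 * s * (f x * g x)) + s ^ 2 * g x ^ 2 := by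
      ext x; ring
    have i1 : Integrable (fun x => f x ^ 2 + 2 * s * (f x * g x)) μ :=
      hf.integrable_sq.add (hfg.const_mul _)
    rw [e, integral_add i1 (hg.integrable_sq.const_mul _),
      integral_add hf.integrable_sq (hfg.const_mul _), integral_const_mul,
      integral_const_mul] at h0
    linarith
  have := discrim_le_zero h
  rw [discrim] at this
  nlinarith

lemma tendsto_integral_mul_of_tendsto_sq {F W : ℕ → X → ℝ} {F' W' : X → ℝ}
    (hF : ∀ n, MemLp (F n) 2 μ) (hW : ∀ n, MemLp (W n) 2 μ) (hF' : MemLp F' 2 μ)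
    (hW' : MemLp W' 2 μ)
    (tF : Tendsto (fun n => ∫ x, (F n x - F' x) ^ 2 ∂μ) atTop (nhds 0))
    (tW : Tendsto (fun n => ∫ x, (W n x - W' x) ^ 2 ∂μ) atTop (nhds 0)) :
    Tendsto (fun n => ∫ x, F n x * W n x ∂μ) atTop (nhds (∫ x, F' x * W' x ∂μ)) := by
  have dF : ∀ n, MemLp (fun x => F n x - F' x) 2 μ := fun n => (hF n).sub hF'
  have dW : ∀ n, MemLp (fun x => W n x - W' x) 2 μ := fun n => (hW n).sub hW'
  have t0 : ∀ a : ℕ → ℝ, Tendsto (fun n => a n ^ 2) atTop (nhds 0) → Tendsto a atTop (nhds 0) := by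
    intro a ha
    have h1 := ha.sqrt
    simp only [Real.sqrt_sq_eq_abs, Real.sqrt_zero] at h1
    exact (tendsto_zero_iff_abs_tendsto_zero _).2 h1
  have t1 : Tendsto (fun n => ∫ x, (F n x - F' x) * (W n x - W' x) ∂μ) atTop (nhds 0) := by
    refine t0 _ (squeeze_zero (fun n => sq_nonneg _) (fun n => sq_integral_mul_le (dF n) (dW n)) ?_)
    simpa using tF.mul tW
  have t2 : Tendsto (fun n => ∫ x, (F n x - F' x) * W' x ∂μ) atTop (nhds 0) := by
    refine t0 _ (squeeze_zero (fun n => sq_nonneg _) (fun n => sq_integral_mul_le (dF n) hW') ?_)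
    simpa using tF.mul_const (∫ x, W' x ^ 2 ∂μ)
  have t3 : Tendsto (fun n => ∫ x, F' x * (W n x - W' x) ∂μ) atTop (nhds 0) := by
    refine t0 _ (squeeze_zero (fun n => sq_nonneg _) (fun n => sq_integral_mul_le hF' (dW n)) ?_)
    simpa using tW.const_mul (∫ x, F' x ^ 2 ∂μ)
  have t := ((t1.add t2).add t3).add_const (∫ x, F' x * W' x ∂μ)
  simp only [add_zero, zero_add] at t
  refine t.congr fun n => ?_
  have i1 := memLp_two_integrable_mul (dF n) (dW n)
  have i2 := memLp_two_integrable_mul (dF n) hW'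
  have i3 := memLp_two_integrable_mul hF' (dW n)
  have i4 := memLp_two_integrable_mul hF' hW'
  have i12 : Integrable (fun x => (F n x - F' x) * (W n x - W' x) + (F n x - F' x) * W' x) μ :=
    i1.add i2
  have i123 : Integrable (fun x => (F n x - F' x) * (W n x - W' x) + (F n x - F' x) * W' x
      + F' x * (W n x - W' x)) μ := i12.add i3
  rw [← integral_add i1 i2, ← integral_add i12 i3, ← integral_add i123 i4]
  refine integral_congr_ae (Eventually.of_forall fun x => ?_)
  ring

/-- `L²` convergence implies a.e. convergence along a subsequence. -/
lemma exists_subseq_ae_of_tendsto_sq {F : ℕ → X → ℝ} {F' : X → ℝ}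
    (hF : ∀ n, MemLp (F n) 2 μ) (hF' : MemLp F' 2 μ)
    (tF : Tendsto (fun n => ∫ x, (F n x - F' x) ^ 2 ∂μ) atTop (nhds 0)) :
    ∃ ns : ℕ → ℕ, StrictMono ns ∧
      ∀ᵐ x ∂μ, Tendsto (fun k => F (ns k) x) atTop (nhds (F' x)) := by
  have h : Tendsto (fun n => eLpNorm (F n - F') 2 μ) atTop (nhds 0) := by
    have e : ∀ n, eLpNorm (F n - F') 2 μ
        = ENNReal.ofReal ((∫ x, (F n x - F' x) ^ 2 ∂μ) ^ ((1 : ℝ) / 2)) := by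
      intro n
      rw [((hF n).sub hF').eLpNorm_eq_integral_rpow_norm (by norm_num) (by norm_num)]
      simp
    simp only [e]
    have t := tF.rpow_const (p := (1 : ℝ) / 2) (Or.inr (by norm_num))
    rw [Real.zero_rpow (by norm_num)] at t
    simpa using ENNReal.tendsto_ofReal t
  exact (tendstoInMeasure_of_tendsto_eLpNorm (by norm_num) (fun n => (hF n).1) hF'.1
    h).exists_seq_tendsto_ae

end CauchySchwarz

/-- `∂_{x_i}` of a function on phase space. -/
def dX {N : ℕ} (i : Fin N) (ψ : En N × En N → ℝ) (z : En N × En N) : ℝ :=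
  fderiv ℝ ψ z (EuclideanSpace.single i 1, 0)

/-- `∂_{v_i}` of a function on phase space. -/
def dV {N : ℕ} (i : Fin N) (ψ : En N × En N → ℝ) (z : En N × En N) : ℝ :=
  fderiv ℝ ψ z (0, EuclideanSpace.single i 1)

/-- The transport operator `v · ∇ₓ`; applied to a mollifier `ρ` this is also the kernel of the
commutator of `v · ∇ₓ` with convolution by `ρ`. -/
def transport {N : ℕ} (ρ : En N × En N → ℝ) (z : En N × En N) : ℝ :=
  ∑ i, z.2 i * dX i ρ z

lemma continuous_transport {N : ℕ} {ρ : En N × En N → ℝ} (h : ContDiff ℝ (⊤ : ℕ∞) ρ) :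
    Continuous (transport ρ) := by
  have := h.continuous_fderiv (by simp)
  unfold transport dX
  fun_prop

lemma hasCompactSupport_transport {N : ℕ} {ρ : En N × En N → ℝ} (h : HasCompactSupport ρ) :
    HasCompactSupport (transport ρ) := by
  refine (h.fderiv ℝ).mono fun z hz => ?_
  contrapose! hz
  simp only [Function.mem_support, not_not] at hz ⊢
  simp [transport, dX, hz]

lemma ContDiffBump.isMoll_normed {E : Type*} [NormedAddCommGroup E] [NormedSpace ℝ E]
    [FiniteDimensional ℝ E] [MeasureSpace E] [BorelSpace E]
    [(volume : Measure E).IsAddHaarMeasure] [HasContDiffBump E] (φ : ContDiffBump (0 : E)) :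
    IsMoll (φ.normed volume) :=
  ⟨φ.contDiff_normed, φ.hasCompactSupport_normed, φ.nonneg_normed, φ.integral_normed⟩

lemma IsMoll.prod {N : ℕ} {ρ₁ ρ₂ : En N → ℝ} (h₁ : IsMoll ρ₁) (h₂ : IsMoll ρ₂) :
    IsMoll fun z : En N × En N => ρ₁ z.1 * ρ₂ z.2 where
  contDiff := (h₁.contDiff.comp contDiff_fst).mul (h₂.contDiff.comp contDiff_snd)
  hasCompactSupport := by
    refine HasCompactSupport.intro (h₁.hasCompactSupport.isCompact.prod
      h₂.hasCompactSupport.isCompact) fun z hz => ?_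
    rw [Set.mem_prod, not_and_or] at hz
    rcases hz with hz | hz
    · rw [image_eq_zero_of_notMem_tsupport hz, zero_mul]
    · rw [image_eq_zero_of_notMem_tsupport hz, mul_zero]
  nonneg z := mul_nonneg (h₁.nonneg _) (h₂.nonneg _)
  integral_eq_one := by
    rw [Measure.volume_eq_prod, integral_prod_mul, h₁.integral_eq_one, h₂.integral_eq_one, one_mul]

lemma fderiv_mul_prod_apply_fst {E F : Type*} [NormedAddCommGroup E] [NormedSpace ℝ E]
    [NormedAddCommGroup F] [NormedSpace ℝ F] {u : E → ℝ} {w : F → ℝ}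
    (hu : Differentiable ℝ u) (hw : Differentiable ℝ w) (z : E × F) (e : E) :
    fderiv ℝ (fun z : E × F => u z.1 * w z.2) z (e, 0) = fderiv ℝ u z.1 e * w z.2 := by
  have d₁ : HasFDerivAt (fun z : E × F => u z.1) _ z :=
    (hu z.1).hasFDerivAt.comp z hasFDerivAt_fst
  have d₂ : HasFDerivAt (fun z : E × F => w z.2) _ z :=
    (hw z.2).hasFDerivAt.comp z hasFDerivAt_snd
  have d := (d₁.mul d₂).fderiv
  change fderiv ℝ (fun z : E × F => u z.1 * w z.2) z = _ at d
  rw [d]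
  simp only [_root_.add_apply, _root_.smul_apply,
    ContinuousLinearMap.comp_apply, ContinuousLinearMap.coe_fst', ContinuousLinearMap.coe_snd',
    map_zero, smul_eq_mul]
  ring

/-- Mollifiers that are much more concentrated in `v` than in `x`, so that the commutator with
`v · ∇ₓ` is small. -/
lemma exists_isMoll_transport_le (N : ℕ) {δ : ℝ} (hδ : 0 < δ) :
    ∃ ρ : En N × En N → ℝ, IsMoll ρ ∧ (∀ z, ρ z ≠ 0 → ‖z‖ ≤ δ) ∧
      ∫ z, |transport ρ z| ≤ δ := by
  let φ : ContDiffBump (0 : En N) := ⟨δ / 2, δ, by positivity, by linarith⟩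
  set ρ₁ : En N → ℝ := φ.normed volume with hρ₁
  have h₁ : IsMoll ρ₁ := φ.isMoll_normed
  set g : En N → ℝ := fun x => ∑ i, |fderiv ℝ ρ₁ x (EuclideanSpace.single i 1)| with hg
  have hgc : Continuous g := by
    have := h₁.contDiff.continuous_fderiv (by simp)
    rw [hg]; fun_prop
  have hgi : Integrable g := by
    refine hgc.integrable_of_hasCompactSupport
      ((h₁.hasCompactSupport.fderiv ℝ).mono fun z hz => ?_)
    contrapose! hz
    simp only [Function.mem_support, not_not] at hz ⊢
    simp [hg, hz]
  have hg0 : 0 ≤ ∫ x, g x := integral_nonneg fun x => Finset.sum_nonneg fun i _ => abs_nonneg _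
  set r : ℝ := δ / (1 + ∫ x, g x) with hr
  have hr0 : 0 < r := by positivity
  have hrδ : r ≤ δ := div_le_self hδ.le (by linarith)
  let ψ : ContDiffBump (0 : En N) := ⟨r / 2, r, by positivity, by linarith⟩
  set ρ₂ : En N → ℝ := ψ.normed volume with hρ₂
  have h₂ : IsMoll ρ₂ := ψ.isMoll_normed
  have s₁ : ∀ x, ρ₁ x ≠ 0 → ‖x‖ ≤ δ := fun x hx => by
    have : x ∈ Function.support ρ₁ := hx
    rw [hρ₁, φ.support_normed_eq, mem_ball_zero_iff] at this
    exact this.le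
  have s₂ : ∀ x, ρ₂ x ≠ 0 → ‖x‖ ≤ r := fun x hx => by
    have : x ∈ Function.support ρ₂ := hx
    rw [hρ₂, ψ.support_normed_eq, mem_ball_zero_iff] at this
    exact this.le
  have h := h₁.prod h₂
  refine ⟨_, h, fun z hz => ?_, ?_⟩
  · have := mul_ne_zero_iff.1 hz
    exact max_le (s₁ _ this.1) ((s₂ _ this.2).trans hrδ)
  have hd : ∀ z e, fderiv ℝ (fun z : En N × En N => ρ₁ z.1 * ρ₂ z.2) z (e, 0)
      = fderiv ℝ ρ₁ z.1 e * ρ₂ z.2 :=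
    fun z e => fderiv_mul_prod_apply_fst (h₁.contDiff.differentiable (by simp))
      (h₂.contDiff.differentiable (by simp)) z e
  have hb : ∀ z : En N × En N, |transport (fun z : En N × En N => ρ₁ z.1 * ρ₂ z.2) z|
      ≤ g z.1 * (r * ρ₂ z.2) := by
    intro z
    simp only [transport, dX, hd]
    refine (Finset.abs_sum_le_sum_abs _ _).trans ?_
    rw [hg, Finset.sum_mul]
    refine Finset.sum_le_sum fun i _ => ?_
    rw [abs_mul, abs_mul, abs_of_nonneg (h₂.nonneg z.2)]
    by_cases hz : ρ₂ z.2 = 0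
    · simp [hz]
    have hv : |z.2 i| ≤ r := (PiLp.norm_apply_le z.2 i).trans (s₂ _ hz)
    calc |z.2 i| * (|fderiv ℝ ρ₁ z.1 (EuclideanSpace.single i 1)| * ρ₂ z.2)
        ≤ r * (|fderiv ℝ ρ₁ z.1 (EuclideanSpace.single i 1)| * ρ₂ z.2) :=
          mul_le_mul_of_nonneg_right hv (mul_nonneg (abs_nonneg _) (h₂.nonneg _))
      _ = _ := by ring
  have hi : Integrable fun z : En N × En N => g z.1 * (r * ρ₂ z.2) := by
    rw [Measure.volume_eq_prod]
    exact hgi.mul_prod (h₂.integrable.const_mul r)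
  calc ∫ z, |transport (fun z : En N × En N => ρ₁ z.1 * ρ₂ z.2) z|
      ≤ ∫ z : En N × En N, g z.1 * (r * ρ₂ z.2) :=
        integral_mono_of_nonneg (Eventually.of_forall fun _ => abs_nonneg _) hi
          (Eventually.of_forall hb)
    _ = (∫ x, g x) * r := by
        rw [Measure.volume_eq_prod, integral_prod_mul g fun v => r * ρ₂ v, integral_const_mul,
          h₂.integral_eq_one, mul_one]
    _ ≤ δ := by
        rw [hr, mul_div_assoc', div_le_iff₀ (by positivity)]
        nlinarith

/-- Chain rule for a primitive of an integrable function. -/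
lemma comp_sub_comp_eq_integral {β β' g G : ℝ → ℝ} {c d t : ℝ} (ht : 0 ≤ t)
    (hG : IntervalIntegrable G volume 0 t) (hg : ∀ s ∈ Icc 0 t, g s = g 0 + ∫ τ in 0..s, G τ)
    (hgc : ∀ s ∈ Icc 0 t, g s ∈ Icc c d) (hβ : ∀ s ∈ Icc c d, HasDerivAt β (β' s) s)
    {K : ℝ} (hK : ∀ s ∈ Icc c d, |β' s| ≤ K) :
    β (g t) - β (g 0) = ∫ τ in 0..t, β' (g τ) * G τ := by
  set p : ℝ → ℝ := fun s => g 0 + ∫ τ in 0..s, G τ with hp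
  have hpc : ∀ s ∈ Icc 0 t, p s ∈ Icc c d := fun s hs => by
    rw [hp]; simpa only [← hg s hs] using hgc s hs
  have hac : AbsolutelyContinuousOnInterval p 0 t := by
    have h1 := hG.absolutelyContinuousOnInterval_intervalIntegral (c := 0) left_mem_uIcc
    have h2 : AbsolutelyContinuousOnInterval (fun _ : ℝ => g 0) 0 t :=
      (LipschitzWith.const (g 0)).lipschitzOnWith.absolutelyContinuousOnInterval
    exact h2.add h1
  have hK0 : 0 ≤ K := (abs_nonneg _).trans (hK _ (hpc 0 ⟨le_rfl, ht⟩))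
  have hL : ∀ x ∈ Icc c d, ∀ y ∈ Icc c d, dist (β x) (β y) ≤ K * dist x y := by
    intro x hx y hy
    have := (convex_Icc c d).norm_image_sub_le_of_norm_hasDerivWithin_le (C := K)
      (fun s hs => (hβ s hs).hasDerivWithinAt) (fun s hs => by simpa using hK s hs) hy hx
    simpa [Real.dist_eq] using this
  have hacβ : AbsolutelyContinuousOnInterval (fun s => β (p s)) 0 t := by
    rw [absolutelyContinuousOnInterval_iff] at hac ⊢
    intro ε hε
    obtain ⟨δ, hδ, h⟩ := hac (ε / (K + 1)) (by positivity)
    refine ⟨δ, hδ, fun E hE hE' => ?_⟩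
    have hm : ∀ i ∈ Finset.range E.1, (E.2 i).1 ∈ Icc 0 t ∧ (E.2 i).2 ∈ Icc 0 t := by
      have := hE.1
      rw [uIcc_of_le ht] at this
      exact this
    calc _ ≤ ∑ i ∈ Finset.range E.1, K * dist (p (E.2 i).1) (p (E.2 i).2) :=
          Finset.sum_le_sum fun i hi => hL _ (hpc _ (hm i hi).1) _ (hpc _ (hm i hi).2)
      _ = K * ∑ i ∈ Finset.range E.1, dist (p (E.2 i).1) (p (E.2 i).2) := by
          rw [Finset.mul_sum]
      _ ≤ (K + 1) * ∑ i ∈ Finset.range E.1, dist (p (E.2 i).1) (p (E.2 i).2) := by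
          gcongr
          linarith
      _ < (K + 1) * (ε / (K + 1)) := by
          gcongr
          exact h E hE hE'
      _ = ε := by field_simp
  have hfund := hacβ.integral_deriv_eq_sub
  have e0 : p 0 = g 0 := by simp [hp]
  have et : p t = g t := (hg t ⟨ht, le_rfl⟩).symm
  simp only [e0, et] at hfund
  rw [← hfund]
  refine intervalIntegral.integral_congr_ae ?_
  filter_upwards [hG.ae_hasDerivAt_integral] with τ hτ hτ'
  have hm : τ ∈ Icc 0 t := by
    rw [uIoc_of_le ht] at hτ'
    exact ⟨hτ'.1.le, hτ'.2⟩
  have h1 : HasDerivAt p (G τ) τ :=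
    (hτ (by rwa [uIcc_of_le ht]) 0 left_mem_uIcc).const_add (g 0)
  have h2 := ((hβ _ (hpc τ hm)).comp τ h1).deriv
  change deriv (fun s => β (p s)) τ = _ at h2
  rw [h2, hg τ hm]

section Primitive

lemma abs_integral_mul_sub_le {w ρ : ℝ → ℝ} {s δ η : ℝ} (hρ0 : ∀ x, 0 ≤ ρ x)
    (hρi : ∫ x, ρ x = 1) (hρs : ∀ x, ρ x ≠ 0 → |x| ≤ δ)
    (hw : ∀ y, |y - s| ≤ δ → |w y - w s| ≤ η)
    (hi : Integrable fun y => w y * ρ (y - s)) :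
    |(∫ y, w y * ρ (y - s)) - w s| ≤ η := by
  have hρI : Integrable ρ := by
    by_contra h
    rw [integral_undef h] at hρi
    exact zero_ne_one hρi
  have hρI' : Integrable fun y => ρ (y - s) := hρI.comp_sub_right s
  have e1 : ∫ y, ρ (y - s) = 1 := by rw [integral_sub_right_eq_self ρ s, hρi]
  have e : (∫ y, w y * ρ (y - s)) - w s = ∫ y, (w y - w s) * ρ (y - s) := by
    simp only [sub_mul]
    rw [integral_sub hi (hρI'.const_mul _), integral_const_mul, e1, mul_one]
  rw [e, ← Real.norm_eq_abs]
  calc _ ≤ ∫ y, η * ρ (y - s) := by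
        refine norm_integral_le_of_norm_le (hρI'.const_mul η) (Eventually.of_forall fun y => ?_)
        rw [norm_mul, Real.norm_of_nonneg (hρ0 _)]
        by_cases h : ρ (y - s) = 0
        · simp [h]
        · exact mul_le_mul_of_nonneg_right (hw y (hρs _ h)) (hρ0 _)
    _ = η := by rw [integral_const_mul, e1, mul_one]

lemma exists_contDiff_deriv_eq_sub {ρ : ℝ → ℝ} {s t δ : ℝ} (hρ : ContDiff ℝ (⊤ : ℕ∞) ρ)
    (hρs : ∀ x, ρ x ≠ 0 → |x| ≤ δ) (hst : s ≤ t) :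
    ∃ θ : ℝ → ℝ, ContDiff ℝ (⊤ : ℕ∞) θ ∧ tsupport θ ⊆ Icc (s - δ) (t + δ) ∧
      ∀ y, deriv θ y = ρ (y - s) - ρ (y - t) := by
  have hc := hρ.continuous
  set R : ℝ → ℝ := fun x => ∫ y in 0..x, ρ y with hR
  have hRd : ∀ x, HasDerivAt R (ρ x) x := fun x =>
    intervalIntegral.integral_hasDerivAt_right (hc.intervalIntegrable _ _)
      hc.aestronglyMeasurable.stronglyMeasurableAtFilter hc.continuousAt
  have hRs : ContDiff ℝ (⊤ : ℕ∞) R := by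
    rw [contDiff_infty_iff_deriv]
    exact ⟨fun x => (hRd x).differentiableAt, by
      rw [show deriv R = ρ from funext fun x => (hRd x).deriv]; exact hρ⟩
  refine ⟨fun y => R (y - s) - R (y - t), ?_, ?_, fun y => ?_⟩
  · exact (hRs.comp (contDiff_id.sub contDiff_const)).sub
      (hRs.comp (contDiff_id.sub contDiff_const))
  · refine closure_minimal (fun y hy => ?_) isClosed_Icc
    by_contra hn
    apply hy
    have e : R (y - s) - R (y - t) = ∫ x in (y - t)..(y - s), ρ x :=
      intervalIntegral.integral_interval_sub_left (hc.intervalIntegrable _ _)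
        (hc.intervalIntegrable _ _)
    change R (y - s) - R (y - t) = 0
    rw [e]
    refine intervalIntegral.integral_zero_ae (Eventually.of_forall fun x hx => ?_)
    rw [uIoc_of_le (by linarith)] at hx
    by_contra h0
    have := abs_le.1 (hρs x h0)
    exact hn ⟨by linarith [hx.1, hx.2], by linarith [hx.1, hx.2]⟩
  · have h1 : HasDerivAt (fun y => R (y - s)) (ρ (y - s)) y := by
      simpa using (hRd (y - s)).comp_sub_const y s
    have h2 : HasDerivAt (fun y => R (y - t)) (ρ (y - t)) y := by
      simpa using (hRd (y - t)).comp_sub_const y t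
    exact (h1.sub h2).deriv

lemma eq_of_integral_mul_deriv_eq_zero {w : ℝ → ℝ} {a b : ℝ} (hw : ContinuousOn w (Ioo a b))
    (h : ∀ θ : ℝ → ℝ, ContDiff ℝ (⊤ : ℕ∞) θ → HasCompactSupport θ → tsupport θ ⊆ Ioo a b →
      ∫ t, w t * deriv θ t = 0) {s t : ℝ} (hs : s ∈ Ioo a b) (ht : t ∈ Ioo a b) : w s = w t := by
  wlog hst : s ≤ t generalizing s t
  · exact (this ht hs (le_of_not_ge hst)).symm
  refine eq_of_forall_dist_le fun η hη => ?_
  have key : ∀ r ∈ Ioo a b, ∃ δ > 0, Icc (r - δ) (r + δ) ⊆ Ioo a b ∧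
      ∀ y, |y - r| ≤ δ → |w y - w r| ≤ η / 2 := by
    intro r hr
    have h1 := (hw.continuousAt (isOpen_Ioo.mem_nhds hr)).eventually
      (Metric.closedBall_mem_nhds (w r) (half_pos hη))
    obtain ⟨δ, hδ, hb⟩ := Metric.nhds_basis_closedBall.eventually_iff.1
      (h1.and (isOpen_Ioo.mem_nhds hr))
    refine ⟨δ, hδ, fun y hy => (hb ?_).2, fun y hy => ?_⟩
    · rw [← Real.closedBall_eq_Icc] at hy; exact hy
    · have := (hb (show y ∈ closedBall r δ by rwa [mem_closedBall, Real.dist_eq])).1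
      rwa [Real.dist_eq] at this
  obtain ⟨δ₁, hδ₁, hI₁, hw₁⟩ := key s hs
  obtain ⟨δ₂, hδ₂, hI₂, hw₂⟩ := key t ht
  set δ := min δ₁ δ₂ with hδ
  have hδ0 : 0 < δ := lt_min hδ₁ hδ₂
  let φ : ContDiffBump (0 : ℝ) := ⟨δ / 2, δ, by positivity, by linarith⟩
  set ρ : ℝ → ℝ := φ.normed volume with hρ
  have hm : IsMoll ρ := φ.isMoll_normed
  have hρs : ∀ x, ρ x ≠ 0 → |x| ≤ δ := fun x hx => by
    have : x ∈ Function.support ρ := hx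
    rw [hρ, φ.support_normed_eq, mem_ball_zero_iff] at this
    exact this.le
  have hsub : Icc (s - δ) (t + δ) ⊆ Ioo a b := fun y hy =>
    ⟨(hI₁ ⟨le_rfl, by linarith⟩).1.trans_le (by linarith [hy.1, min_le_left δ₁ δ₂]),
      lt_of_le_of_lt (by linarith [hy.2, min_le_right δ₁ δ₂]) (hI₂ ⟨by linarith, le_rfl⟩).2⟩
  have hint : ∀ r, s ≤ r → r ≤ t → Integrable fun y => w y * ρ (y - r) := by
    intro r h1 h2
    have hcont : Continuous fun y => w y * ρ (y - r) := by
      refine continuous_iff_continuousAt.2 fun y => ?_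
      by_cases hy : y ∈ Ioo a b
      · exact (hw.continuousAt (isOpen_Ioo.mem_nhds hy)).mul
          (hm.contDiff.continuous.comp (continuous_id.sub continuous_const)).continuousAt
      · have hn : (Icc (s - δ) (t + δ))ᶜ ∈ nhds y :=
          isClosed_Icc.isOpen_compl.mem_nhds fun h => hy (hsub h)
        refine (continuousAt_const (y := (0 : ℝ))).congr ?_
        filter_upwards [hn] with x hx
        by_cases h0 : ρ (x - r) = 0
        · simp [h0]
        · have := abs_le.1 (hρs _ h0)
          exact absurd ⟨by linarith, by linarith⟩ hx
    refine hcont.integrable_of_hasCompactSupport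
      (HasCompactSupport.intro (isCompact_Icc (a := s - δ) (b := t + δ)) fun x hx => ?_)
    by_cases h0 : ρ (x - r) = 0
    · simp [h0]
    · have := abs_le.1 (hρs _ h0)
      exact absurd ⟨by linarith, by linarith⟩ hx
  obtain ⟨θ, hθ, hθs, hθd⟩ := exists_contDiff_deriv_eq_sub hm.contDiff hρs hst
  have h0 := h θ hθ (HasCompactSupport.of_support_subset_isCompact isCompact_Icc
    ((subset_tsupport θ).trans hθs)) (hθs.trans hsub)
  simp only [hθd, mul_sub] at h0
  rw [integral_sub (hint s le_rfl hst) (hint t hst le_rfl)] at h0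
  have b1 := abs_integral_mul_sub_le hm.nonneg hm.integral_eq_one hρs
    (fun y hy => hw₁ y (hy.trans (min_le_left _ _))) (hint s le_rfl hst)
  have b2 := abs_integral_mul_sub_le hm.nonneg hm.integral_eq_one hρs
    (fun y hy => hw₂ y (hy.trans (min_le_right _ _))) (hint t hst le_rfl)
  rw [Real.dist_eq, abs_le]
  rw [abs_le] at b1 b2
  constructor <;> linarith [b1.1, b1.2, b2.1, b2.2]

lemma eq_add_integral_of_weak {m H : ℝ → ℝ} {T c : ℝ} (hmc : ContinuousOn m (Ioo 0 T))
    (hH : IntegrableOn H (Ioo 0 T)) (hlim : Tendsto m (nhdsWithin 0 (Ioi 0)) (nhds c))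
    (h : ∀ θ : ℝ → ℝ, ContDiff ℝ (⊤ : ℕ∞) θ → HasCompactSupport θ → tsupport θ ⊆ Ioo 0 T →
      ∫ t, m t * deriv θ t = -∫ t, H t * θ t) :
    ∀ t ∈ Ioo 0 T, m t = c + ∫ τ in 0..t, H τ := by
  intro t ht
  have hT : 0 < T := ht.1.trans ht.2
  have hHi : IntervalIntegrable H volume 0 T := by
    rw [intervalIntegrable_iff_integrableOn_Ioo_of_le hT.le]; exact hH
  set P : ℝ → ℝ := fun s => ∫ τ in 0..s, H τ with hP
  have hPa : AbsolutelyContinuousOnInterval P 0 T :=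
    hHi.absolutelyContinuousOnInterval_intervalIntegral left_mem_uIcc
  have hPc : ContinuousOn P (Icc 0 T) := by
    have := hPa.continuousOn
    rwa [uIcc_of_le hT.le] at this
  have hw : ContinuousOn (fun s => m s - P s) (Ioo 0 T) :=
    hmc.sub (hPc.mono Ioo_subset_Icc_self)
  have hconst : ∀ s ∈ Ioo 0 T, m s - P s = m t - P t := by
    intro s hs
    refine eq_of_integral_mul_deriv_eq_zero hw (fun θ hθ hθc hθs => ?_) hs ht
    have hdz : ∀ x, x ∉ Ioo 0 T → θ x = 0 ∧ deriv θ x = 0 := fun x hx => by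
      have : x ∉ tsupport θ := fun h => hx (hθs h)
      refine ⟨image_eq_zero_of_notMem_tsupport this, ?_⟩
      exact image_eq_zero_of_notMem_tsupport fun h => this (tsupport_deriv_subset h)
    have hdc : Continuous (deriv θ) := hθ.continuous_deriv (by simp)
    have ext0 : ∀ u : ℝ → ℝ, (∀ x, x ∉ Ioo 0 T → u x = 0) → ∫ x, u x = ∫ x in 0..T, u x := by
      intro u hu
      rw [intervalIntegral.integral_of_le hT.le, setIntegral_eq_integral_of_forall_compl_eq_zero]
      intro x hx
      exact hu x fun h' => hx ⟨h'.1, h'.2.le⟩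
    have e1 : ∫ x, P x * deriv θ x = -∫ x, H x * θ x := by
      rw [ext0 _ fun x hx => by simp [(hdz x hx).2], ext0 _ fun x hx => by simp [(hdz x hx).1]]
      have hθa : AbsolutelyContinuousOnInterval θ 0 T := by
        obtain ⟨K, hK⟩ := hθ.lipschitzWith_of_hasCompactSupport hθc (by simp)
        exact hK.lipschitzOnWith.absolutelyContinuousOnInterval
      rw [hPa.integral_mul_deriv_eq_deriv_mul hθa, (hdz T (by simp)).1, (hdz 0 (by simp)).1]
      simp only [mul_zero, sub_zero, zero_sub, neg_inj]
      refine intervalIntegral.integral_congr_ae ?_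
      filter_upwards [hHi.ae_hasDerivAt_integral] with τ hτ hτ'
      have := (hτ (uIoc_subset_uIcc hτ') 0 left_mem_uIcc).deriv
      change deriv P τ = _ at this
      rw [this]
    have im : ∀ u : ℝ → ℝ, ContinuousOn u (Ioo 0 T) → Integrable fun x => u x * deriv θ x := by
      intro u hu
      have hcont : Continuous fun y => u y * deriv θ y := by
        refine continuous_iff_continuousAt.2 fun y => ?_
        by_cases hy : y ∈ Ioo 0 T
        · exact (hu.continuousAt (isOpen_Ioo.mem_nhds hy)).mul hdc.continuousAt
        · have hn : (tsupport θ)ᶜ ∈ nhds y :=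
            (isClosed_tsupport θ).isOpen_compl.mem_nhds fun h => hy (hθs h)
          refine (continuousAt_const (y := (0 : ℝ))).congr ?_
          filter_upwards [hn] with x hx
          rw [image_eq_zero_of_notMem_tsupport fun h => hx (tsupport_deriv_subset h), mul_zero]
      exact hcont.integrable_of_hasCompactSupport (hθc.deriv.mul_left)
    simp only [sub_mul]
    rw [integral_sub (im m hmc) (im P (hPc.mono Ioo_subset_Icc_self)), h θ hθ hθc hθs, e1, sub_self]
  have hP0 : Tendsto P (nhdsWithin 0 (Ioi 0)) (nhds 0) := by
    have h1 : ContinuousWithinAt P (Icc 0 T) 0 := hPc 0 ⟨le_rfl, hT.le⟩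
    have h2 : P 0 = 0 := by simp [hP]
    rw [ContinuousWithinAt, h2] at h1
    refine h1.mono_left ?_
    rw [← nhdsWithin_Ioo_eq_nhdsGT hT]
    exact nhdsWithin_mono _ Ioo_subset_Icc_self
  have hl := hlim.sub hP0
  have hl' : Tendsto (fun s => m s - P s) (nhdsWithin 0 (Ioi 0)) (nhds (m t - P t)) := by
    refine tendsto_const_nhds.congr' ?_
    rw [← nhdsWithin_Ioo_eq_nhdsGT hT]
    filter_upwards [self_mem_nhdsWithin] with s hs
    exact (hconst s hs).symm
  have := tendsto_nhds_unique hl hl'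
  rw [sub_zero] at this
  rw [this]; ring

end Primitive

section Slab

variable {Ω : Type*} [MeasurableSpace Ω] {ν : Measure Ω}
variable {E : Type*} [NormedAddCommGroup E] [NormedSpace ℝ E] [FiniteDimensional ℝ E]
  [MeasureSpace E] [(volume : Measure E).IsAddHaarMeasure]

lemma measurable_integral_comp_mul {k : E × E → ℝ} (hk : Measurable k) {u : Ω × E → ℝ}
    (hu : Measurable u) : Measurable fun p : Ω × E => ∫ y, u (p.1, y) * k (p.2, y) := by
  have : StronglyMeasurable fun q : (Ω × E) × E => u (q.1.1, q.2) * k (q.1.2, q.2) := by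
    apply Measurable.stronglyMeasurable
    fun_prop
  exact this.integral_prod_right.measurable

lemma memLp_two_of_measurable {X : Type*} [MeasurableSpace X] {μ : Measure X} {u : X → ℝ}
    (hu : Measurable u) (h : Integrable (fun x => u x ^ 2) μ) : MemLp u 2 μ :=
  (memLp_two_iff_integrable_sq hu.aestronglyMeasurable).2 h

/-- An `L²` function on a slab times an `L²` function of the space variable. -/
lemma integrable_mul_comp_snd [IsFiniteMeasure ν] {u : Ω × E → ℝ} {k : E → ℝ}
    (hu : MemLp u 2 (ν.prod (volume : Measure E))) (hk : MemLp k 2 (volume : Measure E)) :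
    Integrable (fun p : Ω × E => u p * k p.2) (ν.prod volume) :=
  memLp_two_integrable_mul hu (hk.comp_snd ν)

variable [SFinite ν]

lemma ae_memLp_section {u : Ω × E → ℝ} (hu : Measurable u)
    (h : MemLp u 2 (ν.prod (volume : Measure E))) :
    ∀ᵐ τ ∂ν, MemLp (fun y => u (τ, y)) 2 (volume : Measure E) := by
  filter_upwards [h.integrable_sq.prod_right_ae] with τ hτ
  exact memLp_two_of_measurable (hu.comp measurable_prodMk_left) hτ

variable [BorelSpace E]

lemma measurable_moll_prod {ρ : E → ℝ} (hρ : Continuous ρ) {u : Ω × E → ℝ} (hu : Measurable u) :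
    Measurable fun p : Ω × E => moll ρ (fun y => u (p.1, y)) p.2 :=
  measurable_integral_comp_mul (k := fun q => ρ (q.1 - q.2))
    (by have := hρ.measurable; fun_prop) hu

lemma IsMoll.memLp_moll_prod {ρ : E → ℝ} (hρ : IsMoll ρ) {u : Ω × E → ℝ} (hu : Measurable u)
    (h : MemLp u 2 (ν.prod (volume : Measure E))) :
    MemLp (fun p : Ω × E => moll ρ (fun y => u (p.1, y)) p.2) 2
      (ν.prod (volume : Measure E)) := by
  have hm := measurable_moll_prod (hρ.contDiff.continuous) hu
  refine memLp_two_of_measurable hm ?_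
  rw [integrable_prod_iff (hm.pow_const 2).aestronglyMeasurable]
  have hs := ae_memLp_section hu h
  constructor
  · filter_upwards [hs] with τ hτ
    exact (hρ.memLp_moll hτ).integrable_sq
  · refine Integrable.mono' h.integrable_sq.integral_prod_left ?_ ?_
    · exact ((hm.pow_const 2).norm.stronglyMeasurable.integral_prod_right).aestronglyMeasurable
    · filter_upwards [hs] with τ hτ
      simp only [norm_pow, Real.norm_eq_abs, sq_abs]
      rw [abs_of_nonneg (integral_nonneg fun _ => sq_nonneg _)]
      exact hρ.integral_sq_moll_le hτ

lemma IsMoll.tendsto_moll_prod {ρ : ℕ → E → ℝ} (h : ∀ n, IsMoll (ρ n)) {δ : ℕ → ℝ}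
    (hδ : Tendsto δ atTop (nhds 0)) (hs : ∀ n z, ρ n z ≠ 0 → ‖z‖ ≤ δ n) {u : Ω × E → ℝ}
    (hu : Measurable u) (hL : MemLp u 2 (ν.prod (volume : Measure E))) :
    Tendsto (fun n => ∫ p : Ω × E, (moll (ρ n) (fun y => u (p.1, y)) p.2 - u p) ^ 2
      ∂(ν.prod volume)) atTop (nhds 0) := by
  have hm := fun n => measurable_moll_prod (h n).contDiff.continuous hu
  have hd : ∀ n, MemLp (fun p : Ω × E => moll (ρ n) (fun y => u (p.1, y)) p.2 - u p) 2
      (ν.prod (volume : Measure E)) := fun n => ((h n).memLp_moll_prod hu hL).sub hL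
  have hsec := ae_memLp_section hu hL
  have e : ∀ n, ∫ p : Ω × E, (moll (ρ n) (fun y => u (p.1, y)) p.2 - u p) ^ 2
      ∂(ν.prod volume) = ∫ τ, (∫ z, (moll (ρ n) (fun y => u (τ, y)) z - u (τ, z)) ^ 2) ∂ν :=
    fun n => integral_prod _ (hd n).integrable_sq
  simp only [e]
  rw [← integral_zero Ω ℝ (μ := ν)]
  refine tendsto_integral_of_dominated_convergence (fun τ => 4 * ∫ z, u (τ, z) ^ 2) (fun n => ?_)
    (hL.integrable_sq.integral_prod_left.const_mul 4) (fun n => ?_) ?_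
  · exact (hd n).integrable_sq.integral_prod_left.aestronglyMeasurable
  · filter_upwards [hsec] with τ hτ
    rw [Real.norm_of_nonneg (integral_nonneg fun _ => sq_nonneg _)]
    have h1 := (h n).memLp_moll hτ
    calc ∫ z, (moll (ρ n) (fun y => u (τ, y)) z - u (τ, z)) ^ 2
        ≤ ∫ z, (2 * moll (ρ n) (fun y => u (τ, y)) z ^ 2 + 2 * u (τ, z) ^ 2) := by
          refine integral_mono (h1.sub hτ).integrable_sq
            ((h1.integrable_sq.const_mul 2).add (hτ.integrable_sq.const_mul 2)) fun z => ?_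
          have := sq_nonneg (moll (ρ n) (fun y => u (τ, y)) z + u (τ, z))
          beta_reduce
          nlinarith
      _ = 2 * (∫ z, moll (ρ n) (fun y => u (τ, y)) z ^ 2) + 2 * ∫ z, u (τ, z) ^ 2 := by
          rw [integral_add (h1.integrable_sq.const_mul 2) (hτ.integrable_sq.const_mul 2),
            integral_const_mul, integral_const_mul]
      _ ≤ _ := by linarith [(h n).integral_sq_moll_le hτ]
  · filter_upwards [hsec] with τ hτ
    exact IsMoll.tendsto_moll h hδ hs hτ

end Slab

lemma memLp_two_of_hasCompactSupport {E : Type*} [NormedAddCommGroup E] [MeasureSpace E]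
    [BorelSpace E] [IsFiniteMeasureOnCompacts (volume : Measure E)] {k : E → ℝ}
    (hk : Continuous k) (hc : HasCompactSupport k) : MemLp k 2 (volume : Measure E) :=
  hk.memLp_of_hasCompactSupport hc

/-- Reduction of a space-time integral against a test function of time. -/
lemma integral_mul_time {N : ℕ} {T : ℝ} {U : ℝ × En N × En N → ℝ}
    (hU : Integrable U ((volume.restrict (Ioo 0 T)).prod (volume : Measure (En N × En N))))
    {θ : ℝ → ℝ} (hθ : Continuous θ) (hc : HasCompactSupport θ) (hs : tsupport θ ⊆ Ioo 0 T) :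
    ∫ p, U p * θ p.1 = ∫ t, (∫ z, U (t, z)) * θ t := by
  have z0 : ∀ x, x ∉ Ioo 0 T → θ x = 0 := fun x hx =>
    image_eq_zero_of_notMem_tsupport fun h => hx (hs h)
  obtain ⟨K, hK⟩ := hc.exists_bound_of_continuous hθ
  have hi : Integrable (fun p : ℝ × En N × En N => U p * θ p.1)
      ((volume.restrict (Ioo 0 T)).prod (volume : Measure (En N × En N))) :=
    hU.mul_bdd (c := K) (hθ.comp continuous_fst).aestronglyMeasurable
      (Eventually.of_forall fun p => hK p.1)
  have e1 : ∫ p, U p * θ p.1 = ∫ p in Ioo 0 T ×ˢ (univ : Set (En N × En N)), U p * θ p.1 := by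
    rw [setIntegral_eq_integral_of_forall_compl_eq_zero]
    intro p hp
    rw [z0 p.1 fun h => hp ⟨h, trivial⟩, mul_zero]
  have e2 : (volume : Measure (ℝ × En N × En N)).restrict (Ioo 0 T ×ˢ univ)
      = (volume.restrict (Ioo 0 T)).prod (volume : Measure (En N × En N)) := by
    rw [Measure.volume_eq_prod, ← Measure.prod_restrict, Measure.restrict_univ]
  rw [e1, e2, integral_prod _ hi]
  simp only [integral_mul_const]
  rw [setIntegral_eq_integral_of_forall_compl_eq_zero]
  intro t ht
  rw [z0 t ht, mul_zero]

/-- Lebesgue measure on the slab `(0,T) × ℝ^{2N}`. -/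
abbrev slab (N : ℕ) (T : ℝ) : Measure (ℝ × En N × En N) :=
  (volume.restrict (Ioo 0 T)).prod volume

instance isAddHaarMeasure_volume_prod (N : ℕ) :
    (volume : Measure (En N × En N)).IsAddHaarMeasure :=
  inferInstanceAs ((volume : Measure (En N)).prod (volume : Measure (En N))).IsAddHaarMeasure

lemma slab_eq (N : ℕ) (T : ℝ) :
    slab N T = (volume : Measure (ℝ × En N × En N)).restrict (Ioo 0 T ×ˢ univ) := by
  rw [Measure.volume_eq_prod, slab, ← Measure.prod_restrict, Measure.restrict_univ]

section Derivatives

variable {N : ℕ} {ψ : En N × En N → ℝ}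

lemma continuous_dX (h : ContDiff ℝ (⊤ : ℕ∞) ψ) (i : Fin N) : Continuous (dX i ψ) := by
  have := h.continuous_fderiv (by simp)
  unfold dX; fun_prop

lemma continuous_dV (h : ContDiff ℝ (⊤ : ℕ∞) ψ) (i : Fin N) : Continuous (dV i ψ) := by
  have := h.continuous_fderiv (by simp)
  unfold dV; fun_prop

lemma hasCompactSupport_dX (h : HasCompactSupport ψ) (i : Fin N) : HasCompactSupport (dX i ψ) :=
  h.fderiv_apply ℝ _

lemma hasCompactSupport_dV (h : HasCompactSupport ψ) (i : Fin N) : HasCompactSupport (dV i ψ) :=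
  h.fderiv_apply ℝ _

variable {θ : ℝ → ℝ}

lemma isTest_mul (hθ : ContDiff ℝ (⊤ : ℕ∞) θ) (hθc : HasCompactSupport θ)
    (hθs : tsupport θ ⊆ Ioi 0) (hψ : ContDiff ℝ (⊤ : ℕ∞) ψ) (hψc : HasCompactSupport ψ) :
    IsTest fun p : ℝ × En N × En N => θ p.1 * ψ p.2 := by
  have hs : Function.support (fun p : ℝ × En N × En N => θ p.1 * ψ p.2)
      ⊆ tsupport θ ×ˢ tsupport ψ := fun p hp => by
    have := mul_ne_zero_iff.1 hp
    exact ⟨subset_tsupport _ this.1, subset_tsupport _ this.2⟩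
  have hts : tsupport (fun p : ℝ × En N × En N => θ p.1 * ψ p.2)
      ⊆ tsupport θ ×ˢ tsupport ψ :=
    closure_minimal hs ((isClosed_tsupport θ).prod (isClosed_tsupport ψ))
  exact ⟨(hθ.comp contDiff_fst).mul (hψ.comp contDiff_snd),
    HasCompactSupport.of_support_subset_isCompact (hθc.isCompact.prod hψc.isCompact) hs,
    fun p hp => hθs (hts hp).1⟩

lemma fderiv_time_mul (hθ : ContDiff ℝ (⊤ : ℕ∞) θ) (hψ : ContDiff ℝ (⊤ : ℕ∞) ψ)
    (p : ℝ × En N × En N) (s : ℝ) (e : En N × En N) :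
    fderiv ℝ (fun p : ℝ × En N × En N => θ p.1 * ψ p.2) p (s, e)
      = s * deriv θ p.1 * ψ p.2 + θ p.1 * fderiv ℝ ψ p.2 e := by
  have d₁ : HasFDerivAt (fun z : ℝ × En N × En N => θ z.1) _ p :=
    ((hθ.differentiable (by simp)) p.1).hasFDerivAt.comp p hasFDerivAt_fst
  have d₂ : HasFDerivAt (fun z : ℝ × En N × En N => ψ z.2) _ p :=
    ((hψ.differentiable (by simp)) p.2).hasFDerivAt.comp p hasFDerivAt_snd
  have d := (d₁.mul d₂).fderiv
  change fderiv ℝ (fun p : ℝ × En N × En N => θ p.1 * ψ p.2) p = _ at d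
  rw [d]
  simp only [_root_.add_apply, _root_.smul_apply,
    ContinuousLinearMap.comp_apply, ContinuousLinearMap.coe_fst', ContinuousLinearMap.coe_snd',
    smul_eq_mul]
  rw [show fderiv ℝ θ p.1 s = s * deriv θ p.1 by
    rw [← fderiv_apply_one_eq_deriv, ← smul_eq_mul, ← map_smul]; simp]
  ring

end Derivatives

/-- Weak solutions of `∂ₜf + v·∇ₓf = ∂_{v_j} F_j` on the slab `(0,T) × ℝ^{2N}`, locally bounded
away from `0` and `1`, with square integrable flux and `v`-gradient. -/
structure IsSlabSol {N : ℕ} (T : ℝ) (f : ℝ × En N × En N → ℝ)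
    (Df F : Fin N → ℝ × En N × En N → ℝ) (f₀ : En N × En N → ℝ) : Prop where
  measurable : Measurable f
  measurable_grad : ∀ i, Measurable (Df i)
  measurable_flux : ∀ j, Measurable (F j)
  measurable_init : Measurable f₀
  bound : ∀ R : ℝ, ∃ c : ℝ, 0 < c ∧ (∀ᵐ p ∂(slab N T), ‖p.2‖ ≤ R → f p ∈ Icc c (1 - c)) ∧
    ∀ z, ‖z‖ ≤ R → f₀ z ∈ Icc c (1 - c)
  memLp : MemLp f 2 (slab N T)
  memLp_grad : ∀ i, MemLp (Df i) 2 (slab N T)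
  memLp_flux : ∀ j, MemLp (F j) 2 (slab N T)
  memLp_init : MemLp f₀ 2
  weak_grad : ∀ (i : Fin N) (φ : ℝ × En N × En N → ℝ), IsTest φ →
    ∫ p, f p * pV i φ p = -∫ p, Df i p * φ p
  weak : ∀ φ : ℝ × En N × En N → ℝ, IsTest φ →
    (∫ p, f p * pT φ p) + ∫ p, f p * ∑ i, p.2.2 i * pX i φ p = ∫ p, ∑ j, F j p * pV j φ p
  cont : ContInDistributions f
  initial : TakesInitialData f f₀

namespace IsSlabSol

variable {N : ℕ} {T : ℝ} {f : ℝ × En N × En N → ℝ} {Df F : Fin N → ℝ × En N × En N → ℝ}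
  {f₀ : En N × En N → ℝ}

/-- The density of `d/dt ∫ f ψ`. -/
def rate (f : ℝ × En N × En N → ℝ) (F : Fin N → ℝ × En N × En N → ℝ) (ψ : En N × En N → ℝ)
    (p : ℝ × En N × En N) : ℝ :=
  f p * transport ψ p.2 - ∑ j, F j p * dV j ψ p.2

lemma integrable_rate (h : IsSlabSol T f Df F f₀) {ψ : En N × En N → ℝ}
    (hψ : ContDiff ℝ (⊤ : ℕ∞) ψ) (hψc : HasCompactSupport ψ) :
    Integrable (rate f F ψ) (slab N T) :=
  (integrable_mul_comp_snd h.memLp (memLp_two_of_hasCompactSupport (continuous_transport hψ)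
    (hasCompactSupport_transport hψc))).sub (integrable_finsetSum _ fun j _ =>
      integrable_mul_comp_snd (h.memLp_flux j) (memLp_two_of_hasCompactSupport
        (continuous_dV hψ j) (hasCompactSupport_dV hψc j)))

lemma integral_mul_eq_add (h : IsSlabSol T f Df F f₀) {ψ : En N × En N → ℝ}
    (hψ : ContDiff ℝ (⊤ : ℕ∞) ψ) (hψc : HasCompactSupport ψ) {t : ℝ} (ht : t ∈ Ioo 0 T) :
    ∫ z, f (t, z) * ψ z = (∫ z, f₀ z * ψ z) + ∫ τ in 0..t, ∫ z, rate f F ψ (τ, z) := by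
  have hR := h.integrable_rate hψ hψc
  refine eq_add_integral_of_weak (m := fun t => ∫ z, f (t, z) * ψ z)
    ((h.cont ψ hψ hψc).mono Ioo_subset_Ioi_self) hR.integral_prod_left (h.initial ψ hψ hψc)
    (fun θ hθ hθc hθs => ?_) t ht
  have hfψ : Integrable (fun p : ℝ × En N × En N => f p * ψ p.2) (slab N T) :=
    integrable_mul_comp_snd h.memLp (memLp_two_of_hasCompactSupport hψ.continuous hψc)
  have e1 := integral_mul_time hfψ (hθ.continuous_deriv (by simp)) hθc.deriv
    ((tsupport_deriv_subset).trans hθs)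
  have e2 := integral_mul_time hR hθ.continuous hθc hθs
  have hw := h.weak _ (isTest_mul hθ hθc (hθs.trans Ioo_subset_Ioi_self) hψ hψc)
  have hz : ∀ (U : ℝ × En N × En N → ℝ), Integrable U (slab N T) →
      Integrable fun p : ℝ × En N × En N => U p * θ p.1 := by
    intro U hU
    obtain ⟨K, hK⟩ := hθc.exists_bound_of_continuous hθ.continuous
    have hi : Integrable (fun p : ℝ × En N × En N => U p * θ p.1) (slab N T) :=
      hU.mul_bdd (c := K) (hθ.continuous.comp continuous_fst).aestronglyMeasurable
        (Eventually.of_forall fun p => hK p.1)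
    rw [slab_eq] at hi
    refine (integrableOn_iff_integrable_of_support_subset fun p hp => ?_).1 hi
    refine ⟨?_, trivial⟩
    by_contra hn
    exact hp (by
      change U p * θ p.1 = 0
      rw [image_eq_zero_of_notMem_tsupport fun h => hn (hθs h), mul_zero])
  have i1 := hz _ (integrable_mul_comp_snd h.memLp (memLp_two_of_hasCompactSupport
    (continuous_transport hψ) (hasCompactSupport_transport hψc)))
  have i2 : Integrable fun p : ℝ × En N × En N => (∑ j, F j p * dV j ψ p.2) * θ p.1 :=
    hz _ (integrable_finsetSum _ fun j _ => integrable_mul_comp_snd (h.memLp_flux j)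
      (memLp_two_of_hasCompactSupport (continuous_dV hψ j) (hasCompactSupport_dV hψc j)))
  have a1 : ∀ p : ℝ × En N × En N, f p * pT (fun p : ℝ × En N × En N => θ p.1 * ψ p.2) p
      = f p * ψ p.2 * deriv θ p.1 := by
    intro p
    rw [pT, show ((1 : ℝ), (0 : En N), (0 : En N)) = (1, (0 : En N × En N)) from rfl,
      fderiv_time_mul hθ hψ]
    simp only [map_zero]; ring
  have a2 : ∀ p : ℝ × En N × En N, f p * ∑ i, p.2.2 i * pX i
      (fun p : ℝ × En N × En N => θ p.1 * ψ p.2) p = f p * transport ψ p.2 * θ p.1 := by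
    intro p
    simp only [pX, fderiv_time_mul hθ hψ, transport, dX, Finset.mul_sum, Finset.sum_mul]
    exact Finset.sum_congr rfl fun i _ => by ring
  have a3 : ∀ p : ℝ × En N × En N, ∑ j, F j p * pV j
      (fun p : ℝ × En N × En N => θ p.1 * ψ p.2) p = (∑ j, F j p * dV j ψ p.2) * θ p.1 := by
    intro p
    simp only [pV, fderiv_time_mul hθ hψ, dV, Finset.sum_mul]
    exact Finset.sum_congr rfl fun i _ => by ring
  simp only [a1, a2, a3] at hw
  rw [← e1, ← e2]
  have e3 : ∫ p, rate f F ψ p * θ p.1 = (∫ p, f p * transport ψ p.2 * θ p.1)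
      - ∫ p : ℝ × En N × En N, (∑ j, F j p * dV j ψ p.2) * θ p.1 := by
    rw [← integral_sub i1 i2]
    simp only [rate, sub_mul]
  rw [e3]
  linarith

lemma ae_weak_grad (h : IsSlabSol T f Df F f₀) (i : Fin N) {ψ : En N × En N → ℝ}
    (hψ : ContDiff ℝ (⊤ : ℕ∞) ψ) (hψc : HasCompactSupport ψ) :
    ∀ᵐ t ∂(volume.restrict (Ioo 0 T)), ∫ z, f (t, z) * dV i ψ z = -∫ z, Df i (t, z) * ψ z := by
  have i1 := integrable_mul_comp_snd h.memLp (memLp_two_of_hasCompactSupport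
    (continuous_dV hψ i) (hasCompactSupport_dV hψc i))
  have i2 := integrable_mul_comp_snd (h.memLp_grad i)
    (memLp_two_of_hasCompactSupport hψ.continuous hψc)
  have hl : LocallyIntegrableOn (fun t => (∫ z, f (t, z) * dV i ψ z) + ∫ z, Df i (t, z) * ψ z)
      (Ioo 0 T) := by
    have : IntegrableOn (fun t => (∫ z, f (t, z) * dV i ψ z) + ∫ z, Df i (t, z) * ψ z)
      (Ioo 0 T) := i1.integral_prod_left.add i2.integral_prod_left
    exact this.locallyIntegrableOn
  have := isOpen_Ioo.ae_eq_zero_of_integral_contDiff_smul_eq_zero hl fun θ hθ hθc hθs => ?_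
  · rw [ae_restrict_iff' measurableSet_Ioo]
    filter_upwards [this] with t ht ht'
    linarith [ht ht']
  have hw := h.weak_grad i _ (isTest_mul hθ hθc (hθs.trans Ioo_subset_Ioi_self) hψ hψc)
  have e1 := integral_mul_time i1 hθ.continuous hθc hθs
  have e2 := integral_mul_time i2 hθ.continuous hθc hθs
  have a1 : ∀ p : ℝ × En N × En N, f p * pV i (fun p : ℝ × En N × En N => θ p.1 * ψ p.2) p
      = f p * dV i ψ p.2 * θ p.1 := by
    intro p
    simp only [pV, fderiv_time_mul hθ hψ, dV]; ring
  have a2 : ∀ p : ℝ × En N × En N, Df i p * (θ p.1 * ψ p.2) = Df i p * ψ p.2 * θ p.1 :=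
    fun p => by ring
  simp only [a1, a2] at hw
  rw [e1, e2] at hw
  simp only [smul_eq_mul, mul_add]
  have bi : ∀ {U : ℝ × En N × En N → ℝ}, Integrable U (slab N T) →
      Integrable fun t => θ t * ∫ z, U (t, z) := by
    intro U hU
    obtain ⟨K, hK⟩ := hθc.exists_bound_of_continuous hθ.continuous
    have := hU.integral_prod_left.bdd_mul (c := K) hθ.continuous.aestronglyMeasurable
      (Eventually.of_forall hK)
    refine (integrableOn_iff_integrable_of_support_subset (s := Ioo 0 T) fun p hp => ?_).1 this
    exact hθs (subset_tsupport _ (left_ne_zero_of_mul hp))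
  rw [integral_add (bi i1) (bi i2)]
  simp only [mul_comm (θ _)]
  rw [hw, neg_add_cancel]

end IsSlabSol

/-- A function `β` that is `C²` on `(0,1)`, with its first two derivatives. -/
structure IsRenorm (β β' β'' : ℝ → ℝ) : Prop where
  measurable : Measurable β
  measurable' : Measurable β'
  measurable'' : Measurable β''
  hasDerivAt : ∀ s ∈ Ioo (0 : ℝ) 1, HasDerivAt β (β' s) s
  hasDerivAt' : ∀ s ∈ Ioo (0 : ℝ) 1, HasDerivAt β' (β'' s) s
  continuousOn'' : ContinuousOn β'' (Ioo 0 1)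

namespace IsRenorm

variable {β β' β'' : ℝ → ℝ}

lemma continuousOn (h : IsRenorm β β' β'') : ContinuousOn β (Ioo 0 1) :=
  fun s hs => (h.hasDerivAt s hs).continuousAt.continuousWithinAt

lemma continuousOn' (h : IsRenorm β β' β'') : ContinuousOn β' (Ioo 0 1) :=
  fun s hs => (h.hasDerivAt' s hs).continuousAt.continuousWithinAt

lemma exists_bound (h : IsRenorm β β' β'') {c : ℝ} (hc : 0 < c) :
    ∃ K, ∀ s ∈ Icc c (1 - c), |β s| ≤ K ∧ |β' s| ≤ K ∧ |β'' s| ≤ K := by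
  have hs : Icc c (1 - c) ⊆ Ioo 0 1 := fun s hs => ⟨hc.trans_le hs.1, by linarith [hs.2]⟩
  obtain ⟨K₁, h₁⟩ := isCompact_Icc.exists_bound_of_continuousOn (h.continuousOn.mono hs)
  obtain ⟨K₂, h₂⟩ := isCompact_Icc.exists_bound_of_continuousOn (h.continuousOn'.mono hs)
  obtain ⟨K₃, h₃⟩ := isCompact_Icc.exists_bound_of_continuousOn (h.continuousOn''.mono hs)
  exact ⟨max K₁ (max K₂ K₃), fun s hs => ⟨(h₁ s hs).trans (le_max_left _ _),
    (h₂ s hs).trans ((le_max_left _ _).trans (le_max_right _ _)),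
    (h₃ s hs).trans ((le_max_right _ _).trans (le_max_right _ _))⟩⟩

end IsRenorm

section FixedTime

variable {N : ℕ}

lemma integral_mul_fderiv_of_hasCompactSupport {u w : En N × En N → ℝ} (hu : Differentiable ℝ u)
    (hw : Differentiable ℝ w) (hc : HasCompactSupport w) (e : En N × En N)
    (hu' : Continuous fun z => fderiv ℝ u z e) (hw' : Continuous fun z => fderiv ℝ w z e) :
    ∫ z, u z * fderiv ℝ w z e = -∫ z, fderiv ℝ u z e * w z :=
  integral_mul_fderiv_eq_neg_fderiv_mul_of_integrable
    ((hu'.mul hw.continuous).integrable_of_hasCompactSupport hc.mul_left)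
    ((hu.continuous.mul hw').integrable_of_hasCompactSupport (hc.fderiv_apply ℝ e).mul_left)
    ((hu.continuous.mul hw.continuous).integrable_of_hasCompactSupport hc.mul_left)
    (fun x _ => hu x) fun x _ => hw x

variable {β β' β'' : ℝ → ℝ} {g χ r : En N × En N → ℝ} {Φ : Fin N → En N × En N → ℝ}

lemma fderiv_coord_mul (hχ : ContDiff ℝ (⊤ : ℕ∞) χ) (i : Fin N) (z : En N × En N) (e : En N) :
    fderiv ℝ (fun z : En N × En N => z.2 i * χ z) z (e, 0) = z.2 i * fderiv ℝ χ z (e, 0) := by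
  let l : (En N × En N) →L[ℝ] ℝ :=
    (EuclideanSpace.proj i : En N →L[ℝ] ℝ).comp (ContinuousLinearMap.snd ℝ (En N) (En N))
  have d := (l.hasFDerivAt (x := z)).mul ((hχ.differentiable (by simp)) z).hasFDerivAt
  have d' := d.fderiv
  change fderiv ℝ (fun z : En N × En N => z.2 i * χ z) z = _ at d'
  rw [d']
  simp only [_root_.add_apply, _root_.smul_apply, smul_eq_mul]
  have : l (e, 0) = 0 := by simp [l]
  rw [this, mul_zero, add_zero]
  rfl

/-- The renormalized equation for a smooth function, tested against `χ` at a fixed time. -/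
lemma integral_renorm_smooth (hβ : IsRenorm β β' β'') (hg : ContDiff ℝ (⊤ : ℕ∞) g)
    (hg01 : ∀ z, g z ∈ Ioo (0 : ℝ) 1) (hΦ : ∀ j, ContDiff ℝ (⊤ : ℕ∞) (Φ j)) (hr : Continuous r)
    (hχ : ContDiff ℝ (⊤ : ℕ∞) χ) (hχc : HasCompactSupport χ) :
    ∫ z, β' (g z) * (-transport g z + r z + ∑ j, dV j (Φ j) z) * χ z
      = (∫ z, β (g z) * transport χ z) + (∫ z, r z * (β' (g z) * χ z))
        - ∫ z, ∑ j, Φ j z * (β'' (g z) * dV j g z * χ z + β' (g z) * dV j χ z) := by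
  have hcβ : Continuous fun z => β (g z) :=
    hβ.continuousOn.comp_continuous hg.continuous hg01
  have hcβ' : Continuous fun z => β' (g z) :=
    hβ.continuousOn'.comp_continuous hg.continuous hg01
  have hcβ'' : Continuous fun z => β'' (g z) :=
    hβ.continuousOn''.comp_continuous hg.continuous hg01
  have dgz := fun z => ((hg.differentiable (by simp)) z).hasFDerivAt
  have dβ : ∀ z, HasFDerivAt (fun z => β (g z)) (β' (g z) • fderiv ℝ g z) z := fun z =>
    (hβ.hasDerivAt _ (hg01 z)).comp_hasFDerivAt z (dgz z)
  have dβ' : ∀ z, HasFDerivAt (fun z => β' (g z)) (β'' (g z) • fderiv ℝ g z) z := fun z =>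
    (hβ.hasDerivAt' _ (hg01 z)).comp_hasFDerivAt z (dgz z)
  have dχ := fun z => ((hχ.differentiable (by simp)) z).hasFDerivAt
  have hgX := fun i => continuous_dX hg i
  have hgV := fun i => continuous_dV hg i
  have hχX := fun i => continuous_dX hχ i
  have hχV := fun i => continuous_dV hχ i
  have hΦV := fun i => continuous_dV (hΦ i) i
  have hΦc := fun i => (hΦ i).continuous
  have hgt := continuous_transport hg
  have hχt := continuous_transport hχ
  have hχcont := hχ.continuous
  have hχcV := fun i => hasCompactSupport_dV hχc i
  have hχcX := fun i => hasCompactSupport_dX hχc i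
  have hc2 : ∀ i : Fin N, Continuous fun z : En N × En N => z.2 i := fun i => by fun_prop
  have cW : ∀ j, Continuous fun z => β'' (g z) * dV j g z * χ z + β' (g z) * dV j χ z := fun j =>
    ((hcβ''.mul (hgV j)).mul hχcont).add (hcβ'.mul (hχV j))
  have T1 : ∀ i, ∫ z, β (g z) * (z.2 i * dX i χ z) = -∫ z, β' (g z) * (z.2 i * dX i g z) * χ z := by
    intro i
    have hw : Differentiable ℝ fun z : En N × En N => z.2 i * χ z := by
      have := hχ.differentiable (by simp)
      fun_prop
    have hw' : Continuous fun z =>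
        fderiv ℝ (fun z : En N × En N => z.2 i * χ z) z (EuclideanSpace.single i 1, 0) := by
      simp only [fderiv_coord_mul hχ]
      have := hχX i
      unfold dX at this
      fun_prop
    have hu' : Continuous fun z =>
        fderiv ℝ (fun z => β (g z)) z (EuclideanSpace.single i 1, (0 : En N)) := by
      simp only [(dβ _).fderiv, _root_.smul_apply, smul_eq_mul]
      exact hcβ'.mul (hgX i)
    have := integral_mul_fderiv_of_hasCompactSupport (fun z => (dβ z).differentiableAt) hw
      hχc.mul_left _ hu' hw'
    simp only [fderiv_coord_mul hχ, (dβ _).fderiv, _root_.smul_apply, smul_eq_mul] at this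
    rw [show (∫ z, β (g z) * (z.2 i * dX i χ z)) = _ from this]
    congr 1
    refine integral_congr_ae (Eventually.of_forall fun z => ?_)
    simp only [dX]; ring
  have T2 : ∀ j, ∫ z, Φ j z * (β'' (g z) * dV j g z * χ z + β' (g z) * dV j χ z)
      = -∫ z, β' (g z) * dV j (Φ j) z * χ z := by
    intro j
    have dw : ∀ z, HasFDerivAt (fun z => β' (g z) * χ z) _ z := fun z => (dβ' z).mul (dχ z)
    have e : ∀ z, fderiv ℝ (fun z => β' (g z) * χ z) z (0, EuclideanSpace.single j 1)
        = β'' (g z) * dV j g z * χ z + β' (g z) * dV j χ z := by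
      intro z
      rw [(dw z).fderiv]
      simp only [_root_.add_apply, _root_.smul_apply, smul_eq_mul, dV]; ring
    have := integral_mul_fderiv_of_hasCompactSupport ((hΦ j).differentiable (by simp))
      (fun z => (dw z).differentiableAt) hχc.mul_left (0, EuclideanSpace.single j 1)
      (hΦV j) (by simp only [e]; exact cW j)
    simp only [e] at this
    rw [this]
    congr 1
    refine integral_congr_ae (Eventually.of_forall fun z => ?_)
    simp only [dV]; ring
  have iT : ∀ i, Integrable fun z => β (g z) * (z.2 i * dX i χ z) := fun i =>
    Continuous.integrable_of_hasCompactSupport (hcβ.mul ((hc2 i).mul (hχX i)))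
      (hχcX i).mul_left.mul_left
  have iT' : ∀ i, Integrable fun z => β' (g z) * (z.2 i * dX i g z) * χ z := fun i =>
    Continuous.integrable_of_hasCompactSupport ((hcβ'.mul ((hc2 i).mul (hgX i))).mul hχcont)
      hχc.mul_left
  have iΦ : ∀ j, Integrable fun z =>
      Φ j z * (β'' (g z) * dV j g z * χ z + β' (g z) * dV j χ z) := fun j =>
    Continuous.integrable_of_hasCompactSupport ((hΦc j).mul (cW j))
      ((hχc.mul_left).add (hχcV j).mul_left).mul_left
  have iΦ' : ∀ j, Integrable fun z => β' (g z) * dV j (Φ j) z * χ z := fun j =>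
    Continuous.integrable_of_hasCompactSupport ((hcβ'.mul (hΦV j)).mul hχcont) hχc.mul_left
  have ir : Integrable fun z => r z * (β' (g z) * χ z) :=
    Continuous.integrable_of_hasCompactSupport (hr.mul (hcβ'.mul hχcont)) hχc.mul_left.mul_left
  have E1 : ∫ z, β (g z) * transport χ z = -∫ z, ∑ i, β' (g z) * (z.2 i * dX i g z) * χ z := by
    simp only [transport, Finset.mul_sum]
    rw [integral_finsetSum _ fun i _ => iT i, integral_finsetSum _ fun i _ => iT' i,
      ← Finset.sum_neg_distrib]
    exact Finset.sum_congr rfl fun i _ => T1 i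
  have E2 : ∫ z, ∑ j, Φ j z * (β'' (g z) * dV j g z * χ z + β' (g z) * dV j χ z)
      = -∫ z, ∑ j, β' (g z) * dV j (Φ j) z * χ z := by
    rw [integral_finsetSum _ fun i _ => iΦ i, integral_finsetSum _ fun i _ => iΦ' i,
      ← Finset.sum_neg_distrib]
    exact Finset.sum_congr rfl fun i _ => T2 i
  have j1 : Integrable fun z => ∑ i, β' (g z) * (z.2 i * dX i g z) * χ z :=
    integrable_finsetSum _ fun i _ => iT' i
  have j2 : Integrable fun z => ∑ j, β' (g z) * dV j (Φ j) z * χ z :=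
    integrable_finsetSum _ fun i _ => iΦ' i
  have j3 : Integrable fun z => r z * (β' (g z) * χ z)
      - ∑ i, β' (g z) * (z.2 i * dX i g z) * χ z := ir.sub j1
  rw [E1, E2, sub_neg_eq_add, neg_add_eq_sub, ← integral_sub ir j1, ← integral_add j3 j2]
  refine integral_congr_ae (Eventually.of_forall fun z => ?_)
  simp only [transport, ← Finset.sum_mul, ← Finset.mul_sum]
  ring

end FixedTime

lemma hasCompactSupport_comp_const_sub {E : Type*} [NormedAddCommGroup E] {ρ : E → ℝ}
    (h : HasCompactSupport ρ) (z : E) :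
    HasCompactSupport fun y => ρ (z - y) :=
  h.comp_homeomorph (Homeomorph.subLeft z)

section Shift

variable {E : Type*} [NormedAddCommGroup E] [NormedSpace ℝ E] {ρ : E → ℝ}

lemma contDiff_comp_const_sub (h : ContDiff ℝ (⊤ : ℕ∞) ρ) (z : E) :
    ContDiff ℝ (⊤ : ℕ∞) fun y => ρ (z - y) :=
  h.comp (contDiff_const.sub contDiff_id)

lemma fderiv_comp_const_sub_apply (h : ContDiff ℝ (⊤ : ℕ∞) ρ) (z y e : E) :
    fderiv ℝ (fun y => ρ (z - y)) y e = -fderiv ℝ ρ (z - y) e := by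
  have d := ((h.differentiable (by simp)) (z - y)).hasFDerivAt.comp y
    ((hasFDerivAt_const z y).sub (hasFDerivAt_id y))
  have d' := d.fderiv
  change fderiv ℝ (fun y => ρ (z - y)) y = _ at d'
  rw [d']
  simp

end Shift

section MollSlab

variable {N : ℕ} {ρ u : En N × En N → ℝ}

lemma dX_moll (hρ : IsMoll ρ) (hu : MemLp u 2) (i : Fin N) (z : En N × En N) :
    dX i (moll ρ u) z = moll (dX i ρ) u z :=
  fderiv_moll hρ.contDiff hρ.hasCompactSupport (memLp_two_locallyIntegrable hu) z _

lemma dV_moll (hρ : IsMoll ρ) (hu : MemLp u 2) (i : Fin N) (z : En N × En N) :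
    dV i (moll ρ u) z = moll (dV i ρ) u z :=
  fderiv_moll hρ.contDiff hρ.hasCompactSupport (memLp_two_locallyIntegrable hu) z _

/-- The mollification of `-v·∇ₓf + ∂_{v_j} F_j`, with all derivatives on the mollifier. -/
def mollRate (ρ : En N × En N → ℝ) (f : ℝ × En N × En N → ℝ)
    (F : Fin N → ℝ × En N × En N → ℝ) (p : ℝ × En N × En N) : ℝ :=
  -(∑ i, p.2.2 i * moll (dX i ρ) (fun y => f (p.1, y)) p.2)
    + moll (transport ρ) (fun y => f (p.1, y)) p.2
    + ∑ j, moll (dV j ρ) (fun y => F j (p.1, y)) p.2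

lemma integral_rate_eq_mollRate (hρ : IsMoll ρ) {f : ℝ × En N × En N → ℝ}
    {F : Fin N → ℝ × En N × En N → ℝ} {τ : ℝ} (hf : MemLp (fun y => f (τ, y)) 2)
    (hF : ∀ j, MemLp (fun y => F j (τ, y)) 2) (z : En N × En N) :
    ∫ y, IsSlabSol.rate f F (fun y => ρ (z - y)) (τ, y) = mollRate ρ f F (τ, z) := by
  have hfl := memLp_two_locallyIntegrable hf
  have hFl := fun j => memLp_two_locallyIntegrable (hF j)
  have hc := hρ.hasCompactSupport
  have i1 : ∀ i, Integrable fun y => z.2 i * (f (τ, y) * dX i ρ (z - y)) := fun i =>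
    (integrable_mul_comp_sub (continuous_dX hρ.contDiff i) (hasCompactSupport_dX hc i)
      hfl z).const_mul _
  have i2 := integrable_mul_comp_sub (continuous_transport hρ.contDiff)
    (hasCompactSupport_transport hc) hfl z
  have i3 := fun j => integrable_mul_comp_sub (continuous_dV hρ.contDiff j)
    (hasCompactSupport_dV hc j) (hFl j) z
  have e : ∀ y, IsSlabSol.rate f F (fun y => ρ (z - y)) (τ, y)
      = (f (τ, y) * transport ρ (z - y) - ∑ i, z.2 i * (f (τ, y) * dX i ρ (z - y)))
        + ∑ j, F j (τ, y) * dV j ρ (z - y) := by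
    intro y
    have a1 : transport (fun y => ρ (z - y)) y
        = transport ρ (z - y) - ∑ i, z.2 i * dX i ρ (z - y) := by
      simp only [transport, dX, fderiv_comp_const_sub_apply hρ.contDiff, ← Finset.sum_sub_distrib]
      refine Finset.sum_congr rfl fun i _ => ?_
      simp only [Prod.snd_sub, PiLp.sub_apply]; ring
    have a2 : ∀ j, dV j (fun y => ρ (z - y)) y = -dV j ρ (z - y) := fun j =>
      fderiv_comp_const_sub_apply hρ.contDiff _ _ _
    simp only [IsSlabSol.rate, a1, a2, mul_sub, Finset.mul_sum, mul_neg, Finset.sum_neg_distrib,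
      sub_neg_eq_add]
    congr 2
    exact Finset.sum_congr rfl fun i _ => by ring
  have j1 : Integrable fun y => ∑ i, z.2 i * (f (τ, y) * dX i ρ (z - y)) :=
    integrable_finsetSum _ fun i _ => i1 i
  have j2 : Integrable fun y => f (τ, y) * transport ρ (z - y)
      - ∑ i, z.2 i * (f (τ, y) * dX i ρ (z - y)) := i2.sub j1
  simp only [e]
  rw [integral_add j2 (integrable_finsetSum _ fun j _ => i3 j), integral_sub i2 j1,
    integral_finsetSum _ fun i _ => i1 i, integral_finsetSum _ fun j _ => i3 j]
  simp only [integral_const_mul, mollRate, moll]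
  ring

lemma abs_moll_le {k : En N × En N → ℝ} (hk : Continuous k) (hc : HasCompactSupport k)
    (hu : MemLp u 2) (z : En N × En N) :
    |moll k u z| ≤ (∫ y, u y ^ 2) + ∫ y, k y ^ 2 := by
  have hk2 := memLp_two_of_hasCompactSupport hk hc
  have hk3 : MemLp (fun y => k (z - y)) 2 :=
    memLp_two_of_hasCompactSupport (hk.comp (continuous_const.sub continuous_id))
      (hasCompactSupport_comp_const_sub hc z)
  have : (volume : Measure (En N × En N)).IsNegInvariant :=
    Measure.IsAddHaarMeasure.isNegInvariant_of_regular _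
  have e : ∫ y, k (z - y) ^ 2 = ∫ y, k y ^ 2 := integral_sub_left_eq_self (fun y => k y ^ 2) _ z
  rw [← e, ← integral_add hu.integrable_sq hk3.integrable_sq, moll, ← Real.norm_eq_abs]
  refine norm_integral_le_of_norm_le (hu.integrable_sq.add hk3.integrable_sq)
    (Eventually.of_forall fun y => ?_)
  rw [Real.norm_eq_abs, abs_le]
  constructor <;> nlinarith [sq_nonneg (u y + k (z - y)), sq_nonneg (u y - k (z - y)),
    sq_nonneg (u y), sq_nonneg (k (z - y))]

lemma integrable_moll_mul {T : ℝ} {k w : En N × En N → ℝ} {u : ℝ × En N × En N → ℝ}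
    (hk : Continuous k) (hc : HasCompactSupport k) (hum : Measurable u)
    (hu : MemLp u 2 (slab N T)) (hw : Continuous w) (hwc : HasCompactSupport w) :
    Integrable (fun p : ℝ × En N × En N => moll k (fun y => u (p.1, y)) p.2 * w p.2)
      (slab N T) := by
  have hb : Integrable (fun p : ℝ × En N × En N => ((∫ y, u (p.1, y) ^ 2) + ∫ y, k y ^ 2) * |w p.2|)
      (slab N T) :=
    (hu.integrable_sq.integral_prod_left.add (integrable_const _)).mul_prod
      (hw.integrable_of_hasCompactSupport hwc).abs
  refine hb.mono' ((measurable_moll_prod hk hum).mul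
    (hw.measurable.comp measurable_snd)).aestronglyMeasurable ?_
  have hs := ae_memLp_section hum hu
  have hs' : ∀ᵐ p ∂(slab N T), MemLp (fun y => u (p.1, y)) 2 :=
    Measure.quasiMeasurePreserving_fst.ae hs
  filter_upwards [hs'] with p hp
  rw [norm_mul, Real.norm_eq_abs, Real.norm_eq_abs]
  exact mul_le_mul_of_nonneg_right (abs_moll_le hk hc hp _) (abs_nonneg _)

lemma integrable_mollRate_mul (hρ : IsMoll ρ) {T : ℝ} {f : ℝ × En N × En N → ℝ}
    {F : Fin N → ℝ × En N × En N → ℝ} (hf : Measurable f) (hF : ∀ j, Measurable (F j))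
    (hf2 : MemLp f 2 (slab N T)) (hF2 : ∀ j, MemLp (F j) 2 (slab N T))
    {w : En N × En N → ℝ} (hw : Continuous w) (hwc : HasCompactSupport w) :
    Integrable (fun p : ℝ × En N × En N => mollRate ρ f F p * w p.2) (slab N T) := by
  have hc := hρ.hasCompactSupport
  have i1 := fun i : Fin N => integrable_moll_mul (continuous_dX hρ.contDiff i)
    (hasCompactSupport_dX hc i) hf hf2 (w := fun z => z.2 i * w z) (by fun_prop) hwc.mul_left
  have i2 := integrable_moll_mul (continuous_transport hρ.contDiff)
    (hasCompactSupport_transport hc) hf hf2 hw hwc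
  have i3 := fun j : Fin N => integrable_moll_mul (continuous_dV hρ.contDiff j)
    (hasCompactSupport_dV hc j) (hF j) (hF2 j) hw hwc
  have j1 := (integrable_finsetSum Finset.univ fun i _ => i1 i).neg
  have j3 := integrable_finsetSum Finset.univ fun i _ => i3 i
  refine ((j1.add i2).add j3).congr (Eventually.of_forall fun p => ?_)
  simp only [Pi.add_apply, Pi.neg_apply, mollRate, add_mul, neg_mul, Finset.sum_mul]
  congr 3
  exact Finset.sum_congr rfl fun i _ => by ring

end MollSlab

/-- Local bounds are preserved by mollification. -/
lemma IsMoll.moll_mem_Icc {E : Type*} [NormedAddCommGroup E] [NormedSpace ℝ E]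
    [FiniteDimensional ℝ E] [MeasureSpace E] [BorelSpace E] [(volume : Measure E).IsAddHaarMeasure]
    {ρ u : E → ℝ} (hρ : IsMoll ρ) (hs : ∀ z, ρ z ≠ 0 → ‖z‖ ≤ 1) (hu : LocallyIntegrable u)
    {R a b : ℝ} (hb : ∀ᵐ y, ‖y‖ ≤ R + 1 → u y ∈ Icc a b) {z : E} (hz : ‖z‖ ≤ R) :
    moll ρ u z ∈ Icc a b := by
  have i1 := integrable_mul_comp_sub hρ.contDiff.continuous hρ.hasCompactSupport hu z
  have key : ∀ᵐ y, a * ρ (z - y) ≤ u y * ρ (z - y) ∧ u y * ρ (z - y) ≤ b * ρ (z - y) := by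
    filter_upwards [hb] with y hy
    by_cases h0 : ρ (z - y) = 0
    · simp [h0]
    have h1 : ‖y‖ ≤ R + 1 := by
      calc ‖y‖ = ‖z - (z - y)‖ := by rw [sub_sub_cancel]
        _ ≤ ‖z‖ + ‖z - y‖ := norm_sub_le _ _
        _ ≤ R + 1 := add_le_add hz (hs _ h0)
    exact ⟨mul_le_mul_of_nonneg_right (hy h1).1 (hρ.nonneg _),
      mul_le_mul_of_nonneg_right (hy h1).2 (hρ.nonneg _)⟩
  have c1 : ∀ c : ℝ, ∫ y, c * ρ (z - y) = c := fun c => by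
    rw [integral_const_mul, hρ.integral_comp_sub, mul_one]
  constructor
  · rw [← c1 a]
    exact integral_mono_ae ((hρ.integrable_comp_sub z).const_mul a) i1 (key.mono fun y h => h.1)
  · rw [← c1 b]
    exact integral_mono_ae i1 ((hρ.integrable_comp_sub z).const_mul b) (key.mono fun y h => h.2)

/-- A closed constraint that holds almost everywhere along a continuous path holds everywhere. -/
lemma forall_mem_of_ae_mem {p : ℝ → ℝ} {t : ℝ} (ht : 0 < t) (hp : ContinuousOn p (Icc 0 t))
    {C : Set ℝ} (hC : IsClosed C) (h : ∀ᵐ s, s ∈ Ioo 0 t → p s ∈ C) : ∀ s ∈ Icc 0 t, p s ∈ C := by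
  intro s hs
  have hd := (Measure.dense_of_ae h).open_subset_closure_inter (isOpen_Ioo (a := 0) (b := t))
  have h1 : s ∈ closure (Ioo 0 t ∩ {s | s ∈ Ioo 0 t → p s ∈ C}) := by
    have := closure_mono hd
    rw [closure_closure, closure_Ioo ht.ne] at this
    exact this hs
  have h2 := ((hp s hs).mono (fun x hx => Ioo_subset_Icc_self hx.1 :
    Ioo 0 t ∩ {s | s ∈ Ioo 0 t → p s ∈ C} ⊆ Icc 0 t)).mem_closure_image h1
  refine hC.closure_subset_iff.2 ?_ h2
  rintro _ ⟨x, hx, rfl⟩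
  exact hx.2 hx.1

/-- Mollification of a function on space-time in the space variables only. -/
abbrev mollS {Ω E : Type*} [NormedAddCommGroup E] [NormedSpace ℝ E]
    [MeasureSpace E] (ρ : E → ℝ) (u : Ω × E → ℝ)
    (p : Ω × E) : ℝ :=
  moll ρ (fun y => u (p.1, y)) p.2

lemma integrable_bdd_mul_of_support {α : Type*} [MeasurableSpace α] {μ : Measure α} {B U : α → ℝ}
    (hU : Integrable U μ) (hB : Measurable B) {K : ℝ} (hK : ∀ᵐ p ∂μ, U p ≠ 0 → |B p| ≤ K) :
    Integrable (fun p => B p * U p) μ := by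
  refine (hU.norm.const_mul K).mono' (hB.aestronglyMeasurable.mul hU.1) ?_
  filter_upwards [hK] with p hp
  rw [norm_mul]
  by_cases h : U p = 0
  · simp [h]
  · exact mul_le_mul_of_nonneg_right (hp h) (norm_nonneg _)

lemma slab_ae_of_le {N : ℕ} {s t : ℝ} (h : s ≤ t) : ae (slab N s) ≤ ae (slab N t) := by
  rw [slab_eq, slab_eq]
  exact ae_mono (Measure.restrict_mono
    (prod_mono_left (Ioo_subset_Ioo_right h)) le_rfl)

lemma slab_mono {N : ℕ} {s t : ℝ} (h : s ≤ t) : slab N s ≤ slab N t := by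
  rw [slab_eq, slab_eq]
  exact Measure.restrict_mono (prod_mono_left (Ioo_subset_Ioo_right h)) le_rfl

namespace IsSlabSol

variable {N : ℕ} {T : ℝ} {f : ℝ × En N × En N → ℝ} {Df F : Fin N → ℝ × En N × En N → ℝ}
  {f₀ : En N × En N → ℝ} {ρ : En N × En N → ℝ}

lemma mono (h : IsSlabSol T f Df F f₀) {t : ℝ} (ht : t ≤ T) : IsSlabSol t f Df F f₀ where
  measurable := h.measurable
  measurable_grad := h.measurable_grad
  measurable_flux := h.measurable_flux
  measurable_init := h.measurable_init
  bound R := by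
    obtain ⟨c, hc, h1, h2⟩ := h.bound R
    exact ⟨c, hc, slab_ae_of_le ht h1, h2⟩
  memLp := h.memLp.mono_measure (slab_mono ht)
  memLp_grad i := (h.memLp_grad i).mono_measure (slab_mono ht)
  memLp_flux i := (h.memLp_flux i).mono_measure (slab_mono ht)
  memLp_init := h.memLp_init
  weak_grad := h.weak_grad
  weak := h.weak
  cont := h.cont
  initial := h.initial

lemma ae_integral_rate (h : IsSlabSol T f Df F f₀) (hρ : IsMoll ρ) :
    ∀ᵐ τ ∂(volume.restrict (Ioo 0 T)), ∀ z,
      ∫ y, rate f F (fun y => ρ (z - y)) (τ, y) = mollRate ρ f F (τ, z) := by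
  filter_upwards [ae_memLp_section h.measurable h.memLp,
    ae_all_iff.2 fun j => ae_memLp_section (h.measurable_flux j) (h.memLp_flux j)] with τ h1 h2 z
  exact integral_rate_eq_mollRate hρ h1 h2 z

lemma integrable_mollRate (h : IsSlabSol T f Df F f₀) (hρ : IsMoll ρ) (z : En N × En N) :
    Integrable (fun τ => mollRate ρ f F (τ, z)) (volume.restrict (Ioo 0 T)) := by
  refine (h.integrable_rate (contDiff_comp_const_sub hρ.contDiff z)
    (hasCompactSupport_comp_const_sub hρ.hasCompactSupport z)).integral_prod_left.congr ?_
  filter_upwards [h.ae_integral_rate hρ] with τ hτ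
  exact hτ z

lemma moll_eq_add (h : IsSlabSol T f Df F f₀) (hρ : IsMoll ρ) (z : En N × En N) {t : ℝ}
    (ht : t ∈ Ioo 0 T) :
    mollS ρ f (t, z) = moll ρ f₀ z + ∫ τ in 0..t, mollRate ρ f F (τ, z) := by
  have e := h.integral_mul_eq_add (contDiff_comp_const_sub hρ.contDiff z)
    (hasCompactSupport_comp_const_sub hρ.hasCompactSupport z) ht
  change (∫ y, f (t, y) * ρ (z - y)) = (∫ y, f₀ y * ρ (z - y)) + _
  rw [e]
  congr 1
  refine intervalIntegral.integral_congr_ae ?_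
  have h1 := (ae_restrict_iff' measurableSet_Ioo).1 (h.ae_integral_rate hρ)
  filter_upwards [h1] with τ hτ hτ'
  rw [uIoc_of_le ht.1.le] at hτ'
  exact hτ ⟨hτ'.1, hτ'.2.trans_lt ht.2⟩ z

/-- The right hand side of `moll_eq_add` as a path in `t`. -/
def path (ρ : En N × En N → ℝ) (f : ℝ × En N × En N → ℝ) (F : Fin N → ℝ × En N × En N → ℝ)
    (f₀ : En N × En N → ℝ) (z : En N × En N) (t : ℝ) : ℝ :=
  moll ρ f₀ z + ∫ τ in 0..t, mollRate ρ f F (τ, z)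

lemma path_mem (h : IsSlabSol T f Df F f₀) (R : ℝ) :
    ∃ c : ℝ, 0 < c ∧ ∀ ρ, IsMoll ρ → (∀ z, ρ z ≠ 0 → ‖z‖ ≤ 1) → ∀ z, ‖z‖ ≤ R →
      ∀ t ∈ Ioo 0 T, ∀ s ∈ Icc 0 t, path ρ f F f₀ z s ∈ Icc c (1 - c) := by
  obtain ⟨c, hc, h1, -⟩ := h.bound (R + 1)
  refine ⟨c, hc, fun ρ hρ hs z hz t ht => ?_⟩
  have hG := h.integrable_mollRate hρ z
  have hGi : IntegrableOn (fun τ => mollRate ρ f F (τ, z)) (Icc 0 t) := by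
    rw [integrableOn_Icc_iff_integrableOn_Ioc]
    exact hG.mono_measure (Measure.restrict_mono (Ioc_subset_Ioo_right ht.2) le_rfl)
  have hcont : ContinuousOn (path ρ f F f₀ z) (Icc 0 t) := by
    have := intervalIntegral.continuousOn_primitive_interval (a := 0) (b := t)
      (f := fun τ => mollRate ρ f F (τ, z)) (μ := volume) (by rwa [uIcc_of_le ht.1.le])
    rw [uIcc_of_le ht.1.le] at this
    exact continuousOn_const.add this
  refine forall_mem_of_ae_mem ht.1 hcont isClosed_Icc ?_
  have h2 := (ae_restrict_iff' measurableSet_Ioo).1 ((Measure.ae_ae_of_ae_prod h1).and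
    (ae_memLp_section h.measurable h.memLp))
  filter_upwards [h2] with s hs' hst
  have hsT : s ∈ Ioo 0 T := ⟨hst.1, hst.2.trans ht.2⟩
  obtain ⟨b1, b2⟩ := hs' hsT
  have := hρ.moll_mem_Icc hs (memLp_two_locallyIntegrable b2) b1 hz
  rwa [path, ← h.moll_eq_add hρ z hsT]

lemma moll_mem (h : IsSlabSol T f Df F f₀) (R : ℝ) :
    ∃ c : ℝ, 0 < c ∧ ∀ ρ, IsMoll ρ → (∀ z, ρ z ≠ 0 → ‖z‖ ≤ 1) → ∀ z, ‖z‖ ≤ R →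
      ∀ t ∈ Ioo 0 T, mollS ρ f (t, z) ∈ Icc c (1 - c) := by
  obtain ⟨c, hc, h1⟩ := h.path_mem R
  refine ⟨c, hc, fun ρ hρ hs z hz t ht => ?_⟩
  rw [h.moll_eq_add hρ z ht]
  exact h1 ρ hρ hs z hz t ht t ⟨ht.1.le, le_rfl⟩

lemma Icc_subset_Ioo_unit {c : ℝ} (hc : 0 < c) : Icc c (1 - c) ⊆ Ioo 0 1 :=
  fun _ hs => ⟨hc.trans_le hs.1, by linarith [hs.2]⟩

variable {β β' β'' : ℝ → ℝ}

lemma renorm_sub (h : IsSlabSol T f Df F f₀) (hβ : IsRenorm β β' β'') (hρ : IsMoll ρ)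
    (hs : ∀ z, ρ z ≠ 0 → ‖z‖ ≤ 1) (z : En N × En N) {t : ℝ} (ht : t ∈ Ioo 0 T) :
    β (mollS ρ f (t, z)) - β (moll ρ f₀ z)
      = ∫ τ in Ioo 0 t, β' (mollS ρ f (τ, z)) * mollRate ρ f F (τ, z) := by
  obtain ⟨c, hc, hp⟩ := h.path_mem ‖z‖
  obtain ⟨K, hK⟩ := hβ.exists_bound hc
  have hG : IntervalIntegrable (fun τ => mollRate ρ f F (τ, z)) volume 0 t := by
    rw [intervalIntegrable_iff_integrableOn_Ioc_of_le ht.1.le]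
    exact (h.integrable_mollRate hρ z).mono_measure
      (Measure.restrict_mono (Ioc_subset_Ioo_right ht.2) le_rfl)
  have h0 : path ρ f F f₀ z 0 = moll ρ f₀ z := by simp [path]
  have e := comp_sub_comp_eq_integral (β := β) (β' := β') (g := path ρ f F f₀ z) ht.1.le hG
    (fun s _ => by rw [h0]; rfl) (hp ρ hρ hs z le_rfl t ht)
    (fun s hs => hβ.hasDerivAt s (Icc_subset_Ioo_unit hc hs)) fun s hs => (hK s hs).2.1
  rw [h0, show path ρ f F f₀ z t = mollS ρ f (t, z) from (h.moll_eq_add hρ z ht).symm] at e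
  rw [e, intervalIntegral.integral_of_le ht.1.le, integral_Ioc_eq_integral_Ioo]
  refine setIntegral_congr_fun measurableSet_Ioo fun τ hτ => ?_
  have hτ' : τ ∈ Ioo 0 T := ⟨hτ.1, hτ.2.trans ht.2⟩
  change β' (path ρ f F f₀ z τ) * _ = _
  rw [path, ← h.moll_eq_add hρ z hτ']

lemma ae_dV_moll (h : IsSlabSol T f Df F f₀) (hρ : IsMoll ρ) (i : Fin N) :
    ∀ᵐ τ ∂(volume.restrict (Ioo 0 T)), ∀ᵐ z,
      dV i (moll ρ fun y => f (τ, y)) z = mollS ρ (Df i) (τ, z) := by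
  have hm1 := measurable_moll_prod (continuous_dV hρ.contDiff i) h.measurable
  have hm2 := measurable_moll_prod hρ.contDiff.continuous (h.measurable_grad i)
  have key : ∀ᵐ τ ∂(volume.restrict (Ioo 0 T)), ∀ᵐ z,
      mollS (dV i ρ) f (τ, z) = mollS ρ (Df i) (τ, z) := by
    rw [Measure.ae_ae_comm (p := fun τ z => mollS (dV i ρ) f (τ, z) = mollS ρ (Df i) (τ, z))
      (measurableSet_eq_fun hm1 hm2)]
    refine Eventually.of_forall fun z => ?_
    filter_upwards [h.ae_weak_grad i (contDiff_comp_const_sub hρ.contDiff z)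
      (hasCompactSupport_comp_const_sub hρ.hasCompactSupport z)] with τ hτ
    have a2 : ∀ y, dV i (fun y => ρ (z - y)) y = -dV i ρ (z - y) := fun y =>
      fderiv_comp_const_sub_apply hρ.contDiff _ _ _
    simp only [a2, mul_neg, integral_neg, neg_inj] at hτ
    exact hτ
  filter_upwards [key, ae_memLp_section h.measurable h.memLp] with τ h1 h2
  filter_upwards [h1] with z hz
  rw [dV_moll hρ h2, ← hz]

end IsSlabSol

lemma contDiff_transport {N : ℕ} {ψ : En N × En N → ℝ} (h : ContDiff ℝ (⊤ : ℕ∞) ψ) :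
    ContDiff ℝ (⊤ : ℕ∞) (transport ψ) := by
  have h1 : ContDiff ℝ (⊤ : ℕ∞) (fderiv ℝ ψ) := h.fderiv_right (by simp)
  unfold transport dX
  fun_prop

namespace IsSlabSol

variable {N : ℕ} {T : ℝ} {f : ℝ × En N × En N → ℝ} {Df F : Fin N → ℝ × En N × En N → ℝ}
  {f₀ : En N × En N → ℝ} {ρ χ : En N × En N → ℝ} {β β' β'' : ℝ → ℝ}

lemma ae_fst_mem_slab (N : ℕ) (T : ℝ) : ∀ᵐ p ∂slab N T, p.1 ∈ Ioo 0 T := by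
  rw [slab_eq]
  filter_upwards [ae_restrict_mem (measurableSet_Ioo.prod MeasurableSet.univ)] with p hp
  exact hp.1

lemma exists_norm_le_of_hasCompactSupport {E : Type*} [NormedAddCommGroup E] {χ : E → ℝ}
    (h : HasCompactSupport χ) : ∃ R, ∀ z, χ z ≠ 0 → ‖z‖ ≤ R := by
  obtain ⟨R, hR⟩ := h.isCompact.isBounded.exists_norm_le
  exact ⟨R, fun z hz => hR z (subset_tsupport _ hz)⟩

lemma dV_eq_zero_of_lt {R : ℝ} (hR : ∀ z, χ z ≠ 0 → ‖z‖ ≤ R) {z : En N × En N} (hz : R < ‖z‖)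
    (e : En N × En N) : fderiv ℝ χ z e = 0 := by
  have : χ =ᶠ[nhds z] fun _ => 0 := by
    filter_upwards [(isOpen_lt continuous_const continuous_norm).mem_nhds hz] with y hy
    by_contra hne
    exact absurd (hR y hne) (not_le.2 hy)
  rw [this.fderiv_eq]; simp

lemma integrable_mul_mul_comp_snd {u w : ℝ × En N × En N → ℝ} {k : En N × En N → ℝ}
    (hu : MemLp u 2 (slab N T)) (hw : MemLp w 2 (slab N T)) (hk : Continuous k)
    (hkc : HasCompactSupport k) :
    Integrable (fun p : ℝ × En N × En N => u p * w p * k p.2) (slab N T) := by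
  obtain ⟨K, hK⟩ := hkc.exists_bound_of_continuous hk
  exact (memLp_two_integrable_mul hu hw).mul_bdd (c := K)
    (hk.comp continuous_snd).aestronglyMeasurable (Eventually.of_forall fun p => hK p.2)

/-- The renormalised equation for the mollified solution, in integrated form. -/
lemma integral_renorm_moll (h : IsSlabSol T f Df F f₀) (hβ : IsRenorm β β' β'') (hρ : IsMoll ρ)
    (hs : ∀ z, ρ z ≠ 0 → ‖z‖ ≤ 1) (hχ : ContDiff ℝ (⊤ : ℕ∞) χ) (hχc : HasCompactSupport χ)
    {t : ℝ} (ht : t ∈ Ioo 0 T) :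
    ∫ z, (β (mollS ρ f (t, z)) - β (moll ρ f₀ z)) * χ z
      = (∫ p, β (mollS ρ f p) * transport χ p.2 ∂slab N t)
        + (∫ p, β' (mollS ρ f p) * (mollS (transport ρ) f p * χ p.2) ∂slab N t)
        - ∑ j, ((∫ p, β'' (mollS ρ f p) * (mollS ρ (F j) p * mollS ρ (Df j) p * χ p.2) ∂slab N t)
          + ∫ p, β' (mollS ρ f p) * (mollS ρ (F j) p * dV j χ p.2) ∂slab N t) := by
  have h' := h.mono ht.2.le
  obtain ⟨R, hR⟩ := exists_norm_le_of_hasCompactSupport hχc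
  obtain ⟨c, hc, hm⟩ := h.moll_mem R
  obtain ⟨K, hK⟩ := hβ.exists_bound hc
  have hdR : ∀ z e, fderiv ℝ χ z e ≠ 0 → ‖z‖ ≤ R := fun z e hz => by
    by_contra hn
    exact hz (dV_eq_zero_of_lt hR (not_le.1 hn) e)
  have htr : ∀ z, transport χ z ≠ 0 → ‖z‖ ≤ R := fun z hz => by
    obtain ⟨i, -, hi⟩ := Finset.exists_ne_zero_of_sum_ne_zero hz
    exact hdR z _ (right_ne_zero_of_mul hi)
  have hbd : ∀ᵐ p ∂slab N t, ‖p.2‖ ≤ R →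
      |β (mollS ρ f p)| ≤ K ∧ |β' (mollS ρ f p)| ≤ K ∧ |β'' (mollS ρ f p)| ≤ K := by
    filter_upwards [ae_fst_mem_slab N t] with p hp hpR
    exact hK _ (hm ρ hρ hs p.2 hpR p.1 ⟨hp.1, hp.2.trans ht.2⟩)
  have hmm : Measurable (mollS ρ f) := measurable_moll_prod hρ.contDiff.continuous h.measurable
  have mF := fun j => hρ.memLp_moll_prod (h.measurable_flux j) (h'.memLp_flux j)
  have mD := fun j => hρ.memLp_moll_prod (h.measurable_grad j) (h'.memLp_grad j)
  have i0 : Integrable (fun p => β' (mollS ρ f p) * (mollRate ρ f F p * χ p.2)) (slab N t) :=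
    integrable_bdd_mul_of_support (integrable_mollRate_mul hρ h.measurable h.measurable_flux
      h'.memLp h'.memLp_flux hχ.continuous hχc) (hβ.measurable'.comp hmm) (K := K) (by
        filter_upwards [hbd] with p hp hne
        exact (hp (hR _ (right_ne_zero_of_mul hne))).2.1)
  have i1 : Integrable (fun p => β (mollS ρ f p) * transport χ p.2) (slab N t) := by
    refine integrable_bdd_mul_of_support (K := K) ?_ (hβ.measurable.comp hmm) ?_
    · exact ((continuous_transport hχ).integrable_of_hasCompactSupport
        (hasCompactSupport_transport hχc)).comp_snd _
    · filter_upwards [hbd] with p hp hne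
      exact (hp (htr _ hne)).1
  have i2 : Integrable (fun p => β' (mollS ρ f p) * (mollS (transport ρ) f p * χ p.2))
      (slab N t) :=
    integrable_bdd_mul_of_support (integrable_moll_mul (continuous_transport hρ.contDiff)
      (hasCompactSupport_transport hρ.hasCompactSupport) h.measurable h'.memLp hχ.continuous hχc)
      (hβ.measurable'.comp hmm) (K := K) (by
        filter_upwards [hbd] with p hp hne
        exact (hp (hR _ (right_ne_zero_of_mul hne))).2.1)
  have i3 : ∀ j, Integrable (fun p => β'' (mollS ρ f p)
      * (mollS ρ (F j) p * mollS ρ (Df j) p * χ p.2)) (slab N t) := fun j =>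
    integrable_bdd_mul_of_support (integrable_mul_mul_comp_snd (mF j) (mD j) hχ.continuous hχc)
      (hβ.measurable''.comp hmm) (K := K) (by
        filter_upwards [hbd] with p hp hne
        exact (hp (hR _ (right_ne_zero_of_mul hne))).2.2)
  have i4 : ∀ j, Integrable (fun p => β' (mollS ρ f p) * (mollS ρ (F j) p * dV j χ p.2))
      (slab N t) := fun j =>
    integrable_bdd_mul_of_support (integrable_mul_comp_snd (mF j)
      (memLp_two_of_hasCompactSupport (continuous_dV hχ j) (hasCompactSupport_dV hχc j)))
      (hβ.measurable'.comp hmm) (K := K) (by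
        filter_upwards [hbd] with p hp hne
        exact (hp (hdR _ _ (right_ne_zero_of_mul hne))).2.1)
  have i34 : Integrable (fun p => ∑ j, (β'' (mollS ρ f p)
      * (mollS ρ (F j) p * mollS ρ (Df j) p * χ p.2)
      + β' (mollS ρ f p) * (mollS ρ (F j) p * dV j χ p.2))) (slab N t) :=
    integrable_finsetSum Finset.univ fun j _ => (i3 j).add (i4 j)
  have i12 := i1.integral_prod_left.add i2.integral_prod_left
  have e0 : ∫ z, (β (mollS ρ f (t, z)) - β (moll ρ f₀ z)) * χ z
      = ∫ p, β' (mollS ρ f p) * (mollRate ρ f F p * χ p.2) ∂slab N t := by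
    rw [integral_prod_symm _ i0]
    refine integral_congr_ae (Eventually.of_forall fun z => ?_)
    change (β (mollS ρ f (t, z)) - β (moll ρ f₀ z)) * χ z = _
    rw [h.renorm_sub hβ hρ hs z ht, ← integral_mul_const]
    simp only [mul_assoc]
  rw [e0, integral_prod _ i0]
  have e1 : ∀ᵐ τ ∂(volume.restrict (Ioo 0 t)),
      ∫ z, β' (mollS ρ f (τ, z)) * (mollRate ρ f F (τ, z) * χ z)
        = (∫ z, β (mollS ρ f (τ, z)) * transport χ z)
          + (∫ z, β' (mollS ρ f (τ, z)) * (mollS (transport ρ) f (τ, z) * χ z))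
          - ∫ z, ∑ j, (β'' (mollS ρ f (τ, z))
              * (mollS ρ (F j) (τ, z) * mollS ρ (Df j) (τ, z) * χ z)
            + β' (mollS ρ f (τ, z)) * (mollS ρ (F j) (τ, z) * dV j χ z)) := by
    filter_upwards [ae_memLp_section h.measurable h'.memLp,
      ae_all_iff.2 fun j => ae_memLp_section (h.measurable_flux j) (h'.memLp_flux j),
      ae_all_iff.2 fun j => h'.ae_dV_moll hρ j, ae_restrict_mem measurableSet_Ioo]
      with τ m1 m2 hD hτ
    have hg : ContDiff ℝ (⊤ : ℕ∞) (moll ρ fun y => f (τ, y)) :=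
      hρ.contDiff_moll (memLp_two_locallyIntegrable m1)
    have hΦ : ∀ j, ContDiff ℝ (⊤ : ℕ∞) (moll ρ fun y => F j (τ, y)) := fun j =>
      hρ.contDiff_moll (memLp_two_locallyIntegrable (m2 j))
    have hr : Continuous (moll (transport ρ) fun y => f (τ, y)) :=
      (contDiff_moll (contDiff_transport hρ.contDiff) (hasCompactSupport_transport
        hρ.hasCompactSupport) (memLp_two_locallyIntegrable m1)).continuous
    have hg01 : ∀ z, moll ρ (fun y => f (τ, y)) z ∈ Ioo (0 : ℝ) 1 := fun z => by
      obtain ⟨c, hc, hm⟩ := h.moll_mem ‖z‖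
      exact Icc_subset_Ioo_unit hc (hm ρ hρ hs z le_rfl τ ⟨hτ.1, hτ.2.trans ht.2⟩)
    have key := integral_renorm_smooth hβ hg hg01 hΦ hr hχ hχc
    have a1 : ∀ z, mollRate ρ f F (τ, z) = -transport (moll ρ fun y => f (τ, y)) z
        + moll (transport ρ) (fun y => f (τ, y)) z
        + ∑ j, dV j (moll ρ fun y => F j (τ, y)) z := fun z => by
      simp only [mollRate, transport, dX_moll hρ m1, dV_moll hρ (m2 _)]
    simp only [← a1] at key
    refine Eq.trans (integral_congr_ae (Eventually.of_forall fun z => ?_)) (key.trans ?_)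
    · simp only [mul_assoc]
    · congr 1
      · congr 1
        refine integral_congr_ae (Eventually.of_forall fun z => ?_)
        simp only; ring
      · refine integral_congr_ae ?_
        filter_upwards [ae_all_iff.2 hD] with z hz
        refine Finset.sum_congr rfl fun j _ => ?_
        rw [hz j]; ring
  rw [integral_congr_ae e1]
  refine (integral_sub i12 i34.integral_prod_left).trans ?_
  rw [← integral_prod _ i34, integral_add' i1.integral_prod_left i2.integral_prod_left,
    ← integral_prod _ i1, ← integral_prod _ i2]
  congr 1
  refine (integral_finsetSum _ fun j _ => (i3 j).add (i4 j)).trans ?_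
  exact Finset.sum_congr rfl fun j _ => integral_add (i3 j) (i4 j)

end IsSlabSol

section SquareLimits

variable {X : Type*} [MeasurableSpace X] {μ : Measure X}

lemma tendsto_integral_sq_sub_of_dominated {W : ℕ → X → ℝ} {W' G : X → ℝ}
    (hW : ∀ n, AEStronglyMeasurable (W n) μ) (hW' : AEStronglyMeasurable W' μ)
    (hG : MemLp G 2 μ) (hb : ∀ n, ∀ᵐ x ∂μ, |W n x| ≤ |G x|)
    (ht : ∀ᵐ x ∂μ, Tendsto (fun n => W n x) atTop (nhds (W' x))) :
    Tendsto (fun n => ∫ x, (W n x - W' x) ^ 2 ∂μ) atTop (nhds 0) := by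
  rw [← integral_zero X ℝ (μ := μ)]
  refine tendsto_integral_of_dominated_convergence (fun x => 4 * G x ^ 2)
    (fun n => ((hW n).sub hW').pow 2) (hG.integrable_sq.const_mul 4) (fun n => ?_) ?_
  · filter_upwards [ae_all_iff.2 hb, ht] with x h1 h2
    have h3 : |W' x| ≤ |G x| := le_of_tendsto h2.abs (Eventually.of_forall h1)
    rw [norm_of_nonneg (sq_nonneg _), ← sq_abs (W n x - W' x), ← sq_abs (G x)]
    have h4 : |W n x - W' x| ≤ 2 * |G x| := (abs_sub _ _).trans (by linarith [h1 n])
    nlinarith [abs_nonneg (W n x - W' x)]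
  · filter_upwards [ht] with x hx
    have : Tendsto (fun n => W n x - W' x) atTop (nhds 0) := by
      simpa using hx.sub_const (W' x)
    simpa using this.pow 2

lemma memLp_two_of_abs_le {W G : X → ℝ} (hW : AEStronglyMeasurable W μ) (hG : MemLp G 2 μ)
    (hb : ∀ᵐ x ∂μ, |W x| ≤ |G x|) : MemLp W 2 μ :=
  hG.mono hW hb

/-- `B_n → B` boundedly and `D_n → D` in `L²` imply `B_n D_n → B D` in `L²`. -/
lemma tendsto_integral_sq_mul_sub {B D : ℕ → X → ℝ} {B' D' : X → ℝ} {K : ℝ}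
    (hB : ∀ n, AEStronglyMeasurable (B n) μ) (hB' : AEStronglyMeasurable B' μ)
    (hD : ∀ n, MemLp (D n) 2 μ) (hD' : MemLp D' 2 μ)
    (hb : ∀ n, ∀ᵐ x ∂μ, |B n x| ≤ K)
    (ht : ∀ᵐ x ∂μ, Tendsto (fun n => B n x) atTop (nhds (B' x)))
    (tD : Tendsto (fun n => ∫ x, (D n x - D' x) ^ 2 ∂μ) atTop (nhds 0)) :
    Tendsto (fun n => ∫ x, (B n x * D n x - B' x * D' x) ^ 2 ∂μ) atTop (nhds 0) := by
  have hbK : ∀ n, ∀ᵐ x ∂μ, |B n x * D' x| ≤ |K * D' x| := fun n => by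
    filter_upwards [hb n] with x hx
    rw [abs_mul, abs_mul]
    exact mul_le_mul_of_nonneg_right (hx.trans (le_abs_self _)) (abs_nonneg _)
  have mK : MemLp (fun x => K * D' x) 2 μ := hD'.const_mul K
  have t2 : Tendsto (fun n => ∫ x, (B n x * D' x - B' x * D' x) ^ 2 ∂μ) atTop (nhds 0) :=
    tendsto_integral_sq_sub_of_dominated (fun n => (hB n).mul hD'.1) (hB'.mul hD'.1) mK hbK
      (ht.mono fun x hx => hx.mul_const _)
  have m1 : ∀ n, MemLp (fun x => B n x * D' x) 2 μ := fun n =>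
    memLp_two_of_abs_le ((hB n).mul hD'.1) mK (hbK n)
  have m2 : MemLp (fun x => B' x * D' x) 2 μ := by
    refine memLp_two_of_abs_le (hB'.mul hD'.1) mK ?_
    filter_upwards [ae_all_iff.2 hbK, ht] with x h1 h2
    exact le_of_tendsto (h2.mul_const _).abs (Eventually.of_forall h1)
  have key := (tD.const_mul (2 * K ^ 2)).add (t2.const_mul 2)
  simp only [mul_zero, add_zero] at key
  refine squeeze_zero (fun n => integral_nonneg fun x => sq_nonneg _) (fun n => ?_) key
  have i1 := ((hD n).sub hD').integrable_sq.const_mul (2 * K ^ 2)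
  have i2 := ((m1 n).sub m2).integrable_sq.const_mul 2
  rw [← integral_const_mul, ← integral_const_mul]
  refine (integral_mono_of_nonneg (Eventually.of_forall fun x => sq_nonneg _) (i1.add i2) ?_).trans
    (integral_add i1 i2).le
  filter_upwards [hb n] with x hx
  have hx2 : B n x ^ 2 ≤ K ^ 2 := sq_le_sq' (by linarith [abs_le.1 hx]) (abs_le.1 hx).2
  simp only [Pi.add_apply, Pi.sub_apply]
  nlinarith [sq_nonneg (B n x * (D n x - D' x) - (B n x * D' x - B' x * D' x)),
    mul_le_mul_of_nonneg_right hx2 (sq_nonneg (D n x - D' x))]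

end SquareLimits

namespace IsSlabSol

variable {N : ℕ} {T : ℝ} {f : ℝ × En N × En N → ℝ} {Df F : Fin N → ℝ × En N × En N → ℝ}
  {f₀ χ : En N × En N → ℝ} {β β' β'' : ℝ → ℝ}

lemma exists_mollifiers (h : IsSlabSol T f Df F f₀) : ∃ ρ : ℕ → En N × En N → ℝ,
    (∀ n, IsMoll (ρ n)) ∧ (∀ n z, ρ n z ≠ 0 → ‖z‖ ≤ 1 / ((n : ℝ) + 1)) ∧
    (∀ n, ∫ z, |transport (ρ n) z| ≤ 1 / ((n : ℝ) + 1)) ∧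
    (∀ᵐ p ∂slab N T, Tendsto (fun n => mollS (ρ n) f p) atTop (nhds (f p))) ∧
    ∀ᵐ z, Tendsto (fun n => moll (ρ n) f₀ z) atTop (nhds (f₀ z)) := by
  choose ρ h1 h2 h3 using fun n : ℕ =>
    exists_isMoll_transport_le N (δ := 1 / ((n : ℝ) + 1)) (by positivity)
  obtain ⟨ns, hns, ha⟩ := exists_subseq_ae_of_tendsto_sq
    (fun n => (h1 n).memLp_moll_prod h.measurable h.memLp) h.memLp
    (IsMoll.tendsto_moll_prod h1 tendsto_one_div_add_atTop_nhds_zero_nat h2 h.measurable h.memLp)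
  have t0 := (IsMoll.tendsto_moll h1 tendsto_one_div_add_atTop_nhds_zero_nat h2
    h.memLp_init).comp hns.tendsto_atTop
  obtain ⟨ms, hms, hb⟩ := exists_subseq_ae_of_tendsto_sq
    (fun n => (h1 (ns n)).memLp_moll h.memLp_init) h.memLp_init t0
  have hle : ∀ n, 1 / ((ns (ms n) : ℝ) + 1) ≤ 1 / ((n : ℝ) + 1) := fun n => by
    have : (n : ℝ) ≤ ns (ms n) := by exact_mod_cast (hns.comp hms).le_apply
    gcongr
  refine ⟨fun n => ρ (ns (ms n)), fun n => h1 _, fun n z hz => (h2 _ z hz).trans (hle n),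
    fun n => (h3 _).trans (hle n), ?_, hb⟩
  filter_upwards [ha] with p hp
  exact hp.comp hms.tendsto_atTop

lemma ae_mem_Ioo (h : IsSlabSol T f Df F f₀) : ∀ᵐ p ∂slab N T, f p ∈ Ioo (0 : ℝ) 1 := by
  choose c hc h1 h2 using fun n : ℕ => h.bound n
  filter_upwards [ae_all_iff.2 h1] with p hp
  obtain ⟨n, hn⟩ := exists_nat_ge ‖p.2‖
  exact Icc_subset_Ioo_unit (hc n) (hp n hn)

lemma ae_abs_moll_transport_le (h : IsSlabSol T f Df F f₀) {ρ : En N × En N → ℝ}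
    (hρ : IsMoll ρ) {δ : ℝ} (hδ : ∫ z, |transport ρ z| ≤ δ) :
    ∀ᵐ p ∂slab N T, |mollS (transport ρ) f p| ≤ δ := by
  have h1 : ∀ᵐ τ ∂(volume.restrict (Ioo 0 T)), ∀ᵐ z, f (τ, z) ∈ Ioo (0 : ℝ) 1 :=
    Measure.ae_ae_of_ae_prod h.ae_mem_Ioo
  filter_upwards [Measure.quasiMeasurePreserving_fst.ae h1] with p hp
  have : (volume : Measure (En N × En N)).IsNegInvariant :=
    Measure.IsAddHaarMeasure.isNegInvariant_of_regular _
  have i1 : Integrable fun y => |transport ρ (p.2 - y)| :=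
    (((continuous_transport hρ.contDiff).integrable_of_hasCompactSupport
      (hasCompactSupport_transport hρ.hasCompactSupport)).comp_sub_left p.2).abs
  refine le_trans ?_ hδ
  rw [← integral_sub_left_eq_self (fun y => |transport ρ y|) volume p.2]
  refine norm_integral_le_of_norm_le (f := fun y => f (p.1, y) * transport ρ (p.2 - y)) i1 ?_
  filter_upwards [hp] with y hy
  rw [norm_mul, Real.norm_eq_abs, Real.norm_eq_abs, abs_of_pos hy.1]
  exact mul_le_of_le_one_left (abs_nonneg _) hy.2.le

lemma tendsto_comp_of_Icc (hβ : ContinuousOn β (Ioo 0 1)) {c : ℝ} (hc : 0 < c) {g : ℕ → ℝ} {s : ℝ}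
    (hg : ∀ n, g n ∈ Icc c (1 - c)) (ht : Tendsto g atTop (nhds s)) :
    Tendsto (fun n => β (g n)) atTop (nhds (β s)) := by
  have hs : s ∈ Ioo (0 : ℝ) 1 :=
    Icc_subset_Ioo_unit hc (isClosed_Icc.mem_of_tendsto ht (Eventually.of_forall hg))
  exact (hβ.continuousAt (isOpen_Ioo.mem_nhds hs)).tendsto.comp ht

/-- The renormalised equation in integrated form. -/
theorem integral_renorm (h : IsSlabSol T f Df F f₀) (hβ : IsRenorm β β' β'') :
    ∀ᵐ t, t ∈ Ioo 0 T → ∀ χ : En N × En N → ℝ, ContDiff ℝ (⊤ : ℕ∞) χ → HasCompactSupport χ →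
      ∫ z, (β (f (t, z)) - β (f₀ z)) * χ z
        = (∫ p, β (f p) * transport χ p.2 ∂slab N t)
          - ∑ j, ((∫ p, F j p * (β'' (f p) * χ p.2 * Df j p) ∂slab N t)
            + ∫ p, F j p * (β' (f p) * dV j χ p.2) ∂slab N t) := by
  obtain ⟨ρ, h1, h2, h3, h4, h5⟩ := h.exists_mollifiers
  have hs : ∀ n z, ρ n z ≠ 0 → ‖z‖ ≤ 1 := fun n z hz => (h2 n z hz).trans
    (div_le_one_of_le₀ (by linarith [(Nat.cast_nonneg n : (0 : ℝ) ≤ n)]) (by positivity))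
  have h6 := (ae_restrict_iff' measurableSet_Ioo).1 (Measure.ae_ae_of_ae_prod h4)
  filter_upwards [h6] with t htt ht χ hχ hχc
  replace htt := htt ht
  have h4' : ∀ᵐ p ∂slab N t, Tendsto (fun n => mollS (ρ n) f p) atTop (nhds (f p)) :=
    slab_ae_of_le ht.2.le h4
  have h' := h.mono ht.2.le
  obtain ⟨R, hR⟩ := exists_norm_le_of_hasCompactSupport hχc
  obtain ⟨c, hc, hm⟩ := h.path_mem R
  obtain ⟨K, hK⟩ := hβ.exists_bound hc
  obtain ⟨M, hM⟩ := hχc.exists_bound_of_continuous hχ.continuous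
  have hdR : ∀ z e, fderiv ℝ χ z e ≠ 0 → ‖z‖ ≤ R := fun z e hz => by
    by_contra hn
    exact hz (dV_eq_zero_of_lt hR (not_le.1 hn) e)
  have htr : ∀ z, transport χ z ≠ 0 → ‖z‖ ≤ R := fun z hz => by
    obtain ⟨i, -, hi⟩ := Finset.exists_ne_zero_of_sum_ne_zero hz
    exact hdR z _ (right_ne_zero_of_mul hi)
  have hg : ∀ n z, ‖z‖ ≤ R → ∀ τ ∈ Ioo 0 T, mollS (ρ n) f (τ, z) ∈ Icc c (1 - c) :=
    fun n z hz τ hτ => by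
      rw [h.moll_eq_add (h1 n) z hτ]
      exact hm _ (h1 n) (hs n) z hz τ hτ τ ⟨hτ.1.le, le_rfl⟩
  have hg0 : ∀ n z, ‖z‖ ≤ R → moll (ρ n) f₀ z ∈ Icc c (1 - c) := fun n z hz => by
    simpa [path] using hm _ (h1 n) (hs n) z hz t ht 0 ⟨le_rfl, ht.1.le⟩
  have hgs : ∀ᵐ p ∂slab N t, ‖p.2‖ ≤ R → ∀ n, mollS (ρ n) f p ∈ Icc c (1 - c) := by
    filter_upwards [ae_fst_mem_slab N t] with p hp hpR n
    exact hg n p.2 hpR p.1 ⟨hp.1, hp.2.trans ht.2⟩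
  have hmm : ∀ n, Measurable (mollS (ρ n) f) := fun n =>
    measurable_moll_prod (h1 n).contDiff.continuous h.measurable
  have hK0 : 0 ≤ |K| := abs_nonneg _
  have key := fun n => h.integral_renorm_moll hβ (h1 n) (hs n) hχ hχc ht
  -- the five limits
  have l0 : Tendsto (fun n => ∫ z, (β (mollS (ρ n) f (t, z)) - β (moll (ρ n) f₀ z)) * χ z) atTop
      (nhds (∫ z, (β (f (t, z)) - β (f₀ z)) * χ z)) := by
    refine tendsto_integral_of_dominated_convergence (fun z => 2 * K * |χ z|) (fun n => ?_)
      ((hχ.continuous.integrable_of_hasCompactSupport hχc).abs.const_mul _) (fun n => ?_) ?_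
    · exact (((hβ.measurable.comp ((hmm n).comp measurable_prodMk_left)).sub (hβ.measurable.comp
        ((h1 n).contDiff_moll (memLp_two_locallyIntegrable
          h.memLp_init)).continuous.measurable)).mul hχ.continuous.measurable).aestronglyMeasurable
    · refine Eventually.of_forall fun z => ?_
      rw [norm_mul]
      by_cases hz : χ z = 0
      · simp [hz]
      · refine mul_le_mul_of_nonneg_right ?_ (norm_nonneg _)
        refine (abs_sub _ _).trans ?_
        linarith [(hK _ (hg n z (hR z hz) t ht)).1, (hK _ (hg0 n z (hR z hz))).1]
    · filter_upwards [htt, h5] with z e1 e2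
      by_cases hz : χ z = 0
      · simp [hz]
      · exact ((tendsto_comp_of_Icc hβ.continuousOn hc (fun n => hg n z (hR z hz) t ht) e1).sub
          (tendsto_comp_of_Icc hβ.continuousOn hc (fun n => hg0 n z (hR z hz)) e2)).mul_const _
  have l1 : Tendsto (fun n => ∫ p, β (mollS (ρ n) f p) * transport χ p.2 ∂slab N t) atTop
      (nhds (∫ p, β (f p) * transport χ p.2 ∂slab N t)) := by
    refine tendsto_integral_of_dominated_convergence (fun p => K * |transport χ p.2|) (fun n => ?_)
      ?_ (fun n => ?_) ?_
    · exact ((hβ.measurable.comp (hmm n)).mul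
        ((continuous_transport hχ).measurable.comp measurable_snd)).aestronglyMeasurable
    · exact ((((continuous_transport hχ).integrable_of_hasCompactSupport
        (hasCompactSupport_transport hχc)).comp_snd _).abs.const_mul _)
    · filter_upwards [hgs] with p hp
      rw [norm_mul]
      by_cases hz : transport χ p.2 = 0
      · simp [hz]
      · exact mul_le_mul_of_nonneg_right (hK _ (hp (htr _ hz) n)).1 (norm_nonneg _)
    · filter_upwards [h4', hgs] with p e1 e2
      by_cases hz : transport χ p.2 = 0
      · simp [hz]
      · exact (tendsto_comp_of_Icc hβ.continuousOn hc (e2 (htr _ hz)) e1).mul_const _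
  have l2 : Tendsto (fun n => ∫ p, β' (mollS (ρ n) f p)
      * (mollS (transport (ρ n)) f p * χ p.2) ∂slab N t) atTop (nhds 0) := by
    have iχ : Integrable (fun p : ℝ × En N × En N => |χ p.2|) (slab N t) :=
      ((hχ.continuous.integrable_of_hasCompactSupport hχc).comp_snd _).abs
    have t0 := (tendsto_one_div_add_atTop_nhds_zero_nat (𝕜 := ℝ)).mul_const
      (K * ∫ p : ℝ × En N × En N, |χ p.2| ∂slab N t)
    rw [zero_mul] at t0
    refine squeeze_zero_norm (fun n => ?_) t0
    rw [← mul_assoc, ← integral_const_mul]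
    refine norm_integral_le_of_norm_le (iχ.const_mul _) ?_
    filter_upwards [hgs, h'.ae_abs_moll_transport_le (h1 n) (h3 n)] with p e1 e2
    rw [norm_mul, norm_mul, ← mul_assoc]
    by_cases hz : χ p.2 = 0
    · simp [hz]
    · refine mul_le_mul_of_nonneg_right ?_ (norm_nonneg _)
      rw [mul_comm]
      exact mul_le_mul e2 (hK _ (e1 (hR _ hz) n)).2.1 (norm_nonneg _) (by positivity)
  have tF := fun j => IsMoll.tendsto_moll_prod h1 tendsto_one_div_add_atTop_nhds_zero_nat h2
    (h.measurable_flux j) (h'.memLp_flux j)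
  have tD := fun j => IsMoll.tendsto_moll_prod h1 tendsto_one_div_add_atTop_nhds_zero_nat h2
    (h.measurable_grad j) (h'.memLp_grad j)
  have mF := fun j n => (h1 n).memLp_moll_prod (h.measurable_flux j) (h'.memLp_flux j)
  have mD := fun j n => (h1 n).memLp_moll_prod (h.measurable_grad j) (h'.memLp_grad j)
  have hχm : Measurable fun p : ℝ × En N × En N => χ p.2 :=
    hχ.continuous.measurable.comp measurable_snd
  have bB : ∀ n, ∀ᵐ p ∂slab N t, |β'' (mollS (ρ n) f p) * χ p.2| ≤ |K| * |M| := fun n => by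
    filter_upwards [hgs] with p e2
    rw [abs_mul]
    by_cases hz : χ p.2 = 0
    · simp only [hz, abs_zero, mul_zero]; positivity
    · exact mul_le_mul ((hK _ (e2 (hR _ hz) n)).2.2.trans (le_abs_self _))
        ((hM p.2).trans (le_abs_self _)) (abs_nonneg _) (abs_nonneg _)
  have tB : ∀ᵐ p ∂slab N t, Tendsto (fun n => β'' (mollS (ρ n) f p) * χ p.2) atTop
      (nhds (β'' (f p) * χ p.2)) := by
    filter_upwards [h4', hgs] with p e1 e2
    by_cases hz : χ p.2 = 0
    · simp [hz]
    · exact (tendsto_comp_of_Icc hβ.continuousOn'' hc (e2 (hR _ hz)) e1).mul_const _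
  have aB : ∀ n, AEStronglyMeasurable (fun p => β'' (mollS (ρ n) f p) * χ p.2) (slab N t) :=
    fun n => ((hβ.measurable''.comp (hmm n)).mul hχm).aestronglyMeasurable
  have aB' : AEStronglyMeasurable (fun p => β'' (f p) * χ p.2) (slab N t) :=
    ((hβ.measurable''.comp h.measurable).mul hχm).aestronglyMeasurable
  have bB' : ∀ᵐ p ∂slab N t, |β'' (f p) * χ p.2| ≤ |K| * |M| := by
    filter_upwards [ae_all_iff.2 bB, tB] with p e1 e2
    exact le_of_tendsto e2.abs (Eventually.of_forall e1)
  have mBD : ∀ {B D : ℝ × En N × En N → ℝ}, AEStronglyMeasurable B (slab N t) →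
      MemLp D 2 (slab N t) → (∀ᵐ p ∂slab N t, |B p| ≤ |K| * |M|) →
      MemLp (fun p => B p * D p) 2 (slab N t) := fun {B D} hB hD hb => by
    refine memLp_two_of_abs_le (hB.mul hD.1) (hD.const_mul (|K| * |M|)) ?_
    filter_upwards [hb] with p e
    rw [abs_mul, abs_mul, abs_of_nonneg (by positivity : 0 ≤ |K| * |M|)]
    exact mul_le_mul_of_nonneg_right e (abs_nonneg _)
  have l3 := fun j => tendsto_integral_mul_of_tendsto_sq (mF j)
    (fun n => mBD (aB n) (mD j n) (bB n)) (h'.memLp_flux j) (mBD aB' (h'.memLp_grad j) bB')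
    (tF j) (tendsto_integral_sq_mul_sub aB aB' (mD j) (h'.memLp_grad j) bB tB (tD j))
  have mdV : ∀ j, MemLp (fun p : ℝ × En N × En N => K * dV j χ p.2) 2 (slab N t) := fun j =>
    ((memLp_two_of_hasCompactSupport (continuous_dV hχ j)
      (hasCompactSupport_dV hχc j)).comp_snd _).const_mul K
  have bV : ∀ j n, ∀ᵐ p ∂slab N t, |β' (mollS (ρ n) f p) * dV j χ p.2| ≤ |K * dV j χ p.2| :=
    fun j n => by
      filter_upwards [hgs] with p e2
      rw [abs_mul, abs_mul]
      by_cases hz : dV j χ p.2 = 0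
      · simp [hz]
      · exact mul_le_mul_of_nonneg_right ((hK _ (e2 (hdR _ _ hz) n)).2.1.trans (le_abs_self _))
          (abs_nonneg _)
  have tV : ∀ j, ∀ᵐ p ∂slab N t, Tendsto (fun n => β' (mollS (ρ n) f p) * dV j χ p.2) atTop
      (nhds (β' (f p) * dV j χ p.2)) := fun j => by
    filter_upwards [h4', hgs] with p e1 e2
    by_cases hz : dV j χ p.2 = 0
    · simp [hz]
    · exact (tendsto_comp_of_Icc hβ.continuousOn' hc (e2 (hdR _ _ hz)) e1).mul_const _
  have hVm : ∀ j, Measurable fun p : ℝ × En N × En N => dV j χ p.2 := fun j =>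
    (continuous_dV hχ j).measurable.comp measurable_snd
  have aV : ∀ j n, AEStronglyMeasurable (fun p => β' (mollS (ρ n) f p) * dV j χ p.2) (slab N t) :=
    fun j n => ((hβ.measurable'.comp (hmm n)).mul (hVm j)).aestronglyMeasurable
  have aV' : ∀ j, AEStronglyMeasurable (fun p => β' (f p) * dV j χ p.2) (slab N t) :=
    fun j => ((hβ.measurable'.comp h.measurable).mul (hVm j)).aestronglyMeasurable
  have l4 := fun j => tendsto_integral_mul_of_tendsto_sq (mF j)
    (fun n => memLp_two_of_abs_le (aV j n) (mdV j) (bV j n)) (h'.memLp_flux j)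
    (memLp_two_of_abs_le (aV' j) (mdV j) (by
      filter_upwards [ae_all_iff.2 (bV j), tV j] with p e1 e2
      exact le_of_tendsto e2.abs (Eventually.of_forall e1)))
    (tF j) (tendsto_integral_sq_sub_of_dominated (aV j) (aV' j) (mdV j) (bV j) (tV j))
  have l5 := (l1.add l2).sub (tendsto_finsetSum Finset.univ fun j _ => (l3 j).add (l4 j))
  rw [add_zero] at l5
  refine tendsto_nhds_unique l0 (l5.congr fun n => ?_)
  rw [key n]
  congr 1
  refine Finset.sum_congr rfl fun j _ => ?_
  congr 1
  · exact integral_congr_ae (Eventually.of_forall fun p => by ring)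
  · exact integral_congr_ae (Eventually.of_forall fun p => by ring)

end IsSlabSol

/-- The entropy density `s log s + (1 - s) log (1 - s)`. -/
def ent (s : ℝ) : ℝ := s * Real.log s + (1 - s) * Real.log (1 - s)

/-- The derivative of `ent`. -/
def ent' (s : ℝ) : ℝ := Real.log s - Real.log (1 - s)

/-- The second derivative of `ent`. -/
def ent'' (s : ℝ) : ℝ := (s * (1 - s))⁻¹

lemma isRenorm_ent : IsRenorm ent ent' ent'' where
  measurable := by unfold ent; fun_prop
  measurable' := by unfold ent'; fun_prop
  measurable'' := by unfold ent''; fun_prop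
  hasDerivAt s hs := by
    have h1 := (hasDerivAt_id s).mul (Real.hasDerivAt_log hs.1.ne')
    have h2 : HasDerivAt (fun s : ℝ => 1 - s) (-1) s := by
      simpa using (hasDerivAt_id s).const_sub 1
    have h3 := h2.mul (h2.log (sub_pos.2 hs.2).ne')
    have h4 := h1.add h3
    have a1 := hs.1.ne'
    have a2 := (sub_pos.2 hs.2).ne'
    refine h4.congr_deriv ?_
    simp only [ent', id]
    field_simp
    ring
  hasDerivAt' s hs := by
    have h2 : HasDerivAt (fun s : ℝ => 1 - s) (-1) s := by
      simpa using (hasDerivAt_id s).const_sub 1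
    have h4 := (Real.hasDerivAt_log hs.1.ne').sub (h2.log (sub_pos.2 hs.2).ne')
    have a1 := hs.1.ne'
    have a2 := (sub_pos.2 hs.2).ne'
    refine h4.congr_deriv ?_
    simp only [ent'']
    field_simp
    ring
  continuousOn'' := by
    refine ContinuousOn.inv₀ (by fun_prop) fun s hs => ?_
    exact (mul_pos hs.1 (sub_pos.2 hs.2)).ne'

lemma integrable_gaussian_weight (N : ℕ) {α : ℝ} (hα : 0 < α) :
    Integrable fun z : En N × En N =>
      (1 + (‖z.1‖ ^ 2 + ‖z.2‖ ^ 2)) ^ 2 * Real.exp (-α * (‖z.1‖ ^ 2 + ‖z.2‖ ^ 2)) := by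
  have h1 : Integrable fun v : En N => Real.exp (-(α / 2) * ‖v‖ ^ 2) := by
    have := (GaussianFourier.integrable_cexp_neg_mul_sq_norm_add (V := En N)
      (b := ((α / 2 : ℝ) : ℂ)) (by simpa using hα) 0 0).norm
    refine this.congr (Eventually.of_forall fun v => ?_)
    simp only [Complex.norm_exp]
    congr 1
    simp [← Complex.ofReal_pow]
  have h2 := (h1.mul_prod h1).const_mul ((1 + 4 / α) ^ 2)
  refine Integrable.mono' h2 (by fun_prop) (Eventually.of_forall fun z => ?_)
  set q : ℝ := ‖z.1‖ ^ 2 + ‖z.2‖ ^ 2 with hq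
  have hq0 : 0 ≤ q := by positivity
  have e1 : 1 + q ≤ (1 + 4 / α) * Real.exp (α * q / 4) := by
    have := Real.add_one_le_exp (α * q / 4)
    calc 1 + q ≤ (1 + 4 / α) * (α * q / 4 + 1) := by
          have : (1 + 4 / α) * (α * q / 4 + 1) = 1 + q + α * q / 4 + 4 / α := by
            field_simp; ring
          rw [this]
          have : 0 ≤ α * q / 4 := by positivity
          have : 0 ≤ 4 / α := by positivity
          linarith
      _ ≤ _ := mul_le_mul_of_nonneg_left this (by positivity)
  rw [norm_of_nonneg (by positivity)]
  have e2 : (1 + q) ^ 2 ≤ (1 + 4 / α) ^ 2 * Real.exp (α * q / 2) := by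
    calc (1 + q) ^ 2 ≤ ((1 + 4 / α) * Real.exp (α * q / 4)) ^ 2 :=
          pow_le_pow_left₀ (by positivity) e1 2
      _ = _ := by rw [mul_pow, ← Real.exp_nat_mul]; congr 2; push_cast; ring
  calc (1 + q) ^ 2 * Real.exp (-α * q)
      ≤ (1 + 4 / α) ^ 2 * Real.exp (α * q / 2) * Real.exp (-α * q) :=
        mul_le_mul_of_nonneg_right e2 (Real.exp_pos _).le
    _ = _ := by
        rw [mul_assoc, ← Real.exp_add, ← Real.exp_add]
        congr 2
        rw [hq]; ring

/-- Bounds for the entropy and its derivatives in terms of Gaussian sandwich bounds. -/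
lemma exists_sandwich_bound {C₁ C₂ α : ℝ} (h₁ : 0 < C₁) (h₂ : 0 < C₂) (hα : 0 < α) :
    ∃ K : ℝ, 0 < K ∧ ∀ q u : ℝ, 0 ≤ q → C₁ * Real.exp (-α * q) ≤ u →
      u ≤ C₂ * Real.exp (-α * q) / (1 + C₂ * Real.exp (-α * q)) →
      u ∈ Ioo (0 : ℝ) 1 ∧ C₁ / (1 + C₂) * Real.exp (-α * q) ≤ u * (1 - u) ∧
      1 / (1 + C₂) ≤ 1 - u ∧
      |ent u| ≤ K * (1 + q) * Real.exp (-α * q) ∧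
      u * (1 - u) * (1 + ent' u ^ 2) ≤ K * (1 + q) ^ 2 * Real.exp (-α * q) := by
  set c := |Real.log C₁| + |Real.log C₂| + Real.log (1 + C₂) with hc
  have hlog : 0 ≤ Real.log (1 + C₂) := Real.log_nonneg (by linarith)
  have hc0 : 0 ≤ c := by positivity
  refine ⟨C₂ * (1 + c + α) ^ 2, by positivity, fun q u hq hl hu => ?_⟩
  set s := Real.exp (-α * q) with hs
  have hs0 : 0 < s := Real.exp_pos _
  have hs1 : s ≤ 1 := Real.exp_le_one_iff.2 (by nlinarith)
  have hu0 : 0 < u := (mul_pos h₁ hs0).trans_le hl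
  have hC : 0 < C₂ * s := mul_pos h₂ hs0
  have hu' : 1 / (1 + C₂) ≤ 1 - u := by
    have : 1 - C₂ * s / (1 + C₂ * s) = 1 / (1 + C₂ * s) := by field_simp; ring
    have h3 : 1 / (1 + C₂) ≤ 1 / (1 + C₂ * s) :=
      one_div_le_one_div_of_le (by positivity) (by nlinarith)
    linarith
  have hpos : 0 < 1 / (1 + C₂) := by positivity
  have hu1 : 0 < 1 - u := hpos.trans_le hu'
  have huC : u ≤ C₂ * s := hu.trans (div_le_self hC.le (by linarith))
  have l1 : |Real.log u| ≤ |Real.log C₁| + |Real.log C₂| + α * q := by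
    have a1 := Real.log_le_log (mul_pos h₁ hs0) hl
    have a2 := Real.log_le_log hu0 huC
    rw [Real.log_mul h₁.ne' hs0.ne', hs, Real.log_exp] at a1
    rw [Real.log_mul h₂.ne' hs0.ne', hs, Real.log_exp] at a2
    have : 0 ≤ α * q := by positivity
    rw [abs_le]
    constructor
    · linarith [neg_abs_le (Real.log C₁), abs_nonneg (Real.log C₂)]
    · linarith [le_abs_self (Real.log C₂), abs_nonneg (Real.log C₁)]
  have l2 : |Real.log (1 - u)| ≤ Real.log (1 + C₂) := by
    have a1 := Real.log_le_log hpos hu'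
    rw [one_div, Real.log_inv] at a1
    have a2 := Real.log_nonpos hu1.le (by linarith)
    rw [abs_le]; constructor <;> linarith
  have l3 : (1 - u) * |Real.log (1 - u)| ≤ u := by
    have a2 := Real.log_nonpos hu1.le (by linarith)
    have a1 := Real.one_sub_inv_le_log_of_pos hu1
    rw [abs_of_nonpos a2]
    have : (1 - u) * (1 - (1 - u)⁻¹) = -u := by field_simp; ring
    nlinarith
  have hαq : 0 ≤ α * q := by positivity
  have b' : |ent' u| ≤ c + α * q := by
    refine (abs_sub _ _).trans ?_
    linarith
  have hcq : 1 + c + α * q ≤ (1 + c + α) * (1 + q) := by nlinarith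
  have hm : 1 + c + α * q ≤ (1 + c + α) ^ 2 * (1 + q) := by
    refine hcq.trans ?_
    have : 1 + c + α ≤ (1 + c + α) ^ 2 := by nlinarith
    exact mul_le_mul_of_nonneg_right this (by positivity)
  refine ⟨⟨hu0, by linarith⟩, ?_, hu', ?_, ?_⟩
  · calc C₁ / (1 + C₂) * s = C₁ * s * (1 / (1 + C₂)) := by ring
      _ ≤ u * (1 - u) := mul_le_mul hl hu' hpos.le hu0.le
  · calc |ent u| ≤ |u * Real.log u| + |(1 - u) * Real.log (1 - u)| := abs_add_le _ _
      _ = u * |Real.log u| + (1 - u) * |Real.log (1 - u)| := by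
          rw [abs_mul, abs_mul, abs_of_pos hu0, abs_of_pos hu1]
      _ ≤ u * (c + α * q) + u :=
          add_le_add (mul_le_mul_of_nonneg_left (by linarith) hu0.le) l3
      _ = u * (1 + c + α * q) := by ring
      _ ≤ C₂ * s * ((1 + c + α) ^ 2 * (1 + q)) := mul_le_mul huC hm (by positivity) hC.le
      _ = _ := by ring
  · have h5 : ent' u ^ 2 ≤ (c + α * q) ^ 2 := by
      rw [← sq_abs]; exact pow_le_pow_left₀ (abs_nonneg _) b' 2
    calc u * (1 - u) * (1 + ent' u ^ 2) ≤ C₂ * s * ((1 + c + α) * (1 + q)) ^ 2 := by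
          refine mul_le_mul ?_ ?_ (by positivity) hC.le
          · nlinarith
          · have h6 := pow_le_pow_left₀ (by positivity) hcq 2
            nlinarith
      _ = _ := by ring

section Absorption

variable {X : Type*} [MeasurableSpace X] {μ : Measure X}

lemma integrable_of_tendsto_of_integral_le {G : ℕ → X → ℝ} {g : X → ℝ} {C : ℝ}
    (hG : ∀ n, Integrable (G n) μ) (h0 : ∀ n, 0 ≤ᵐ[μ] G n)
    (hC : ∀ᶠ n in atTop, ∫ x, G n x ∂μ ≤ C)
    (hg : ∀ᵐ x ∂μ, Tendsto (fun n => G n x) atTop (nhds (g x))) : Integrable g μ := by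
  refine ⟨aestronglyMeasurable_of_tendsto_ae _ (fun n => (hG n).1) hg, ?_⟩
  have hf : ∫⁻ x, ‖g x‖ₑ ∂μ ≤ liminf (fun n => ∫⁻ x, ‖G n x‖ₑ ∂μ) atTop := by
    refine le_trans (le_of_eq (lintegral_congr_ae ?_))
      (lintegral_liminf_le' fun n => (hG n).1.aemeasurable.enorm)
    filter_upwards [hg] with x hx using hx.enorm.liminf_eq.symm
  refine (hf.trans (liminf_le_of_le (h := ?_))).trans_lt (ENNReal.ofReal_lt_top (r := C))
  · intro b hb
    obtain ⟨n, h1, h2⟩ := (hb.and hC).exists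
    refine h1.trans ?_
    rw [← ofReal_integral_norm_eq_lintegral_enorm (hG n)]
    refine ENNReal.ofReal_le_ofReal (le_trans (le_of_eq ?_) h2)
    refine integral_congr_ae ?_
    filter_upwards [h0 n] with x hx using norm_of_nonneg hx

/-- Passing to the limit in a localized dissipation identity whose error terms are absorbed by
the dissipation `D`. -/
lemma integrable_and_eq_of_absorption {χ E τ : ℕ → X → ℝ} {D w y G : X → ℝ} {κ M l : ℝ}
    {L : ℕ → ℝ} (hκ : 0 < κ) (hM : 0 ≤ M)
    (hχ0 : ∀ n x, 0 ≤ χ n x) (hχ1 : ∀ n x, χ n x ≤ 1)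
    (hχ : ∀ x, Tendsto (fun n => χ n x) atTop (nhds 1))
    (hχm : ∀ n, AEStronglyMeasurable (χ n) μ)
    (hD0 : 0 ≤ᵐ[μ] D) (hw0 : 0 ≤ᵐ[μ] w) (hw : Integrable w μ) (hy : Integrable y μ)
    (hGl : ∀ᵐ x ∂μ, κ * D x - M * w x ≤ G x) (hGu : ∀ᵐ x ∂μ, |G x| ≤ M * (D x + w x))
    (hE : ∀ n : ℕ, ∀ᵐ x ∂μ, |E n x| ≤ M / (n + 1) * (χ n x * D x + w x))
    (hτ : ∀ n : ℕ, ∀ᵐ x ∂μ, |τ n x| ≤ M / (n + 1) * y x)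
    (hGm : AEStronglyMeasurable G μ)
    (hDχ : ∀ n, Integrable (fun x => χ n x * D x) μ)
    (hL : ∀ n, L n = (∫ x, τ n x ∂μ) - ((∫ x, G x * χ n x ∂μ) + ∫ x, E n x ∂μ))
    (hLl : Tendsto L atTop (nhds l)) :
    Integrable D μ ∧ Integrable G μ ∧ l = -∫ x, G x ∂μ := by
  have hGχ : ∀ n, Integrable (fun x => G x * χ n x) μ := fun n => by
    refine Integrable.mono' (((hDχ n).add hw).const_mul M) (hGm.mul (hχm n)) ?_
    filter_upwards [hGu, hw0] with x h1 h2
    simp only [Pi.add_apply, Pi.zero_apply] at h2 ⊢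
    rw [Real.norm_eq_abs, abs_mul, abs_of_nonneg (hχ0 n x)]
    calc |G x| * χ n x ≤ M * (D x + w x) * χ n x := mul_le_mul_of_nonneg_right h1 (hχ0 n x)
      _ = M * (χ n x * D x + w x * χ n x) := by ring
      _ ≤ _ := by
          refine mul_le_mul_of_nonneg_left ?_ hM
          have := mul_le_of_le_one_right h2 (hχ1 n x)
          linarith
  have hτi : ∀ n : ℕ, |∫ x, τ n x ∂μ| ≤ M / (n + 1) * ∫ x, y x ∂μ := fun n => by
    rw [← integral_const_mul]
    exact norm_integral_le_of_norm_le (f := τ n) (hy.const_mul _) (hτ n)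
  have hEi : ∀ n : ℕ, |∫ x, E n x ∂μ| ≤ M / (n + 1) * ((∫ x, χ n x * D x ∂μ) + ∫ x, w x ∂μ) :=
    fun n => by
      rw [← integral_add (hDχ n) hw, ← integral_const_mul]
      exact norm_integral_le_of_norm_le (f := E n) (((hDχ n).add hw).const_mul _) (hE n)
  have hGi : ∀ n, κ * (∫ x, χ n x * D x ∂μ) - M * ∫ x, w x ∂μ ≤ ∫ x, G x * χ n x ∂μ := fun n => by
    rw [← integral_const_mul, ← integral_const_mul,
      ← integral_sub ((hDχ n).const_mul _) (hw.const_mul _)]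
    refine integral_mono_ae (((hDχ n).const_mul _).sub (hw.const_mul _)) (hGχ n) ?_
    filter_upwards [hGl, hw0] with x h1 h2
    simp only [Pi.zero_apply] at h2 ⊢
    have h3 := mul_le_mul_of_nonneg_right h1 (hχ0 n x)
    have h4 := mul_le_mul_of_nonneg_left (mul_le_of_le_one_right h2 (hχ1 n x)) hM
    nlinarith
  have hMn : Tendsto (fun n : ℕ => M / ((n : ℝ) + 1)) atTop (nhds 0) := by
    simpa [div_eq_mul_inv] using tendsto_one_div_add_atTop_nhds_zero_nat.const_mul M
  have hY : 0 ≤ M * ∫ x, y x ∂μ := by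
    have := (abs_nonneg _).trans (hτi 0)
    simpa using this
  have hW : 0 ≤ ∫ x, w x ∂μ := integral_nonneg_of_ae hw0
  have hbd : ∀ᶠ n in atTop, ∫ x, χ n x * D x ∂μ ≤
      2 / κ * (M * (∫ x, w x ∂μ) + M * (∫ x, y x ∂μ) + M * (∫ x, w x ∂μ) + (|l| + 1)) := by
    filter_upwards [hMn.eventually_le_const (by positivity : (0 : ℝ) < κ / 2),
      hLl.abs.eventually_le_const (lt_add_one |l|)] with n h1 h2
    have e1 := le_of_abs_le (hτi n)
    have e2 := neg_le_of_abs_le (hEi n)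
    have e3 := hGi n
    have e4 := neg_le_of_abs_le h2
    have hn : M / ((n : ℝ) + 1) ≤ M :=
      div_le_self hM (by linarith [(Nat.cast_nonneg n : (0 : ℝ) ≤ n)])
    have hd : 0 ≤ ∫ x, χ n x * D x ∂μ := integral_nonneg_of_ae (by
      filter_upwards [hD0] with x hx using mul_nonneg (hχ0 n x) hx)
    have e5 : M / ((n : ℝ) + 1) * ∫ x, y x ∂μ ≤ M * ∫ x, y x ∂μ := by
      rw [div_mul_eq_mul_div]
      exact div_le_self hY (by linarith [(Nat.cast_nonneg n : (0 : ℝ) ≤ n)])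
    have e6 := mul_le_mul_of_nonneg_right h1 hd
    have e7 := mul_le_mul_of_nonneg_right hn hW
    have e8 := hL n
    have : κ / 2 * ∫ x, χ n x * D x ∂μ ≤
        M * (∫ x, w x ∂μ) + M * (∫ x, y x ∂μ) + M * (∫ x, w x ∂μ) + (|l| + 1) := by linarith
    calc ∫ x, χ n x * D x ∂μ = 2 / κ * (κ / 2 * ∫ x, χ n x * D x ∂μ) := by field_simp
      _ ≤ _ := mul_le_mul_of_nonneg_left this (by positivity)
  have hDi : Integrable D μ := by
    refine integrable_of_tendsto_of_integral_le hDχ (fun n => ?_) hbd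
      (Eventually.of_forall fun x => ?_)
    · filter_upwards [hD0] with x hx using mul_nonneg (hχ0 n x) hx
    · simpa using (hχ x).mul_const (D x)
  have hGi' : Integrable G μ := Integrable.mono' ((hDi.add hw).const_mul M) hGm hGu
  refine ⟨hDi, hGi', tendsto_nhds_unique hLl ?_⟩
  have t1 : Tendsto (fun n => ∫ x, τ n x ∂μ) atTop (nhds 0) :=
    squeeze_zero_norm hτi (by simpa using hMn.mul_const (∫ x, y x ∂μ))
  have t2 : Tendsto (fun n => ∫ x, E n x ∂μ) atTop (nhds 0) := by
    refine squeeze_zero_norm (fun n => (hEi n).trans ?_)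
      (by simpa using hMn.mul_const ((∫ x, D x ∂μ) + ∫ x, w x ∂μ))
    refine mul_le_mul_of_nonneg_left ?_ (by positivity)
    refine add_le_add (integral_mono_ae (hDχ n) hDi ?_) le_rfl
    filter_upwards [hD0] with x hx using mul_le_of_le_one_left hx (hχ1 n x)
  have t3 : Tendsto (fun n => ∫ x, G x * χ n x ∂μ) atTop (nhds (∫ x, G x ∂μ)) := by
    refine tendsto_integral_of_dominated_convergence (fun x => |G x|) (fun n => (hGχ n).1)
      hGi'.abs (fun n => Eventually.of_forall fun x => ?_) (Eventually.of_forall fun x => ?_)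
    · rw [Real.norm_eq_abs, abs_mul, abs_of_nonneg (hχ0 n x)]
      exact mul_le_of_le_one_right (abs_nonneg _) (hχ1 n x)
    · simpa using (hχ x).const_mul (G x)
  have := t1.sub (t3.add t2)
  simp only [zero_sub, add_zero] at this
  exact this.congr fun n => (hL n).symm

end Absorption

/-- Smooth cutoffs exhausting phase space whose derivatives decay. -/
lemma exists_cutoff (N : ℕ) : ∃ (η : ℕ → En N × En N → ℝ) (L : ℝ), 0 ≤ L ∧
    (∀ n, ContDiff ℝ (⊤ : ℕ∞) (η n)) ∧ (∀ n, HasCompactSupport (η n)) ∧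
    (∀ n z, 0 ≤ η n z) ∧ (∀ n z, η n z ≤ 1) ∧
    (∀ n : ℕ, ∀ i z, |dX i (η n) z| ≤ L / (n + 1)) ∧
    (∀ n : ℕ, ∀ i z, |dV i (η n) z| ≤ L / (n + 1)) ∧
    ∀ z, Tendsto (fun n => η n z) atTop (nhds 1) := by
  let b : ContDiffBump (0 : En N × En N) := ⟨1, 2, one_pos, one_lt_two⟩
  have hb : ContDiff ℝ (⊤ : ℕ∞) b := b.contDiff
  obtain ⟨L, hL⟩ : ∃ L, ∀ z, ‖fderiv ℝ b z‖ ≤ L :=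
    (hb.continuous_fderiv (by simp)).bounded_above_of_compact_support
      (b.hasCompactSupport.fderiv (𝕜 := ℝ))
  have hL0 : 0 ≤ L := (norm_nonneg _).trans (hL 0)
  have hfd : ∀ (n : ℕ) (z e : En N × En N), ‖e‖ ≤ 1 →
      |fderiv ℝ (fun z => b (((n : ℝ) + 1)⁻¹ • z)) z e| ≤ L / (n + 1) := fun n z e he => by
    have h1 : HasFDerivAt (fun z : En N × En N => b (((n : ℝ) + 1)⁻¹ • z)) _ z :=
      ((hb.differentiable (by simp)) _).hasFDerivAt.comp z
        ((hasFDerivAt_id z).const_smul ((n : ℝ) + 1)⁻¹)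
    rw [h1.fderiv, ContinuousLinearMap.comp_apply]
    refine ((fderiv ℝ b (((n : ℝ) + 1)⁻¹ • z)).le_opNorm _).trans ?_
    rw [div_eq_mul_inv]
    refine mul_le_mul (hL _) ?_ (norm_nonneg _) hL0
    simp only [_root_.smul_apply, ContinuousLinearMap.id_apply, norm_smul, norm_inv]
    rw [norm_of_nonneg (by positivity : (0 : ℝ) ≤ (n : ℝ) + 1)]
    exact mul_le_of_le_one_right (by positivity) he
  refine ⟨fun n z => b (((n : ℝ) + 1)⁻¹ • z), L, hL0, fun n => ?_, fun n => ?_, fun n z => b.nonneg,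
    fun n z => b.le_one, fun n i z => hfd n z _ ?_, fun n i z => hfd n z _ ?_, fun z => ?_⟩
  · exact hb.comp (contDiff_const_smul _)
  · exact b.hasCompactSupport.comp_smul (by positivity)
  · simp [Prod.norm_def]
  · simp [Prod.norm_def]
  · refine tendsto_const_nhds.congr' ?_
    filter_upwards [eventually_ge_atTop ⌈‖z‖⌉₊] with n hn
    refine (b.one_of_mem_closedBall ?_).symm
    rw [mem_closedBall_zero_iff, norm_smul, norm_inv,
      norm_of_nonneg (by positivity : (0 : ℝ) ≤ (n : ℝ) + 1)]
    change _ ≤ (1 : ℝ)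
    rw [inv_mul_le_iff₀ (by positivity)]
    have := (Nat.le_ceil ‖z‖).trans (Nat.cast_le.2 hn)
    linarith

/-- A squared cutoff, with the derivative bounds used to absorb error terms. -/
lemma dV_sq {N : ℕ} {η : En N × En N → ℝ} (h : ContDiff ℝ (⊤ : ℕ∞) η) (j : Fin N)
    (z : En N × En N) : dV j (fun z => η z ^ 2) z = 2 * η z * dV j η z := by
  simp only [dV]
  rw [(((h.differentiable (by simp)) z).hasFDerivAt.pow 2).fderiv]
  simp

lemma dX_sq {N : ℕ} {η : En N × En N → ℝ} (h : ContDiff ℝ (⊤ : ℕ∞) η) (j : Fin N)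
    (z : En N × En N) : dX j (fun z => η z ^ 2) z = 2 * η z * dX j η z := by
  simp only [dX]
  rw [(((h.differentiable (by simp)) z).hasFDerivAt.pow 2).fderiv]
  simp

lemma abs_transport_sq_le {N : ℕ} {η : En N × En N → ℝ} (h : ContDiff ℝ (⊤ : ℕ∞) η)
    (h0 : ∀ z, 0 ≤ η z) (h1 : ∀ z, η z ≤ 1) {L : ℝ} (hL : ∀ i z, |dX i η z| ≤ L)
    (z : En N × En N) : |transport (fun z => η z ^ 2) z| ≤ 2 * L * ∑ i, |z.2 i| := by
  unfold transport
  refine (Finset.abs_sum_le_sum_abs _ _).trans ?_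
  rw [Finset.mul_sum]
  refine Finset.sum_le_sum fun i _ => ?_
  rw [dX_sq h, abs_mul, abs_mul, abs_mul, abs_two, abs_of_nonneg (h0 z)]
  have := mul_le_mul (h1 z) (hL i z) (abs_nonneg _) zero_le_one
  nlinarith [abs_nonneg (z.2 i)]

section Pointwise

variable {N : ℕ} {A : Fin N → Fin N → ℝ} {b d : Fin N → ℝ} {ε Λ h : ℝ}

lemma mul_le_sq_div_add (hh : 0 < h) (x y : ℝ) : |x| * |y| ≤ x ^ 2 / h + h * y ^ 2 := by
  have : x ^ 2 / h + h * y ^ 2 = (|x| ^ 2 + (h * |y|) ^ 2) / h := by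
    rw [sq_abs, mul_pow, sq_abs]; field_simp
  rw [this, le_div_iff₀ hh]
  nlinarith [sq_nonneg (|x| - h * |y|), sq_nonneg |x|, sq_nonneg (h * |y|)]

lemma abs_flux_mul_le (hε : 0 < ε) (hΛ : 0 ≤ Λ) (hh : 0 < h) (hA : ∀ i j, |A i j| ≤ Λ)
    (hb : ∀ j, |b j| ≤ Λ) (j : Fin N) {η : ℝ} (hη0 : 0 ≤ η) (hη1 : η ≤ 1) (r : ℝ) :
    |((∑ i, A i j * d i) + ε * d j - b j * h) * r| * η
      ≤ (N * Λ + ε + Λ) * (η ^ 2 * ((∑ i, d i ^ 2) / h) + h * (1 + r ^ 2)) := by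
  have hi : ∀ i, |d i| * |r| * η ≤ η ^ 2 * ((∑ i, d i ^ 2) / h) + h * (1 + r ^ 2) := fun i => by
    have h1 := mul_le_sq_div_add hh (d i * η) r
    rw [abs_mul, abs_of_nonneg hη0] at h1
    have h2 : d i ^ 2 ≤ ∑ i, d i ^ 2 :=
      Finset.single_le_sum (f := fun i => d i ^ 2) (fun i _ => sq_nonneg _) (Finset.mem_univ i)
    have h3 : (d i * η) ^ 2 / h ≤ η ^ 2 * ((∑ i, d i ^ 2) / h) := by
      rw [mul_pow, mul_comm, mul_div_assoc]
      gcongr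
    nlinarith
  have h0 : 0 ≤ η ^ 2 * ((∑ i, d i ^ 2) / h) :=
    mul_nonneg (sq_nonneg _) (div_nonneg (Finset.sum_nonneg fun i _ => sq_nonneg _) hh.le)
  have hr : h * |r| * η ≤ η ^ 2 * ((∑ i, d i ^ 2) / h) + h * (1 + r ^ 2) := by
    have h1 : h * |r| * η ≤ h * |r| := mul_le_of_le_one_right (by positivity) hη1
    have h2 : |r| ≤ 1 + r ^ 2 := by rw [← sq_abs]; nlinarith [sq_nonneg (|r| - 1), abs_nonneg r]
    nlinarith
  set W := η ^ 2 * ((∑ i, d i ^ 2) / h) + h * (1 + r ^ 2)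
  have hs : |∑ i, A i j * d i| * |r| * η ≤ N * Λ * W := by
    calc |∑ i, A i j * d i| * |r| * η ≤ (∑ i, Λ * |d i|) * |r| * η := by
          refine mul_le_mul_of_nonneg_right (mul_le_mul_of_nonneg_right ?_ (abs_nonneg _)) hη0
          refine (Finset.abs_sum_le_sum_abs _ _).trans (Finset.sum_le_sum fun i _ => ?_)
          rw [abs_mul]
          exact mul_le_mul_of_nonneg_right (hA i j) (abs_nonneg _)
      _ = ∑ i, Λ * (|d i| * |r| * η) := by
          rw [Finset.sum_mul, Finset.sum_mul]
          exact Finset.sum_congr rfl fun i _ => by ring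
      _ ≤ ∑ _i : Fin N, Λ * W :=
          Finset.sum_le_sum fun i _ => mul_le_mul_of_nonneg_left (hi i) hΛ
      _ = N * Λ * W := by simp; ring
  have ht : |(∑ i, A i j * d i) + ε * d j - b j * h|
      ≤ |∑ i, A i j * d i| + ε * |d j| + Λ * h := by
    refine (abs_sub _ _).trans (add_le_add ((abs_add_le _ _).trans ?_) ?_)
    · rw [abs_mul, abs_of_pos hε]
    · rw [abs_mul, abs_of_pos hh]
      exact mul_le_mul_of_nonneg_right (hb j) hh.le
  rw [abs_mul]
  calc |(∑ i, A i j * d i) + ε * d j - b j * h| * |r| * η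
      ≤ (|∑ i, A i j * d i| + ε * |d j| + Λ * h) * |r| * η :=
        mul_le_mul_of_nonneg_right (mul_le_mul_of_nonneg_right ht (abs_nonneg _)) hη0
    _ = |∑ i, A i j * d i| * |r| * η + ε * (|d j| * |r| * η) + Λ * (h * |r| * η) := by ring
    _ ≤ N * Λ * W + ε * W + Λ * W :=
        add_le_add (add_le_add hs (mul_le_mul_of_nonneg_left (hi j) hε.le))
          (mul_le_mul_of_nonneg_left hr hΛ)
    _ = _ := by ring

lemma flux_mul_grad_eq (hh : 0 < h) :
    ∑ j, ((∑ i, A i j * d i) + ε * d j - b j * h) * (h⁻¹ * d j)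
      = (∑ i, ∑ j, A i j * d i * d j) / h + ε * ((∑ i, d i ^ 2) / h) - ∑ j, b j * d j := by
  rw [Finset.sum_comm, Finset.sum_div, Finset.sum_div, Finset.mul_sum, ← Finset.sum_add_distrib,
    ← Finset.sum_sub_distrib]
  refine Finset.sum_congr rfl fun j _ => ?_
  rw [← Finset.sum_mul]
  field_simp

lemma le_flux_mul_grad (hε : 0 < ε) (hh : 0 < h)
    (hp : 0 ≤ ∑ i, ∑ j, A i j * d i * d j) (hb : ∀ j, |b j| ≤ Λ) :
    3 * ε / 4 * ((∑ i, d i ^ 2) / h) - N * Λ ^ 2 / ε * h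
      ≤ ∑ j, ((∑ i, A i j * d i) + ε * d j - b j * h) * (h⁻¹ * d j) := by
  rw [flux_mul_grad_eq hh]
  have h1 : ∑ j, b j * d j ≤ ∑ j, (ε / 4 * (d j ^ 2 / h) + Λ ^ 2 / ε * h) := by
    refine Finset.sum_le_sum fun j _ => ?_
    have h2 : b j * d j ≤ Λ * |d j| := (le_abs_self _).trans (by
      rw [abs_mul]; exact mul_le_mul_of_nonneg_right (hb j) (abs_nonneg _))
    refine h2.trans ?_
    have h3 : ε / 4 * (d j ^ 2 / h) + Λ ^ 2 / ε * h - Λ * |d j|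
        = (ε * |d j| / 2 - Λ * h) ^ 2 / (ε * h) := by
      rw [sub_sq, div_pow, mul_pow, sq_abs]
      field_simp
      ring
    have : 0 ≤ (ε * |d j| / 2 - Λ * h) ^ 2 / (ε * h) := by positivity
    linarith
  rw [Finset.sum_add_distrib, ← Finset.mul_sum, ← Finset.sum_div] at h1
  simp only [Finset.sum_const, Finset.card_univ, Fintype.card_fin, nsmul_eq_mul] at h1
  have h4 : 0 ≤ (∑ i, ∑ j, A i j * d i * d j) / h := div_nonneg hp hh.le
  have h5 : (N : ℝ) * Λ ^ 2 / ε * h = N * (Λ ^ 2 / ε * h) := by ring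
  linarith

end Pointwise

namespace IsSlabSol

variable {N : ℕ} {T : ℝ} {f : ℝ × En N × En N → ℝ} {Df F : Fin N → ℝ × En N × En N → ℝ}
  {f₀ : En N × En N → ℝ}

lemma integrable_comp_mul (h : IsSlabSol T f Df F f₀) {γ : ℝ → ℝ} (hγ : Measurable γ)
    (hγc : ContinuousOn γ (Ioo 0 1)) {U : ℝ × En N × En N → ℝ} (hU : Integrable U (slab N T))
    {k : En N × En N → ℝ} (hk : Continuous k) (hkc : HasCompactSupport k) :
    Integrable (fun p => γ (f p) * (U p * k p.2)) (slab N T) := by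
  obtain ⟨R, hR⟩ := exists_norm_le_of_hasCompactSupport hkc
  obtain ⟨M, hM⟩ := hkc.exists_bound_of_continuous hk
  obtain ⟨c, hc, hm, -⟩ := h.bound R
  obtain ⟨K, hK⟩ := isCompact_Icc.exists_bound_of_continuousOn
    (hγc.mono (Icc_subset_Ioo_unit hc))
  refine integrable_bdd_mul_of_support (K := K) (hU.mul_bdd (c := M)
    (hk.comp continuous_snd).aestronglyMeasurable (Eventually.of_forall fun p => hM p.2))
    (hγ.comp h.measurable) ?_
  filter_upwards [hm] with p hp h0
  exact hK _ (hp (hR _ (right_ne_zero_of_mul h0)))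

/-- The entropy identity for solutions whose flux has the structure of a regularized
drift-diffusion operator. -/
theorem entropy_identity (h : IsSlabSol T f Df F f₀) {A : Fin N → Fin N → ℝ × En N × En N → ℝ}
    {b : Fin N → ℝ × En N × En N → ℝ} {ε Λ : ℝ} (hε : 0 < ε) (hΛ : 0 ≤ Λ)
    (hF : ∀ j p, F j p = (∑ i, A i j p * Df i p) + ε * Df j p - b j p * (f p * (1 - f p)))
    (hA : ∀ᵐ p ∂slab N T, ∀ i j, |A i j p| ≤ Λ) (hb : ∀ᵐ p ∂slab N T, ∀ j, |b j p| ≤ Λ)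
    (hpsd : ∀ᵐ p ∂slab N T, 0 ≤ ∑ i, ∑ j, A i j p * Df i p * Df j p)
    (hw : Integrable (fun p => f p * (1 - f p) * (1 + ent' (f p) ^ 2)) (slab N T))
    (hy : Integrable (fun p => |ent (f p)| * ∑ i, |p.2.2 i|) (slab N T))
    (he : Integrable (fun p => ent (f p)) (slab N T)) (he₀ : Integrable fun z => ent (f₀ z)) :
    ∀ᵐ t, t ∈ Ioo 0 T →
      Integrable (fun p => (∑ i, Df i p ^ 2) / (f p * (1 - f p))) (slab N t) ∧
      (∫ z, ent (f (t, z))) - ∫ z, ent (f₀ z)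
        = -∫ p, ∑ j, F j p * ((f p * (1 - f p))⁻¹ * Df j p) ∂slab N t := by
  obtain ⟨η, L, hL, hη, hηc, hη0, hη1, hηX, hηV, hηt⟩ := exists_cutoff N
  have het := (ae_restrict_iff' measurableSet_Ioo).1 he.prod_right_ae
  filter_upwards [h.integral_renorm isRenorm_ent, het] with t hren het ht
  replace hren := hren ht
  replace het := het ht
  have h' := h.mono ht.2.le
  have hle := slab_ae_of_le (N := N) ht.2.le
  have hm := slab_mono (N := N) ht.2.le
  have hχ : ∀ n, ContDiff ℝ (⊤ : ℕ∞) fun z => η n z ^ 2 := fun n => (hη n).pow 2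
  have hχc : ∀ n, HasCompactSupport fun z => η n z ^ 2 := fun n => by
    simp only [pow_two]; exact (hηc n).mul_left
  have hχ1 : ∀ n z, η n z ^ 2 ≤ 1 := fun n z => pow_le_one₀ (hη0 n z) (hη1 n z)
  have hχt : ∀ z, Tendsto (fun n => η n z ^ 2) atTop (nhds 1) := fun z => by
    simpa using (hηt z).pow 2
  have hI : ∀ᵐ p ∂slab N t, f p ∈ Ioo (0 : ℝ) 1 := h'.ae_mem_Ioo
  have hpos : ∀ᵐ p ∂slab N t, 0 < f p * (1 - f p) := by
    filter_upwards [hI] with p hp using mul_pos hp.1 (sub_pos.2 hp.2)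
  have iG : ∀ n j, Integrable (fun p => F j p * (ent'' (f p) * η n p.2 ^ 2 * Df j p)) (slab N t) :=
    fun n j => by
      have := h'.integrable_comp_mul isRenorm_ent.measurable'' isRenorm_ent.continuousOn''
        (memLp_two_integrable_mul (h'.memLp_flux j) (h'.memLp_grad j)) (hχ n).continuous (hχc n)
      exact this.congr (Eventually.of_forall fun p => by ring)
  have iE : ∀ n j, Integrable
      (fun p => F j p * (ent' (f p) * dV j (fun z => η n z ^ 2) p.2)) (slab N t) := fun n j => by
    obtain ⟨R, hR⟩ := exists_norm_le_of_hasCompactSupport (hasCompactSupport_dV (hχc n) j)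
    obtain ⟨c, hc, hbd, -⟩ := h'.bound R
    obtain ⟨K', hK'⟩ := isRenorm_ent.exists_bound hc
    have := integrable_mul_comp_snd (h'.memLp_flux j) (memLp_two_of_hasCompactSupport
      (continuous_dV (hχ n) j) (hasCompactSupport_dV (hχc n) j))
    refine (integrable_bdd_mul_of_support (K := K') this
      (isRenorm_ent.measurable'.comp h.measurable) ?_).congr
      (Eventually.of_forall fun p => by simp only [Function.comp]; ring)
    filter_upwards [hbd] with p hp h0
    exact (hK' _ (hp (hR _ (right_ne_zero_of_mul h0)))).2.1
  have key : ∀ n, ∫ z, (ent (f (t, z)) - ent (f₀ z)) * η n z ^ 2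
      = (∫ p, ent (f p) * transport (fun z => η n z ^ 2) p.2 ∂slab N t)
        - ((∫ p, (∑ j, F j p * ((f p * (1 - f p))⁻¹ * Df j p)) * η n p.2 ^ 2 ∂slab N t)
          + ∫ p, ∑ j, F j p * (ent' (f p) * dV j (fun z => η n z ^ 2) p.2) ∂slab N t) := fun n => by
    rw [hren _ (hχ n) (hχc n), Finset.sum_add_distrib, ← integral_finsetSum _ fun j _ => iG n j,
      ← integral_finsetSum _ fun j _ => iE n j]
    have e : ∀ p, (∑ j, F j p * ((f p * (1 - f p))⁻¹ * Df j p)) * η n p.2 ^ 2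
        = ∑ j, F j p * (ent'' (f p) * η n p.2 ^ 2 * Df j p) := fun p => by
      simp only [Finset.sum_mul, ent'']
      exact Finset.sum_congr rfl fun j _ => by ring
    simp only [e]
  set c₀ : ℝ := N * Λ + ε + Λ with hc₀
  have hc₀0 : 0 ≤ c₀ := by positivity
  have main := integrable_and_eq_of_absorption (μ := slab N t)
    (χ := fun n p => η n p.2 ^ 2)
    (E := fun n p => ∑ j, F j p * (ent' (f p) * dV j (fun z => η n z ^ 2) p.2))
    (τ := fun n p => ent (f p) * transport (fun z => η n z ^ 2) p.2)
    (D := fun p => (∑ i, Df i p ^ 2) / (f p * (1 - f p)))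
    (w := fun p => f p * (1 - f p) * (1 + ent' (f p) ^ 2))
    (y := fun p => |ent (f p)| * ∑ i, |p.2.2 i|)
    (G := fun p => ∑ j, F j p * ((f p * (1 - f p))⁻¹ * Df j p))
    (κ := 3 * ε / 4) (M := N * Λ ^ 2 / ε + 2 * N * c₀ + N * c₀ * (2 * L) + 2 * L)
    (l := ∫ z, (ent (f (t, z)) - ent (f₀ z)))
    (L := fun n => ∫ z, (ent (f (t, z)) - ent (f₀ z)) * η n z ^ 2)
    (by positivity) (by positivity) (fun n p => sq_nonneg _) (fun n p => hχ1 n p.2)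
    (fun p => hχt p.2) (fun n => ((hχ n).continuous.comp continuous_snd).aestronglyMeasurable)
    ?_ ?_ (hw.mono_measure hm) (hy.mono_measure hm) ?_ ?_ ?_ ?_ ?_ ?_ key ?_
  · refine ⟨main.1, ?_⟩
    rw [← integral_sub het he₀]
    exact main.2.2
  · filter_upwards [hpos] with p hp
    exact div_nonneg (Finset.sum_nonneg fun i _ => sq_nonneg _) hp.le
  · filter_upwards [hpos] with p hp
    exact mul_nonneg hp.le (by positivity)
  · filter_upwards [hpos, hle hb, hle hpsd] with p hp hb hpsd
    simp only [hF]
    refine le_trans ?_ (le_flux_mul_grad hε hp hpsd hb)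
    refine sub_le_sub le_rfl ?_
    refine mul_le_mul ?_ (le_mul_of_one_le_right hp.le (by nlinarith [sq_nonneg (ent' (f p))]))
      hp.le (by positivity)
    have : 0 ≤ 2 * N * c₀ + N * c₀ * (2 * L) + 2 * L := by positivity
    linarith
  · filter_upwards [hpos, hle hb, hle hA] with p hp hb hA
    have hD : 0 ≤ (∑ i, Df i p ^ 2) / (f p * (1 - f p)) :=
      div_nonneg (Finset.sum_nonneg fun i _ => sq_nonneg _) hp.le
    have hw0 : f p * (1 - f p) ≤ f p * (1 - f p) * (1 + ent' (f p) ^ 2) :=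
      le_mul_of_one_le_right hp.le (by nlinarith [sq_nonneg (ent' (f p))])
    set w := f p * (1 - f p) * (1 + ent' (f p) ^ 2)
    set D := (∑ i, Df i p ^ 2) / (f p * (1 - f p))
    calc |∑ j, F j p * ((f p * (1 - f p))⁻¹ * Df j p)| ≤ ∑ _j : Fin N, c₀ * (2 * (D + w)) := by
          refine (Finset.abs_sum_le_sum_abs _ _).trans (Finset.sum_le_sum fun j _ => ?_)
          have h1 := abs_flux_mul_le (d := fun i => Df i p) hε hΛ hp hA hb j zero_le_one le_rfl
            ((f p * (1 - f p))⁻¹ * Df j p)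
          rw [mul_one, ← hF] at h1
          refine h1.trans (mul_le_mul_of_nonneg_left ?_ hc₀0)
          have h2 : f p * (1 - f p) * ((f p * (1 - f p))⁻¹ * Df j p) ^ 2 ≤ D := by
            have : f p * (1 - f p) * ((f p * (1 - f p))⁻¹ * Df j p) ^ 2
                = Df j p ^ 2 / (f p * (1 - f p)) := by field_simp
            rw [this]
            refine div_le_div_of_nonneg_right ?_ hp.le
            exact Finset.single_le_sum (f := fun i => Df i p ^ 2) (fun i _ => sq_nonneg _)
              (Finset.mem_univ j)
          change 1 ^ 2 * D + _ ≤ _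
          nlinarith
      _ = 2 * N * c₀ * (D + w) := by simp; ring
      _ ≤ _ := by
          refine mul_le_mul_of_nonneg_right ?_ (by linarith)
          have : 0 ≤ N * Λ ^ 2 / ε + N * c₀ * (2 * L) + 2 * L := by positivity
          linarith
  · intro n
    filter_upwards [hpos, hle hb, hle hA] with p hp hb hA
    have hD : 0 ≤ (∑ i, Df i p ^ 2) / (f p * (1 - f p)) :=
      div_nonneg (Finset.sum_nonneg fun i _ => sq_nonneg _) hp.le
    have hw0 : 0 ≤ f p * (1 - f p) * (1 + ent' (f p) ^ 2) := mul_nonneg hp.le (by positivity)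
    calc |∑ j, F j p * (ent' (f p) * dV j (fun z => η n z ^ 2) p.2)|
        ≤ ∑ _j : Fin N, 2 * (L / (n + 1)) * (c₀ * (η n p.2 ^ 2 *
          ((∑ i, Df i p ^ 2) / (f p * (1 - f p))) + f p * (1 - f p) * (1 + ent' (f p) ^ 2))) := by
          refine (Finset.abs_sum_le_sum_abs _ _).trans (Finset.sum_le_sum fun j _ => ?_)
          have h1 := abs_flux_mul_le (d := fun i => Df i p) hε hΛ hp hA hb j (hη0 n p.2)
            (hη1 n p.2) (ent' (f p))
          rw [← hF] at h1
          rw [dV_sq (hη n), show F j p * (ent' (f p) * (2 * η n p.2 * dV j (η n) p.2))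
            = 2 * dV j (η n) p.2 * (F j p * ent' (f p) * η n p.2) by ring, abs_mul, abs_mul,
            abs_two, abs_mul (F j p * _), abs_of_nonneg (hη0 n p.2)]
          refine mul_le_mul (mul_le_mul_of_nonneg_left (hηV n j p.2) two_pos.le) h1
            (mul_nonneg (abs_nonneg _) (hη0 n p.2)) (by positivity)
      _ = N * c₀ * (2 * L) / (n + 1) * (η n p.2 ^ 2 * ((∑ i, Df i p ^ 2) / (f p * (1 - f p)))
          + f p * (1 - f p) * (1 + ent' (f p) ^ 2)) := by
          simp only [Finset.sum_const, Finset.card_univ, Fintype.card_fin, nsmul_eq_mul]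
          ring
      _ ≤ _ := by
          refine mul_le_mul_of_nonneg_right (div_le_div_of_nonneg_right ?_ (by positivity))
            (by positivity)
          have : 0 ≤ N * Λ ^ 2 / ε + 2 * N * c₀ + 2 * L := by positivity
          linarith
  · intro n
    refine Eventually.of_forall fun p => ?_
    have h1 := abs_transport_sq_le (hη n) (hη0 n) (hη1 n) (hηX n) p.2
    have hs : 0 ≤ ∑ i, |p.2.2 i| := Finset.sum_nonneg fun i _ => abs_nonneg _
    calc |ent (f p) * transport (fun z => η n z ^ 2) p.2|
        ≤ |ent (f p)| * (2 * (L / (n + 1)) * ∑ i, |p.2.2 i|) := by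
          rw [abs_mul]; exact mul_le_mul_of_nonneg_left h1 (abs_nonneg _)
      _ = 2 * L / (n + 1) * (|ent (f p)| * ∑ i, |p.2.2 i|) := by ring
      _ ≤ _ := by
          refine mul_le_mul_of_nonneg_right (div_le_div_of_nonneg_right ?_ (by positivity))
            (by positivity)
          have : 0 ≤ N * Λ ^ 2 / ε + 2 * N * c₀ + N * c₀ * (2 * L) := by positivity
          linarith
  · have := h.measurable
    have := h.measurable_flux
    have := h.measurable_grad
    exact Measurable.aestronglyMeasurable (by fun_prop)
  · intro n
    have i1 := h'.integrable_comp_mul isRenorm_ent.measurable'' isRenorm_ent.continuousOn''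
      (integrable_finsetSum Finset.univ fun i _ => (h'.memLp_grad i).integrable_sq)
      (hχ n).continuous (hχc n)
    exact i1.congr (Eventually.of_forall fun p => by simp only [ent'']; ring)
  · refine tendsto_integral_of_dominated_convergence (fun z => |ent (f (t, z)) - ent (f₀ z)|)
      (fun n => ?_) (het.sub he₀).abs (fun n => Eventually.of_forall fun z => ?_)
      (Eventually.of_forall fun z => ?_)
    · exact (het.1.sub he₀.1).mul (hχ n).continuous.aestronglyMeasurable
    · rw [Real.norm_eq_abs, abs_mul, abs_of_nonneg (sq_nonneg (η n z))]
      exact mul_le_of_le_one_right (abs_nonneg _) (hχ1 n z)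
    · simpa using (hχt z).const_mul (ent (f (t, z)) - ent (f₀ z))

end IsSlabSol

section Dissipation

variable {N : ℕ}

/-- Exchange of the two velocities in `(x, v, w)`. -/
def swapVel (N : ℕ) : (En N × En N) × En N ≃ᵐ (En N × En N) × En N :=
  MeasurableEquiv.prodAssoc.trans
    (((MeasurableEquiv.refl _).prodCongr MeasurableEquiv.prodComm).trans
      MeasurableEquiv.prodAssoc.symm)

@[simp] lemma swapVel_apply (q : (En N × En N) × En N) :
    swapVel N q = ((q.1.1, q.2), q.1.2) := rfl

lemma measurePreserving_swapVel (N : ℕ) :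
    MeasurePreserving (swapVel N)
      ((volume : Measure (En N × En N)).prod volume)
      ((volume : Measure (En N × En N)).prod volume) := by
  have h1 := measurePreserving_prodAssoc (volume : Measure (En N)) (volume : Measure (En N))
    (volume : Measure (En N))
  have h2 : MeasurePreserving (MeasurableEquiv.prodComm : En N × En N ≃ᵐ En N × En N)
      (volume.prod volume) (volume.prod volume) := Measure.measurePreserving_swap
  exact (h1.symm _).comp (((MeasurePreserving.id volume).prod h2).comp h1)

lemma integrable_comp_sub_mul {k : En N → ℝ} (hkc : Continuous k) (hk : Integrable k)
    {Φ : En N × En N → ℝ} (hΦ : Integrable Φ) :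
    Integrable (fun q : (En N × En N) × En N => k (q.1.2 - q.2) * Φ q.1)
      ((volume : Measure (En N × En N)).prod volume) := by
  have hm : AEStronglyMeasurable (fun q : (En N × En N) × En N => k (q.1.2 - q.2) * Φ q.1)
      ((volume : Measure (En N × En N)).prod volume) :=
    (hkc.comp (by fun_prop)).aestronglyMeasurable.mul hΦ.1.comp_fst
  refine (integrable_prod_iff hm).2 ⟨Eventually.of_forall fun z => ?_, ?_⟩
  · exact (hk.comp_sub_left z.2).mul_const (Φ z)
  · have : ∀ z : En N × En N, ∫ w, ‖k (z.2 - w) * Φ z‖ = (∫ w, ‖k w‖) * ‖Φ z‖ := fun z => by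
      simp only [norm_mul]
      rw [integral_mul_const, integral_sub_left_eq_self (fun w => ‖k w‖)]
    simp only [this]
    exact hΦ.norm.const_mul _

/-- The symmetrized dissipation equals twice the drift-diffusion form. -/
lemma integral_dissipation_eq (a : Fin N → Fin N → SchwartzMap (En N) ℝ)
    (heven : ∀ i j (z : En N), a i j (-z) = a i j z) {u : En N × En N → ℝ}
    {g : Fin N → En N × En N → ℝ} (hu : Measurable u) (hg : ∀ i, Measurable (g i))
    (hI : ∀ᵐ z, u z ∈ Ioo (0 : ℝ) 1)
    (hD : Integrable fun z => (∑ i, g i z ^ 2) / (u z * (1 - u z)))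
    (hg2 : ∀ i, Integrable fun z => g i z ^ 2) :
    ∫ z : En N × En N, ∫ w : En N,
        (∑ i, ∑ j, a i j (z.2 - w)
          * (g i (z.1, z.2) / (u (z.1, z.2) * (1 - u (z.1, z.2)))
              - g i (z.1, w) / (u (z.1, w) * (1 - u (z.1, w))))
          * (g j (z.1, z.2) / (u (z.1, z.2) * (1 - u (z.1, z.2)))
              - g j (z.1, w) / (u (z.1, w) * (1 - u (z.1, w)))))
        * (u (z.1, z.2) * (1 - u (z.1, z.2))) * (u (z.1, w) * (1 - u (z.1, w)))
      = 2 * ∫ z : En N × En N,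
        ((∑ i, ∑ j, (∫ w, a i j (z.2 - w) * (u (z.1, w) * (1 - u (z.1, w)))) * g i z * g j z)
            / (u z * (1 - u z))
          - ∑ i, (∑ j, ∫ w, a i j (z.2 - w) * g j (z.1, w)) * g i z) := by
  set μ := (volume : Measure (En N × En N)).prod (volume : Measure (En N)) with hμ
  set H : En N × En N → ℝ := fun z => u z * (1 - u z) with hH
  set P : Fin N → En N × En N → ℝ := fun i z => g i z / H z with hP
  have hHm : Measurable H := by fun_prop
  have hPm : ∀ i, Measurable (P i) := fun i => (hg i).div hHm
  have hH1 : ∀ᵐ z, 0 < H z ∧ H z ≤ 1 := by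
    filter_upwards [hI] with z hz
    exact ⟨mul_pos hz.1 (sub_pos.2 hz.2), by
      simp only [hH]; nlinarith [hz.1, hz.2]⟩
  have hPH : ∀ᵐ z, ∀ i, P i z * H z = g i z := by
    filter_upwards [hH1] with z hz i
    exact div_mul_cancel₀ _ hz.1.ne'
  have hfst : ∀ {p : En N × En N → Prop}, (∀ᵐ z, p z) → ∀ᵐ q ∂μ, p q.1 := fun h =>
    Measure.quasiMeasurePreserving_fst.ae h
  have hσ := measurePreserving_swapVel N
  have hsnd : ∀ {p : En N × En N → Prop}, (∀ᵐ z, p z) → ∀ᵐ q ∂μ, p (q.1.1, q.2) := fun h =>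
    hσ.quasiMeasurePreserving.ae (hfst h)
  have hk : ∀ i j, Integrable (fun z => |a i j z|) := fun i j => (a i j).integrable.abs
  have hkc : ∀ i j, Continuous fun z => |a i j z| := fun i j => (a i j).continuous.abs
  have am : ∀ i j, Measurable fun q : (En N × En N) × En N => a i j (q.1.2 - q.2) := fun i j =>
    ((a i j).continuous.comp (by fun_prop)).measurable
  have ms : Measurable fun q : (En N × En N) × En N => (q.1.1, q.2) := by fun_prop
  have i1 : ∀ i j, Integrable (fun q : (En N × En N) × En N =>
      (P i q.1 * P j q.1 * H q.1) * (a i j (q.1.2 - q.2) * H (q.1.1, q.2))) μ := fun i j => by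
    refine Integrable.mono' (integrable_comp_sub_mul (hkc i j) (hk i j) hD) ?_ ?_
    · exact (((((hPm i).comp measurable_fst).mul ((hPm j).comp measurable_fst)).mul
        (hHm.comp measurable_fst)).mul ((am i j).mul (hHm.comp ms))).aestronglyMeasurable
    · filter_upwards [hfst hH1, hsnd hH1] with q h1 h2
      have e1 : |P i q.1 * P j q.1 * H q.1| ≤ (∑ i, g i q.1 ^ 2) / H q.1 := by
        have : P i q.1 * P j q.1 * H q.1 = g i q.1 * g j q.1 / H q.1 := by
          simp only [hP]; field_simp [h1.1.ne']
        rw [this, abs_div, abs_of_pos h1.1, abs_mul]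
        refine div_le_div_of_nonneg_right ?_ h1.1.le
        have s1 : g i q.1 ^ 2 ≤ ∑ i, g i q.1 ^ 2 := Finset.single_le_sum
          (f := fun i => g i q.1 ^ 2) (fun i _ => sq_nonneg _) (Finset.mem_univ i)
        have s2 : g j q.1 ^ 2 ≤ ∑ i, g i q.1 ^ 2 := Finset.single_le_sum
          (f := fun i => g i q.1 ^ 2) (fun i _ => sq_nonneg _) (Finset.mem_univ j)
        rw [← sq_abs] at s1 s2
        nlinarith [sq_nonneg (|g i q.1| - |g j q.1|)]
      rw [Real.norm_eq_abs, abs_mul, abs_mul (a i j _), abs_of_pos h2.1]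
      calc _ ≤ (∑ i, g i q.1 ^ 2) / H q.1 * (|a i j (q.1.2 - q.2)| * 1) :=
            mul_le_mul e1 (mul_le_mul_of_nonneg_left h2.2 (abs_nonneg _))
              (mul_nonneg (abs_nonneg _) h2.1.le) ((abs_nonneg _).trans e1)
        _ = _ := by rw [mul_one, mul_comm]
  have i2 : ∀ i j, Integrable (fun q : (En N × En N) × En N =>
      (P i q.1 * H q.1) * (a i j (q.1.2 - q.2) * (P j (q.1.1, q.2) * H (q.1.1, q.2)))) μ :=
    fun i j => by
      have b1 := integrable_comp_sub_mul (hkc i j) (hk i j) (hg2 i)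
      have b2 := hσ.integrable_comp_of_integrable
        (integrable_comp_sub_mul (hkc i j) (hk i j) (hg2 j))
      refine Integrable.mono' (b1.add b2) ?_ ?_
      · exact ((((hPm i).comp measurable_fst).mul (hHm.comp measurable_fst)).mul
          ((am i j).mul (((hPm j).comp ms).mul (hHm.comp ms)))).aestronglyMeasurable
      · filter_upwards [hfst hPH, hsnd hPH] with q h1 h2
        rw [h1, h2]
        simp only [Pi.add_apply, Function.comp, swapVel_apply]
        rw [Real.norm_eq_abs, abs_mul, abs_mul, ← neg_sub q.1.2 q.2, heven, ← mul_add]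
        have := two_mul_le_add_sq |g i q.1| |g j (q.1.1, q.2)|
        rw [sq_abs, sq_abs] at this
        have h3 : 0 ≤ |g i q.1| * |g j (q.1.1, q.2)| := by positivity
        calc _ = |a i j (q.1.2 - q.2)| * (|g i q.1| * |g j (q.1.1, q.2)|) := by ring
          _ ≤ _ := mul_le_mul_of_nonneg_left (by linarith) (abs_nonneg _)
  set S : (En N × En N) × En N → ℝ := fun q => ∑ i, ∑ j,
    ((P i q.1 * P j q.1 * H q.1) * (a i j (q.1.2 - q.2) * H (q.1.1, q.2))
      - (P i q.1 * H q.1) * (a i j (q.1.2 - q.2) * (P j (q.1.1, q.2) * H (q.1.1, q.2)))) with hS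
  have iS : Integrable S μ := integrable_finsetSum _ fun i _ => integrable_finsetSum _ fun j _ =>
    (i1 i j).sub (i2 i j)
  have iS' : Integrable (fun q => S (swapVel N q)) μ := hσ.integrable_comp_of_integrable iS
  have hdec : ∀ (z : En N × En N) (w : En N),
      (∑ i, ∑ j, a i j (z.2 - w) * (P i (z.1, z.2) - P i (z.1, w))
        * (P j (z.1, z.2) - P j (z.1, w))) * H (z.1, z.2) * H (z.1, w)
      = S (z, w) + S (swapVel N (z, w)) := fun z w => by
    simp only [hS, swapVel_apply, ← Finset.sum_add_distrib, Finset.sum_mul]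
    refine Finset.sum_congr rfl fun i _ => Finset.sum_congr rfl fun j _ => ?_
    rw [← neg_sub z.2 w, heven]
    ring
  have hL : ∫ z : En N × En N, ∫ w : En N,
      (∑ i, ∑ j, a i j (z.2 - w) * (P i (z.1, z.2) - P i (z.1, w))
        * (P j (z.1, z.2) - P j (z.1, w))) * H (z.1, z.2) * H (z.1, w)
      = 2 * ∫ z : En N × En N, ∫ w : En N, S (z, w) := by
    simp only [hdec]
    have e := integral_prod _ (iS.add iS')
    simp only [Pi.add_apply] at e
    rw [← e, ← integral_prod _ iS, integral_add iS iS', hσ.integral_comp' S, two_mul]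
  refine hL.trans ?_
  congr 1
  refine integral_congr_ae ?_
  have j1 : ∀ᵐ z : En N × En N, ∀ i j, Integrable (fun w : En N =>
      (P i z * P j z * H z) * (a i j (z.2 - w) * H (z.1, w))) :=
    ae_all_iff.2 fun i => ae_all_iff.2 fun j => (i1 i j).prod_right_ae
  have j2 : ∀ᵐ z : En N × En N, ∀ i j, Integrable (fun w : En N =>
      (P i z * H z) * (a i j (z.2 - w) * (P j (z.1, w) * H (z.1, w)))) :=
    ae_all_iff.2 fun i => ae_all_iff.2 fun j => (i2 i j).prod_right_ae
  have j3 := Measure.ae_ae_of_ae_prod (hsnd hPH)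
  filter_upwards [j1, j2, j3, hPH, hH1] with z e1 e2 e3 e4 e5
  simp only [hS]
  have e12 : ∀ i j, Integrable (fun w : En N =>
      (P i z * P j z * H z) * (a i j (z.2 - w) * H (z.1, w))
        - (P i z * H z) * (a i j (z.2 - w) * (P j (z.1, w) * H (z.1, w)))) := fun i j =>
    (e1 i j).sub (e2 i j)
  rw [integral_finsetSum _ fun i _ => integrable_finsetSum _ fun j _ => e12 i j,
    Finset.sum_div, ← Finset.sum_sub_distrib]
  refine Finset.sum_congr rfl fun i _ => ?_
  rw [integral_finsetSum _ fun j _ => e12 i j, Finset.sum_div, Finset.sum_mul,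
    ← Finset.sum_sub_distrib]
  refine Finset.sum_congr rfl fun j _ => ?_
  rw [integral_sub (e1 i j) (e2 i j), integral_const_mul, integral_const_mul, e4]
  have e6 : ∫ w, a i j (z.2 - w) * (P j (z.1, w) * H (z.1, w))
      = ∫ w, a i j (z.2 - w) * g j (z.1, w) := by
    refine integral_congr_ae ?_
    filter_upwards [e3] with w hw
    rw [hw j]
  rw [e6]
  have e7 : P i z * P j z * H z = g i z * g j z / H z := by
    have := e5.1.ne'
    simp only [hP]; field_simp
  rw [e7]
  ring

end Dissipation

section FiberGradient

variable {N : ℕ} {T : ℝ}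

/-- Lebesgue measure on `(0,T) × ℝ^N`. -/
abbrev timeSpace (N : ℕ) (T : ℝ) : Measure (ℝ × En N) := (volume.restrict (Ioo 0 T)).prod volume

lemma timeSpace_eq (N : ℕ) (T : ℝ) :
    timeSpace N T = (volume : Measure (ℝ × En N)).restrict (Ioo 0 T ×ˢ univ) := by
  rw [Measure.volume_eq_prod, timeSpace, ← Measure.prod_restrict, Measure.restrict_univ]

lemma measurePreserving_assoc_slab (N : ℕ) (T : ℝ) :
    MeasurePreserving (MeasurableEquiv.prodAssoc : (ℝ × En N) × En N ≃ᵐ ℝ × En N × En N)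
      ((timeSpace N T).prod volume) (slab N T) :=
  measurePreserving_prodAssoc (volume.restrict (Ioo 0 T)) volume volume

lemma integral_mul_comp_fst {Ω E : Type*} [MeasureSpace Ω] [MeasureSpace E] [TopologicalSpace Ω]
    [OpensMeasurableSpace Ω] [SFinite (volume : Measure Ω)] [SFinite (volume : Measure E)]
    {K : Set Ω} {V : Ω × E → ℝ}
    (hV : Integrable V ((volume.restrict K).prod (volume : Measure E))) {θ : Ω → ℝ}
    (hθ : Continuous θ) (hc : HasCompactSupport θ) (hs : tsupport θ ⊆ K) :
    Integrable (fun q : Ω × E => V q * θ q.1) ∧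
      ∫ q, V q * θ q.1 = ∫ y, θ y * ∫ w, V (y, w) := by
  have z0 : ∀ x, x ∉ K → θ x = 0 := fun x hx =>
    image_eq_zero_of_notMem_tsupport fun h => hx (hs h)
  obtain ⟨c, hc⟩ := hc.exists_bound_of_continuous hθ
  have hi : Integrable (fun q : Ω × E => V q * θ q.1)
      ((volume.restrict K).prod (volume : Measure E)) :=
    hV.mul_bdd (c := c) (hθ.measurable.comp measurable_fst).aestronglyMeasurable
      (Eventually.of_forall fun p => hc p.1)
  have e2 : (volume.restrict K).prod (volume : Measure E)
      = (volume : Measure (Ω × E)).restrict (K ×ˢ univ) := by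
    rw [Measure.volume_eq_prod, ← Measure.prod_restrict, Measure.restrict_univ]
  have hi' : Integrable (fun q : Ω × E => V q * θ q.1) := by
    rw [e2] at hi
    refine (integrableOn_iff_integrable_of_support_subset fun p hp => ?_).1 hi
    exact ⟨by_contra fun hn => hp (by simp [z0 p.1 hn]), trivial⟩
  refine ⟨hi', ?_⟩
  rw [Measure.volume_eq_prod, integral_prod _ hi']
  simp only [integral_mul_const, mul_comm (θ _)]

lemma isTest_mul_fiber {θ : ℝ × En N → ℝ} {ψ : En N → ℝ} (hθ : ContDiff ℝ (⊤ : ℕ∞) θ)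
    (hθc : HasCompactSupport θ) (hθs : tsupport θ ⊆ Ioi 0 ×ˢ univ) (hψ : ContDiff ℝ (⊤ : ℕ∞) ψ)
    (hψc : HasCompactSupport ψ) :
    IsTest fun p : ℝ × En N × En N => θ (p.1, p.2.1) * ψ p.2.2 := by
  have hs : Function.support (fun p : ℝ × En N × En N => θ (p.1, p.2.1) * ψ p.2.2)
      ⊆ MeasurableEquiv.prodAssoc '' (tsupport θ ×ˢ tsupport ψ) := fun p hp => by
    have := mul_ne_zero_iff.1 hp
    exact ⟨((p.1, p.2.1), p.2.2), ⟨subset_tsupport _ this.1, subset_tsupport _ this.2⟩, rfl⟩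
  have hK : IsCompact (MeasurableEquiv.prodAssoc '' (tsupport θ ×ˢ tsupport ψ) :
      Set (ℝ × En N × En N)) :=
    (hθc.isCompact.prod hψc.isCompact).image (Homeomorph.prodAssoc ℝ (En N) (En N)).continuous
  refine ⟨(hθ.comp (by fun_prop)).mul (hψ.comp (by fun_prop)),
    HasCompactSupport.of_support_subset_isCompact hK hs, fun p hp => ?_⟩
  obtain ⟨q, hq, rfl⟩ := closure_minimal hs hK.isClosed hp
  exact (hθs hq.1).1

lemma pV_mul_fiber {θ : ℝ × En N → ℝ} {ψ : En N → ℝ} (hθ : ContDiff ℝ (⊤ : ℕ∞) θ)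
    (hψ : ContDiff ℝ (⊤ : ℕ∞) ψ) (i : Fin N) (p : ℝ × En N × En N) :
    pV i (fun p : ℝ × En N × En N => θ (p.1, p.2.1) * ψ p.2.2) p
      = θ (p.1, p.2.1) * fderiv ℝ ψ p.2.2 (EuclideanSpace.single i 1) := by
  have d₀ : HasFDerivAt (fun z : ℝ × En N × En N => (z.1, z.2.1))
      ((ContinuousLinearMap.fst ℝ ℝ (En N × En N)).prod
        ((ContinuousLinearMap.fst ℝ (En N) (En N)).comp
          (ContinuousLinearMap.snd ℝ ℝ (En N × En N)))) p :=
    hasFDerivAt_fst.prodMk (hasFDerivAt_fst.comp p hasFDerivAt_snd)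
  have d₁ : HasFDerivAt (fun z : ℝ × En N × En N => θ (z.1, z.2.1)) _ p :=
    HasFDerivAt.comp p ((hθ.differentiable (by simp)) (p.1, p.2.1)).hasFDerivAt d₀
  have d₃ : HasFDerivAt (fun z : ℝ × En N × En N => z.2.2)
      ((ContinuousLinearMap.snd ℝ (En N) (En N)).comp
          (ContinuousLinearMap.snd ℝ ℝ (En N × En N))) p :=
    hasFDerivAt_snd.comp p hasFDerivAt_snd
  have d₂ : HasFDerivAt (fun z : ℝ × En N × En N => ψ z.2.2) _ p :=
    HasFDerivAt.comp p ((hψ.differentiable (by simp)) p.2.2).hasFDerivAt d₃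
  have d := (d₁.mul d₂).fderiv
  change fderiv ℝ (fun p : ℝ × En N × En N => θ (p.1, p.2.1) * ψ p.2.2) p = _ at d
  have h0 : fderiv ℝ θ (p.1, p.2.1) ((0 : ℝ), (0 : En N)) = 0 := map_zero _
  rw [pV, d]
  simp [h0]

/-- Weak `v`-differentiability on almost every fibre, against a fixed test function. -/
lemma ae_fiber_weak_grad {f g : ℝ × En N × En N → ℝ} (hf : MemLp f 2 (slab N T))
    (hg : MemLp g 2 (slab N T)) {i : Fin N}
    (hw : ∀ φ : ℝ × En N × En N → ℝ, IsTest φ → ∫ p, f p * pV i φ p = -∫ p, g p * φ p)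
    {ψ : En N → ℝ} (hψ : ContDiff ℝ (⊤ : ℕ∞) ψ) (hψc : HasCompactSupport ψ) :
    ∀ᵐ y ∂timeSpace N T, ∫ w, (f (y.1, y.2, w) * fderiv ℝ ψ w (EuclideanSpace.single i 1)
      + g (y.1, y.2, w) * ψ w) = 0 := by
  set dψ : En N → ℝ := fun w => fderiv ℝ ψ w (EuclideanSpace.single i 1) with hdψ
  have hdc : Continuous dψ := by
    have := hψ.continuous_fderiv (by simp)
    fun_prop
  have hds : HasCompactSupport dψ := hψc.fderiv_apply ℝ _
  set U : Set (ℝ × En N) := Ioo 0 T ×ˢ univ with hU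
  have hUo : IsOpen U := isOpen_Ioo.prod isOpen_univ
  set V : (ℝ × En N) × En N → ℝ := fun q =>
    f (q.1.1, q.1.2, q.2) * dψ q.2 + g (q.1.1, q.1.2, q.2) * ψ q.2 with hV
  have hm := measurePreserving_assoc_slab N T
  have hVi : ∀ K ⊆ U, IsCompact K → Integrable V ((volume.restrict K).prod volume) := by
    intro K hK hKc
    have hle : (volume.restrict K).prod (volume : Measure (En N))
        ≤ (timeSpace N T).prod volume := by
      rw [timeSpace_eq]
      exact Measure.prod_mono (Measure.restrict_mono hK le_rfl) le_rfl
    have : IsFiniteMeasure ((volume : Measure (ℝ × En N)).restrict K) :=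
      ⟨by simpa using hKc.measure_lt_top⟩
    have hf' := (hf.comp_measurePreserving hm).mono_measure hle
    have hg' := (hg.comp_measurePreserving hm).mono_measure hle
    exact (integrable_mul_comp_snd hf' (memLp_two_of_hasCompactSupport hdc hds)).add
      (integrable_mul_comp_snd hg' (memLp_two_of_hasCompactSupport hψ.continuous hψc))
  have hl : LocallyIntegrableOn (fun y => ∫ w, V (y, w)) U := by
    rw [locallyIntegrableOn_iff hUo.isLocallyClosed]
    exact fun K hK hKc => (hVi K hK hKc).integral_prod_left
  rw [timeSpace_eq, ae_restrict_iff' hUo.measurableSet]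
  refine hUo.ae_eq_zero_of_integral_contDiff_smul_eq_zero hl fun θ hθ hθc hθs => ?_
  obtain ⟨-, e1⟩ := integral_mul_comp_fst (hVi _ hθs hθc.isCompact) hθ.continuous hθc subset_rfl
  simp only [smul_eq_mul]
  rw [← e1]
  have hv : MeasurePreserving (MeasurableEquiv.prodAssoc : (ℝ × En N) × En N ≃ᵐ ℝ × En N × En N) :=
    measurePreserving_prodAssoc volume volume volume
  have hwθ := hw _ (isTest_mul_fiber hθ hθc (hθs.trans (prod_mono_left Ioo_subset_Ioi_self)) hψ hψc)
  simp only [pV_mul_fiber hθ hψ] at hwθ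
  have : IsFiniteMeasure ((volume : Measure (ℝ × En N)).restrict (tsupport θ)) :=
    ⟨by simpa using hθc.isCompact.measure_lt_top⟩
  have hle : (volume.restrict (tsupport θ)).prod (volume : Measure (En N))
      ≤ (timeSpace N T).prod volume := by
    rw [timeSpace_eq]
    exact Measure.prod_mono (Measure.restrict_mono hθs le_rfl) le_rfl
  have i1 : Integrable (fun q : (ℝ × En N) × En N => f (q.1.1, q.1.2, q.2) * dψ q.2 * θ q.1) :=
    (integral_mul_comp_fst (integrable_mul_comp_snd
    ((hf.comp_measurePreserving hm).mono_measure hle) (memLp_two_of_hasCompactSupport hdc hds))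
    hθ.continuous hθc subset_rfl).1
  have i2 : Integrable (fun q : (ℝ × En N) × En N => g (q.1.1, q.1.2, q.2) * ψ q.2 * θ q.1) :=
    (integral_mul_comp_fst (integrable_mul_comp_snd
    ((hg.comp_measurePreserving hm).mono_measure hle)
    (memLp_two_of_hasCompactSupport hψ.continuous hψc)) hθ.continuous hθc subset_rfl).1
  rw [← hv.integral_comp', ← hv.integral_comp'] at hwθ
  simp only [hV, add_mul]
  rw [integral_add i1 i2]
  have e3 : ∀ q : (ℝ × En N) × En N, f (q.1.1, q.1.2, q.2) * dψ q.2 * θ q.1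
      = f (MeasurableEquiv.prodAssoc q) * (θ ((MeasurableEquiv.prodAssoc q).1,
        (MeasurableEquiv.prodAssoc q).2.1) * fderiv ℝ ψ (MeasurableEquiv.prodAssoc q).2.2
          (EuclideanSpace.single i 1)) := fun q => by
    simp only [MeasurableEquiv.prodAssoc, MeasurableEquiv.coe_mk, Equiv.prodAssoc_apply, hdψ]
    ring
  have e4 : ∀ q : (ℝ × En N) × En N, g (q.1.1, q.1.2, q.2) * ψ q.2 * θ q.1
      = g (MeasurableEquiv.prodAssoc q) * (θ ((MeasurableEquiv.prodAssoc q).1,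
        (MeasurableEquiv.prodAssoc q).2.1) * ψ (MeasurableEquiv.prodAssoc q).2.2) := fun q => by
    simp only [MeasurableEquiv.prodAssoc, MeasurableEquiv.coe_mk, Equiv.prodAssoc_apply]
    ring
  rw [integral_congr_ae (Eventually.of_forall e3), integral_congr_ae (Eventually.of_forall e4),
    hwθ, neg_add_cancel]

/-- Weak `v`-differentiability on almost every fibre, against a square integrable function. -/
lemma ae_fiber_weak_grad_of_memLp {f g : ℝ × En N × En N → ℝ} (hfm : Measurable f)
    (hgm : Measurable g) (hf : MemLp f 2 (slab N T))
    (hg : MemLp g 2 (slab N T)) {i : Fin N}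
    (hw : ∀ φ : ℝ × En N × En N → ℝ, IsTest φ → ∫ p, f p * pV i φ p = -∫ p, g p * φ p)
    {k : En N → ℝ} (hk : ContDiff ℝ (⊤ : ℕ∞) k) (hkL : MemLp k 2)
    (hdkL : MemLp (fun w => fderiv ℝ k w (EuclideanSpace.single i 1)) 2) :
    ∀ᵐ y ∂timeSpace N T,
      ∫ w, f (y.1, y.2, w) * fderiv ℝ k w (EuclideanSpace.single i 1)
        = -∫ w, g (y.1, y.2, w) * k w := by
  obtain ⟨η, L, hL, hη, hηc, hη0, hη1, -, hηd, hηt⟩ := exists_cutoff N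
  have hχ : ∀ n, ContDiff ℝ (⊤ : ℕ∞) fun w : En N => η n (0, w) := fun n =>
    (hη n).comp (by fun_prop)
  have hχc : ∀ n, HasCompactSupport fun w : En N => η n (0, w) := fun n => by
    refine HasCompactSupport.of_support_subset_isCompact
      (((hηc n).isCompact.image continuous_snd)) fun w hw => ?_
    exact ⟨(0, w), subset_tsupport _ hw, rfl⟩
  have hd : ∀ n w, fderiv ℝ (fun w : En N => η n (0, w)) w (EuclideanSpace.single i 1)
      = dV i (η n) (0, w) := fun n w => by
    have h1 : HasFDerivAt (fun w : En N => ((0 : En N), w))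
        ((0 : En N →L[ℝ] En N).prod (ContinuousLinearMap.id ℝ (En N))) w :=
      (hasFDerivAt_const _ _).prodMk (hasFDerivAt_id w)
    have h2 : HasFDerivAt (fun w : En N => η n (0, w)) _ w :=
      HasFDerivAt.comp w (((hη n).differentiable (by simp)) (0, w)).hasFDerivAt h1
    rw [h2.fderiv]
    simp [dV]
  set dk : En N → ℝ := fun w => fderiv ℝ k w (EuclideanSpace.single i 1) with hdk
  have hdψ : ∀ n w, fderiv ℝ (fun w => k w * η n (0, w)) w (EuclideanSpace.single i 1)
      = dk w * η n (0, w) + k w * dV i (η n) (0, w) := fun n w => by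
    have h1 : HasFDerivAt k _ w := (hk.differentiable (by simp) w).hasFDerivAt
    have h2 : HasFDerivAt (fun w : En N => η n (0, w)) _ w :=
      ((hχ n).differentiable (by simp) w).hasFDerivAt
    have h := (h1.mul h2).fderiv
    change fderiv ℝ (fun w => k w * η n (0, w)) w = _ at h
    rw [h, ← hd]
    simp only [_root_.add_apply, _root_.smul_apply, smul_eq_mul, hdk]
    ring
  have hall := ae_all_iff.2 fun n => ae_fiber_weak_grad hf hg hw (hk.mul (hχ n)) ((hχc n).mul_left)
  have hm := measurePreserving_assoc_slab N T
  have hm' : Measurable (MeasurableEquiv.prodAssoc : (ℝ × En N) × En N ≃ᵐ ℝ × En N × En N) :=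
    MeasurableEquiv.measurable _
  have sf := ae_memLp_section (hfm.comp hm') (hf.comp_measurePreserving hm)
  have sg := ae_memLp_section (hgm.comp hm') (hg.comp_measurePreserving hm)
  filter_upwards [hall, sf, sg] with y hy sfy sgy
  have sfy' : MemLp (fun w => f (y.1, y.2, w)) 2 volume := sfy
  have sgy' : MemLp (fun w => g (y.1, y.2, w)) 2 volume := sgy
  have i1 := memLp_two_integrable_mul sfy' hdkL
  have i2 := memLp_two_integrable_mul sgy' hkL
  have i3 := memLp_two_integrable_mul sfy' hkL
  have lim : Tendsto (fun n => ∫ w, (f (y.1, y.2, w)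
      * (dk w * η n (0, w) + k w * dV i (η n) (0, w)) + g (y.1, y.2, w) * (k w * η n (0, w))))
      atTop (nhds (∫ w, (f (y.1, y.2, w) * dk w + g (y.1, y.2, w) * k w))) := by
    refine tendsto_integral_of_dominated_convergence (fun w => |f (y.1, y.2, w) * dk w|
      + L * |f (y.1, y.2, w) * k w| + |g (y.1, y.2, w) * k w|) (fun n => ?_)
      ((i1.abs.add (i3.abs.const_mul L)).add i2.abs) (fun n => ?_) ?_
    · have c1 : Continuous fun w : En N => η n (0, w) := (hχ n).continuous
      have c2 : Continuous fun w : En N => dV i (η n) (0, w) :=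
        (continuous_dV (hη n) i).comp (by fun_prop)
      have e : (fun w => f (y.1, y.2, w)
          * (dk w * η n (0, w) + k w * dV i (η n) (0, w)) + g (y.1, y.2, w) * (k w * η n (0, w)))
          = fun w => f (y.1, y.2, w) * dk w * η n (0, w)
            + f (y.1, y.2, w) * k w * dV i (η n) (0, w)
            + g (y.1, y.2, w) * k w * η n (0, w) := by
        funext w; ring
      rw [e]
      exact ((i1.1.mul c1.aestronglyMeasurable).add (i3.1.mul c2.aestronglyMeasurable)).add
        (i2.1.mul c1.aestronglyMeasurable)
    · refine Eventually.of_forall fun w => ?_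
      have h0 := hη0 n (0, w)
      have h1 := hη1 n (0, w)
      have h2 := hηd n i (0, w)
      have h3 : L / (n + 1) ≤ L := div_le_self hL (by linarith [n.cast_nonneg (α := ℝ)])
      have habs : |η n (0, w)| ≤ 1 := abs_le.2 ⟨by linarith [show (0:ℝ) ≤ η n (0, w) from h0], h1⟩
      rw [Real.norm_eq_abs, show f (y.1, y.2, w)
          * (dk w * η n (0, w) + k w * dV i (η n) (0, w)) + g (y.1, y.2, w) * (k w * η n (0, w))
          = f (y.1, y.2, w) * dk w * η n (0, w)
            + f (y.1, y.2, w) * k w * dV i (η n) (0, w)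
            + g (y.1, y.2, w) * k w * η n (0, w) by ring]
      refine (abs_add_le _ _).trans (add_le_add ((abs_add_le _ _).trans (add_le_add ?_ ?_)) ?_)
      · rw [abs_mul]
        exact mul_le_of_le_one_right (abs_nonneg _) habs
      · rw [abs_mul, mul_comm]
        exact mul_le_mul_of_nonneg_right (h2.trans h3) (abs_nonneg _)
      · rw [abs_mul]
        exact mul_le_of_le_one_right (abs_nonneg _) habs
    · refine Eventually.of_forall fun w => ?_
      have t1 := hηt (0, w)
      have t2 : Tendsto (fun n => dV i (η n) (0, w)) atTop (nhds 0) := by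
        refine squeeze_zero_norm (fun n => hηd n i (0, w)) ?_
        simpa [div_eq_mul_inv] using (tendsto_one_div_add_atTop_nhds_zero_nat (𝕜 := ℝ)).const_mul L
      have := (((t1.const_mul (dk w)).add (t2.const_mul (k w))).const_mul
        (f (y.1, y.2, w))).add ((t1.const_mul (k w)).const_mul (g (y.1, y.2, w)))
      simpa using this
  have z : ∀ n, ∫ w, (f (y.1, y.2, w)
      * (dk w * η n (0, w) + k w * dV i (η n) (0, w)) + g (y.1, y.2, w) * (k w * η n (0, w)))
      = 0 := fun n => by
    rw [← hy n]
    simp only [← hdψ]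
  simp only [z] at lim
  have hlim := tendsto_nhds_unique tendsto_const_nhds lim
  rw [integral_add i1 i2] at hlim
  linarith

end FiberGradient

section Coefficients

variable {N : ℕ} {T : ℝ}

lemma continuous_dSch (a : Fin N → Fin N → SchwartzMap (En N) ℝ) (i j : Fin N) :
    Continuous (dSch a i j) := by
  have := ((a i j).smooth (⊤ : ℕ∞)).continuous_fderiv (by simp)
  unfold dSch; fun_prop

/-- `∂_{z_j} a_{ij}` as a Schwartz function. -/
lemma exists_schwartz_eq_dSch (a : Fin N → Fin N → SchwartzMap (En N) ℝ) (i j : Fin N) :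
    ∃ S : SchwartzMap (En N) ℝ, ⇑S = dSch a i j :=
  ⟨LineDeriv.lineDerivOp (EuclideanSpace.single j (1 : ℝ)) (a i j), by
    funext z
    rw [SchwartzMap.lineDerivOp_apply_eq_fderiv]
    rfl⟩

lemma memLp_two_comp_sub_left (S : SchwartzMap (En N) ℝ) (v : En N) :
    MemLp (fun w => S (v - w)) 2 :=
  (S.memLp 2).comp_measurePreserving (Measure.measurePreserving_sub_left volume v)

lemma fderiv_comp_sub_left (a : Fin N → Fin N → SchwartzMap (En N) ℝ) (i j : Fin N) (v w : En N) :
    fderiv ℝ (fun w => a i j (v - w)) w (EuclideanSpace.single j 1) = -dSch a i j (v - w) := by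
  have h : HasFDerivAt (fun w => a i j (v - w)) _ w :=
    HasFDerivAt.comp w ((a i j).differentiableAt (x := v - w)).hasFDerivAt
      ((hasFDerivAt_id w).const_sub v)
  rw [h.fderiv]
  simp [dSch]

variable {f : ℝ × En N × En N → ℝ} {Df : Fin N → ℝ × En N × En N → ℝ}

lemma measurable_integral_fiber {k : En N → ℝ} (hk : Measurable k)
    {u : ℝ × En N × En N → ℝ} (hu : Measurable u) :
    Measurable fun p : ℝ × En N × En N => ∫ w, k (p.2.2 - w) * u (p.1, p.2.1, w) := by
  have h := measurable_integral_comp_mul (k := fun q : En N × En N => k (q.1 - q.2))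
    (by fun_prop) (hu.comp (MeasurableEquiv.prodAssoc :
      (ℝ × En N) × En N ≃ᵐ ℝ × En N × En N).measurable)
  have h2 := h.comp (MeasurableEquiv.prodAssoc :
      (ℝ × En N) × En N ≃ᵐ ℝ × En N × En N).symm.measurable
  have e : (fun p : ℝ × En N × En N => ∫ w, k (p.2.2 - w) * u (p.1, p.2.1, w))
      = fun p => ∫ w, u (p.1, p.2.1, w) * k (p.2.2 - w) := by
    funext p
    exact integral_congr_ae (Eventually.of_forall fun w => mul_comm _ _)
  rw [e]
  exact h2

lemma measurable_bbarS (a : Fin N → Fin N → SchwartzMap (En N) ℝ) (hfm : Measurable f)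
    (i : Fin N) : Measurable (bbarS a f i) :=
  measurable_integral_fiber (k := fun z => ∑ j, dSch a i j z)
    (continuous_finsetSum _ fun j _ => continuous_dSch a i j).measurable hfm

/-- Integration by parts under the velocity convolution. -/
lemma ae_sum_integral_grad_eq_bbarS (a : Fin N → Fin N → SchwartzMap (En N) ℝ) (hfm : Measurable f)
    (hgm : ∀ j, Measurable (Df j)) (hf : MemLp f 2 (slab N T))
    (hg : ∀ j, MemLp (Df j) 2 (slab N T))
    (hw : ∀ (i : Fin N) (φ : ℝ × En N × En N → ℝ), IsTest φ →
      ∫ p, f p * pV i φ p = -∫ p, Df i p * φ p) :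
    ∀ᵐ p ∂slab N T, ∀ i, ∑ j, ∫ w, a i j (p.2.2 - w) * Df j (p.1, p.2.1, w) = bbarS a f i p := by
  have hm := measurePreserving_assoc_slab N T
  have hm' : Measurable (MeasurableEquiv.prodAssoc : (ℝ × En N) × En N ≃ᵐ ℝ × En N × En N) :=
    MeasurableEquiv.measurable _
  have sf := ae_memLp_section (hfm.comp hm') (hf.comp_measurePreserving hm)
  rw [ae_all_iff]
  intro i
  have key : ∀ v : En N, ∀ᵐ y ∂timeSpace N T,
      ∑ j, ∫ w, a i j (v - w) * Df j (y.1, y.2, w) = bbarS a f i (y.1, y.2, v) := by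
    intro v
    have h1 : ∀ᵐ y ∂timeSpace N T, ∀ j,
        ∫ w, f (y.1, y.2, w) * dSch a i j (v - w) = ∫ w, Df j (y.1, y.2, w) * a i j (v - w) := by
      refine ae_all_iff.2 fun j => ?_
      obtain ⟨S, hS⟩ := exists_schwartz_eq_dSch a i j
      have hd : MemLp (fun w => fderiv ℝ (fun w => a i j (v - w)) w
          (EuclideanSpace.single j 1)) 2 volume := by
        simp only [fderiv_comp_sub_left, ← hS]
        exact (memLp_two_comp_sub_left S v).neg
      have := ae_fiber_weak_grad_of_memLp hfm (hgm j) hf (hg j) (hw j)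
        (k := fun w => a i j (v - w)) (((a i j).smooth _).comp (by fun_prop))
        (memLp_two_comp_sub_left (a i j) v) hd
      filter_upwards [this] with y hy
      simpa only [fderiv_comp_sub_left, mul_neg, integral_neg, neg_inj] using hy
    filter_upwards [h1, sf] with y hy hs
    have hs' : MemLp (fun w => f (y.1, y.2, w)) 2 volume := hs
    simp only [bbarS, Finset.sum_mul]
    rw [integral_finsetSum]
    · refine Finset.sum_congr rfl fun j _ => ?_
      simp only [mul_comm (a i j _), mul_comm (dSch a i j _)]
      exact (hy j).symm
    · intro j _
      obtain ⟨S, hS⟩ := exists_schwartz_eq_dSch a i j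
      rw [← hS]
      exact memLp_two_integrable_mul (memLp_two_comp_sub_left S v) hs'
  have m1 : Measurable fun p : ℝ × En N × En N =>
      ∑ j, ∫ w, a i j (p.2.2 - w) * Df j (p.1, p.2.1, w) :=
    Finset.measurable_fun_sum _ fun j _ =>
      measurable_integral_fiber (a i j).continuous.measurable (hgm j)
  have m2 := measurable_bbarS a hfm i
  have hms := (measurableSet_eq_fun m1 m2)
  have hms' := hm' hms
  have h2 := (Measure.ae_ae_comm (μ := (volume : Measure (En N))) (ν := timeSpace N T)
    (p := fun v y => ∑ j, ∫ w, a i j (v - w) * Df j (y.1, y.2, w) = bbarS a f i (y.1, y.2, v))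
    (measurable_swap hms')).1 (Eventually.of_forall key)
  have h3 := (Measure.ae_prod_iff_ae_ae (μ := timeSpace N T) (ν := (volume : Measure (En N)))
    (p := fun q => ∑ j, ∫ w, a i j (q.2 - w) * Df j (q.1.1, q.1.2, w)
      = bbarS a f i (q.1.1, q.1.2, q.2)) hms').2 h2
  exact (hm.symm _).quasiMeasurePreserving.ae h3

lemma ae_fiber {P : ℝ × En N × En N → Prop} (h : ∀ᵐ p ∂slab N T, P p) :
    ∀ᵐ p ∂slab N T, ∀ᵐ w, P (p.1, p.2.1, w) := by
  have hm := measurePreserving_assoc_slab N T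
  have h1 := Measure.ae_ae_of_ae_prod (hm.quasiMeasurePreserving.ae h)
  have h2 : ∀ᵐ q ∂(timeSpace N T).prod (volume : Measure (En N)), ∀ᵐ w, P (q.1.1, q.1.2, w) :=
    Measure.quasiMeasurePreserving_fst.ae h1
  exact (hm.symm _).quasiMeasurePreserving.ae h2

lemma abs_integral_sub_left_mul_le {k : En N → ℝ} (hk : Integrable k) (v : En N) {u : En N → ℝ}
    (hu : ∀ᵐ w, |u w| ≤ 1) : |∫ w, k (v - w) * u w| ≤ ∫ w, |k w| := by
  rw [← integral_sub_left_eq_self (fun w => |k w|) volume v]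
  refine norm_integral_le_of_norm_le (f := fun w => k (v - w) * u w)
    (hk.abs.comp_sub_left v) ?_
  filter_upwards [hu] with w hw
  rw [Real.norm_eq_abs, abs_mul]
  exact mul_le_of_le_one_right (abs_nonneg _) hw

/-- The diffusion matrix and the drift are bounded wherever `0 < f < 1` on the fibre. -/
lemma exists_abs_abarS_bbarS_le (a : Fin N → Fin N → SchwartzMap (En N) ℝ) :
    ∃ Λ : ℝ, 0 ≤ Λ ∧ ∀ (f : ℝ × En N × En N → ℝ) (p : ℝ × En N × En N),
      (∀ᵐ w, f (p.1, p.2.1, w) ∈ Ioo (0 : ℝ) 1) →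
      (∀ i j, |abarS a f i j p| ≤ Λ) ∧ ∀ j, |bbarS a f j p| ≤ Λ := by
  have hi : ∀ i, Integrable fun z => ∑ j, dSch a i j z := fun i =>
    integrable_finsetSum _ fun j _ => by
      obtain ⟨S, hS⟩ := exists_schwartz_eq_dSch a i j
      rw [← hS]
      exact S.integrable
  have n1 : ∀ i j, 0 ≤ ∫ w, |a i j w| := fun i j => integral_nonneg fun _ => abs_nonneg _
  have n2 : ∀ i, 0 ≤ ∫ w, |∑ j, dSch a i j w| := fun i => integral_nonneg fun _ => abs_nonneg _
  have n3 : 0 ≤ ∑ i, ∑ j, ∫ w, |a i j w| :=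
    Finset.sum_nonneg fun i _ => Finset.sum_nonneg fun j _ => n1 i j
  have n4 : 0 ≤ ∑ i, ∫ w, |∑ j, dSch a i j w| := Finset.sum_nonneg fun i _ => n2 i
  refine ⟨(∑ i, ∑ j, ∫ w, |a i j w|) + ∑ i, ∫ w, |∑ j, dSch a i j w|, by positivity,
    fun f p hp => ⟨fun i j => ?_, fun j => ?_⟩⟩
  · have h1 : |abarS a f i j p| ≤ ∫ w, |a i j w| := by
      refine abs_integral_sub_left_mul_le (a i j).integrable p.2.2 ?_
      filter_upwards [hp] with w hw
      rw [abs_of_pos (mul_pos hw.1 (sub_pos.2 hw.2))]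
      nlinarith [hw.1, hw.2]
    have h2 : ∫ w, |a i j w| ≤ ∑ j, ∫ w, |a i j w| :=
      Finset.single_le_sum (f := fun j => ∫ w, |a i j w|) (fun j _ => n1 i j) (Finset.mem_univ j)
    have h3 : ∑ j, ∫ w, |a i j w| ≤ ∑ i, ∑ j, ∫ w, |a i j w| :=
      Finset.single_le_sum (f := fun i => ∑ j, ∫ w, |a i j w|)
        (fun i _ => Finset.sum_nonneg fun j _ => n1 i j) (Finset.mem_univ i)
    linarith
  · have h1 : |bbarS a f j p| ≤ ∫ w, |∑ l, dSch a j l w| := by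
      refine abs_integral_sub_left_mul_le (hi j) p.2.2 ?_
      filter_upwards [hp] with w hw
      rw [abs_of_pos hw.1]
      exact hw.2.le
    have h2 : ∫ w, |∑ l, dSch a j l w| ≤ ∑ i, ∫ w, |∑ l, dSch a i l w| :=
      Finset.single_le_sum (f := fun i => ∫ w, |∑ l, dSch a i l w|) (fun i _ => n2 i)
        (Finset.mem_univ j)
    linarith

lemma sum_abarS_nonneg (a : Fin N → Fin N → SchwartzMap (En N) ℝ)
    (hpsd : ∀ z η : En N, 0 ≤ ∑ i, ∑ j, a i j z * η i * η j) (hfm : Measurable f)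
    {p : ℝ × En N × En N} (hp : ∀ᵐ w, f (p.1, p.2.1, w) ∈ Ioo (0 : ℝ) 1) (d : Fin N → ℝ) :
    0 ≤ ∑ i, ∑ j, abarS a f i j p * d i * d j := by
  set H : En N → ℝ := fun w => f (p.1, p.2.1, w) * (1 - f (p.1, p.2.1, w)) with hH
  have hHb : ∀ᵐ w, 0 ≤ H w ∧ H w ≤ 1 := by
    filter_upwards [hp] with w hw
    exact ⟨(mul_pos hw.1 (sub_pos.2 hw.2)).le, by simp only [hH]; nlinarith [hw.1, hw.2]⟩
  have hHm : Measurable H := by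
    have : Measurable fun w => f (p.1, p.2.1, w) := hfm.comp (by fun_prop)
    fun_prop
  have i1 : ∀ i j, Integrable fun w => a i j (p.2.2 - w) * H w := fun i j => by
    refine ((a i j).integrable.comp_sub_left p.2.2).mul_bdd (c := 1) hHm.aestronglyMeasurable ?_
    filter_upwards [hHb] with w hw
    rw [Real.norm_of_nonneg hw.1]
    exact hw.2
  have e : ∑ i, ∑ j, abarS a f i j p * d i * d j
      = ∫ w, ∑ i, ∑ j, a i j (p.2.2 - w) * H w * d i * d j := by
    have i2 : ∀ i j, Integrable fun w => a i j (p.2.2 - w) * H w * d i * d j := fun i j =>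
      ((i1 i j).mul_const (d i)).mul_const (d j)
    rw [integral_finsetSum _ fun i _ => integrable_finsetSum _ fun j _ => i2 i j]
    refine Finset.sum_congr rfl fun i _ => ?_
    rw [integral_finsetSum _ fun j _ => i2 i j]
    refine Finset.sum_congr rfl fun j _ => ?_
    rw [integral_mul_const, integral_mul_const]
    rfl
  rw [e]
  refine integral_nonneg_of_ae ?_
  filter_upwards [hHb] with w hw
  have h1 := mul_nonneg hw.1 (hpsd (p.2.2 - w) (WithLp.toLp 2 d))
  simp only [Pi.zero_apply]
  refine h1.trans_eq ?_
  simp only [Finset.mul_sum]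
  exact Finset.sum_congr rfl fun i _ => Finset.sum_congr rfl fun j _ => by ring

lemma measurable_abarS (a : Fin N → Fin N → SchwartzMap (En N) ℝ) (hfm : Measurable f)
    (i j : Fin N) : Measurable (abarS a f i j) :=
  measurable_integral_fiber (u := fun p => f p * (1 - f p)) (a i j).continuous.measurable
    (by fun_prop)

end Coefficients

section Regularized

variable {N : ℕ} {T ε : ℝ} {a : Fin N → Fin N → SchwartzMap (En N) ℝ}
  {f : ℝ × En N × En N → ℝ} {Df : Fin N → ℝ × En N × En N → ℝ} {f₀ : En N × En N → ℝ}
  {C₁ C₂ α C₁' C₂' α₀ : ℝ}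

/-- `C₁ e^{-αq} ≤ u ≤ C₂ e^{-αq} / (1 + C₂ e^{-αq})` with `q = |x|² + |v|²`. -/
def GaussSandwich (C₁ C₂ α : ℝ) (z : En N × En N) (u : ℝ) : Prop :=
  C₁ * Real.exp (-α * (‖z.1‖ ^ 2 + ‖z.2‖ ^ 2)) ≤ u ∧
    u ≤ C₂ * Real.exp (-α * (‖z.1‖ ^ 2 + ‖z.2‖ ^ 2))
      / (1 + C₂ * Real.exp (-α * (‖z.1‖ ^ 2 + ‖z.2‖ ^ 2)))

/-- The flux of the regularized problem. -/
def regFlux (ε : ℝ) (a : Fin N → Fin N → SchwartzMap (En N) ℝ) (f : ℝ × En N × En N → ℝ)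
    (Df : Fin N → ℝ × En N × En N → ℝ) (j : Fin N) (p : ℝ × En N × En N) : ℝ :=
  (∑ i, abarS a f i j p * Df i p) + ε * Df j p - bbarS a f j p * (f p * (1 - f p))

lemma GaussSandwich.mem_Ioo (h₁ : 0 < C₁) (h₂ : 0 < C₂) (hα : 0 < α) {z : En N × En N} {u : ℝ}
    (h : GaussSandwich C₁ C₂ α z u) : u ∈ Ioo (0 : ℝ) 1 := by
  obtain ⟨K, -, hK⟩ := exists_sandwich_bound h₁ h₂ hα
  exact (hK _ u (by positivity) h.1 h.2).1

lemma exists_mem_Icc_of_gaussSandwich (h₁ : 0 < C₁) (h₂ : 0 < C₂) (hα : 0 < α) (R : ℝ) :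
    ∃ c : ℝ, 0 < c ∧ ∀ (z : En N × En N) (u : ℝ), GaussSandwich C₁ C₂ α z u → ‖z‖ ≤ R →
      c ≤ u ∧ u ≤ 1 - c := by
  obtain ⟨K, -, hK⟩ := exists_sandwich_bound h₁ h₂ hα
  refine ⟨min (C₁ * Real.exp (-α * (2 * R ^ 2))) (1 / (1 + C₂)), by positivity,
    fun z u hu hz => ⟨?_, ?_⟩⟩
  · refine (min_le_left _ _).trans (le_trans ?_ hu.1)
    have h3 : ‖z.1‖ ^ 2 ≤ R ^ 2 := pow_le_pow_left₀ (norm_nonneg _) ((norm_fst_le z).trans hz) 2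
    have h4 : ‖z.2‖ ^ 2 ≤ R ^ 2 := pow_le_pow_left₀ (norm_nonneg _) ((norm_snd_le z).trans hz) 2
    refine mul_le_mul_of_nonneg_left (Real.exp_le_exp.2 ?_) h₁.le
    nlinarith
  · have h3 := (hK _ u (by positivity) hu.1 hu.2).2.2.1
    have h4 := min_le_right (C₁ * Real.exp (-α * (2 * R ^ 2))) (1 / (1 + C₂))
    linarith

lemma integrable_ent_of_gaussSandwich (h₁ : 0 < C₁) (h₂ : 0 < C₂) (hα : 0 < α)
    {u : En N × En N → ℝ} (hu : Measurable u) (hs : ∀ z, GaussSandwich C₁ C₂ α z (u z)) :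
    Integrable fun z => ent (u z) := by
  obtain ⟨K, hK0, hK⟩ := exists_sandwich_bound h₁ h₂ hα
  refine ((integrable_gaussian_weight N hα).const_mul K).mono'
    (isRenorm_ent.measurable.comp hu).aestronglyMeasurable (Eventually.of_forall fun z => ?_)
  have hq : 0 ≤ ‖z.1‖ ^ 2 + ‖z.2‖ ^ 2 := by positivity
  refine (hK _ (u z) hq (hs z).1 (hs z).2).2.2.2.1.trans ?_
  rw [← mul_assoc]
  refine mul_le_mul_of_nonneg_right ?_ (Real.exp_pos _).le
  exact mul_le_mul_of_nonneg_left (by nlinarith) hK0.le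

lemma integrable_slab_of_gaussSandwich (h₁ : 0 < C₁) (h₂ : 0 < C₂) (hα : 0 < α)
    (hfm : Measurable f) (hs : ∀ᵐ p ∂slab N T, GaussSandwich C₁ C₂ α p.2 (f p)) :
    Integrable (fun p => f p * (1 - f p) * (1 + ent' (f p) ^ 2)) (slab N T) ∧
      Integrable (fun p => |ent (f p)| * ∑ i, |p.2.2 i|) (slab N T) ∧
      Integrable (fun p => ent (f p)) (slab N T) ∧
      Integrable (fun p => f p * (1 - f p)) (slab N T) := by
  obtain ⟨K, hK0, hK⟩ := exists_sandwich_bound h₁ h₂ hα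
  have hG : Integrable (fun p : ℝ × En N × En N => (1 + (‖p.2.1‖ ^ 2 + ‖p.2.2‖ ^ 2)) ^ 2
      * Real.exp (-α * (‖p.2.1‖ ^ 2 + ‖p.2.2‖ ^ 2))) (slab N T) :=
    (integrable_gaussian_weight N hα).comp_snd (volume.restrict (Ioo 0 T))
  have me : Measurable fun p => ent (f p) := isRenorm_ent.measurable.comp hfm
  have me' : Measurable fun p => ent' (f p) := isRenorm_ent.measurable'.comp hfm
  refine ⟨(hG.const_mul K).mono' (by fun_prop) ?_, (hG.const_mul (K * N)).mono' (by fun_prop) ?_,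
    (hG.const_mul K).mono' me.aestronglyMeasurable ?_, (hG.const_mul K).mono' (by fun_prop) ?_⟩
  all_goals
    filter_upwards [hs] with p hp
    have hq : 0 ≤ ‖p.2.1‖ ^ 2 + ‖p.2.2‖ ^ 2 := by positivity
    obtain ⟨hI, -, -, b1, b2⟩ := hK _ (f p) hq hp.1 hp.2
    have hh : 0 < f p * (1 - f p) := mul_pos hI.1 (sub_pos.2 hI.2)
    have hE := Real.exp_pos (-α * (‖p.2.1‖ ^ 2 + ‖p.2.2‖ ^ 2))
    set q := ‖p.2.1‖ ^ 2 + ‖p.2.2‖ ^ 2 with hqd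
    have b3 : K * (1 + q) * Real.exp (-α * q) ≤ K * ((1 + q) ^ 2 * Real.exp (-α * q)) := by
      rw [← mul_assoc]
      exact mul_le_mul_of_nonneg_right (mul_le_mul_of_nonneg_left (by nlinarith) hK0.le) hE.le
  · rw [Real.norm_of_nonneg (by positivity), ← mul_assoc]
    exact b2
  · have b4 : ∑ i, |p.2.2 i| ≤ N * (1 + q) := by
      refine (Finset.sum_le_card_nsmul _ _ (1 + q) fun i _ => ?_).trans_eq (by simp [mul_add])
      have h5 : |p.2.2 i| ≤ ‖p.2.2‖ := PiLp.norm_apply_le p.2.2 i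
      nlinarith [sq_nonneg (‖p.2.2‖ - 1), sq_nonneg ‖p.2.1‖]
    have b5 : 0 ≤ ∑ i, |p.2.2 i| := Finset.sum_nonneg fun i _ => abs_nonneg _
    rw [Real.norm_of_nonneg (mul_nonneg (abs_nonneg _) b5)]
    refine (mul_le_mul b1 b4 b5 ((abs_nonneg _).trans b1)).trans_eq ?_
    ring
  · exact b1.trans b3
  · rw [Real.norm_of_nonneg hh.le, ← mul_assoc]
    refine le_trans ?_ b2
    exact le_mul_of_one_le_right hh.le (by nlinarith [sq_nonneg (ent' (f p))])

lemma memLp_of_integrableOn (hfm : Measurable f) (hDfm : ∀ i, Measurable (Df i))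
    (h : IntegrableOn (fun p => f p ^ 2 + ∑ i, Df i p ^ 2) {p : ℝ × En N × En N | 0 < p.1}) :
    MemLp f 2 (slab N T) ∧ ∀ i, MemLp (Df i) 2 (slab N T) := by
  have hi : Integrable (fun p => f p ^ 2 + ∑ i, Df i p ^ 2) (slab N T) := by
    rw [slab_eq]
    exact h.mono_set fun p hp => hp.1.1
  have hn : ∀ p, 0 ≤ ∑ i, Df i p ^ 2 := fun p => Finset.sum_nonneg fun i _ => sq_nonneg _
  refine ⟨memLp_two_of_measurable hfm (hi.mono' (by fun_prop) (Eventually.of_forall fun p => ?_)),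
    fun i => memLp_two_of_measurable (hDfm i) (hi.mono' (by fun_prop)
      (Eventually.of_forall fun p => ?_))⟩
  · rw [Real.norm_of_nonneg (sq_nonneg _)]
    linarith [hn p]
  · rw [Real.norm_of_nonneg (sq_nonneg _)]
    have := Finset.single_le_sum (f := fun i => Df i p ^ 2) (fun i _ => sq_nonneg _)
      (Finset.mem_univ i)
    nlinarith [sq_nonneg (f p)]

lemma isSlabSol_of_isWeakReg (h₁ : 0 < C₁) (h₂ : 0 < C₂) (hα : 0 < α) (h₁' : 0 < C₁')
    (h₂' : 0 < C₂') (hα₀ : 0 < α₀) (hf₀S : ∃ S : SchwartzMap (En N × En N) ℝ, ⇑S = f₀)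
    (hs₀ : ∀ z, GaussSandwich C₁' C₂' α₀ z (f₀ z)) (hfm : Measurable f)
    (hDfm : ∀ i, Measurable (Df i))
    (hweakgrad : ∀ (i : Fin N) (φ : ℝ × En N × En N → ℝ), IsTest φ →
      ∫ p, f p * pV i φ p = -∫ p, Df i p * φ p)
    (hL2H1 : IntegrableOn (fun p => f p ^ 2 + ∑ i, Df i p ^ 2)
      {p : ℝ × En N × En N | 0 < p.1})
    (hcont : ContInDistributions f) (hsol : IsWeakReg ε a f Df) (hinit : TakesInitialData f f₀)
    (hs : ∀ᵐ p ∂slab N T, GaussSandwich C₁ C₂ α p.2 (f p)) :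
    IsSlabSol T f Df (regFlux ε a f Df) f₀ := by
  obtain ⟨hf, hDf⟩ := memLp_of_integrableOn (T := T) hfm hDfm hL2H1
  have mA := fun i j => measurable_abarS a hfm i j
  have mb := fun j => measurable_bbarS a hfm j
  have hI : ∀ᵐ p ∂slab N T, f p ∈ Ioo (0 : ℝ) 1 := by
    filter_upwards [hs] with p hp using hp.mem_Ioo h₁ h₂ hα
  obtain ⟨Λ, hΛ, hΛb⟩ := exists_abs_abarS_bbarS_le a
  have hIf := ae_fiber hI
  obtain ⟨S, rfl⟩ := hf₀S
  refine ⟨hfm, hDfm, fun j => ?_, S.continuous.measurable, fun R => ?_, hf, hDf, fun j => ?_,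
    S.memLp 2, hweakgrad, fun φ hφ => ?_, hcont, hinit⟩
  · unfold regFlux
    fun_prop
  · obtain ⟨c, hc, hcb⟩ := exists_mem_Icc_of_gaussSandwich (N := N) h₁ h₂ hα R
    obtain ⟨c', hc', hcb'⟩ := exists_mem_Icc_of_gaussSandwich (N := N) h₁' h₂' hα₀ R
    refine ⟨min c c', lt_min hc hc', ?_, fun z hz => ?_⟩
    · filter_upwards [hs] with p hp hR
      obtain ⟨e1, e2⟩ := hcb _ _ hp hR
      exact ⟨(min_le_left _ _).trans e1, by linarith [min_le_left c c']⟩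
    · obtain ⟨e1, e2⟩ := hcb' _ _ (hs₀ z) hz
      exact ⟨(min_le_right _ _).trans e1, by linarith [min_le_right c c']⟩
  · have m1 : ∀ i, MemLp (fun p => abarS a f i j p * Df i p) 2 (slab N T) := fun i => by
      refine (hDf i).of_le_mul (c := Λ) (by fun_prop) ?_
      filter_upwards [hIf] with p hp
      rw [norm_mul]
      exact mul_le_mul_of_nonneg_right ((hΛb f p hp).1 i j) (norm_nonneg _)
    have m2 : MemLp (fun p => bbarS a f j p * (f p * (1 - f p))) 2 (slab N T) := by
      refine hf.of_le_mul (c := Λ) (by fun_prop) ?_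
      filter_upwards [hIf, hI] with p hp hp1
      rw [norm_mul, norm_mul, Real.norm_of_nonneg (sub_pos.2 hp1.2).le]
      refine mul_le_mul ((hΛb f p hp).2 j) ?_ (by have := hp1.2; positivity) hΛ
      exact mul_le_of_le_one_right (norm_nonneg _) (by linarith [hp1.1])
    exact ((memLp_finsetSum _ fun i _ => m1 i).add ((hDf j).const_mul ε)).sub m2
  · have := hsol φ hφ
    simp only [regFlux]
    linarith

end Regularized

section EntropyInequality

variable {N : ℕ} {T ε : ℝ} {a : Fin N → Fin N → SchwartzMap (En N) ℝ}
  {f : ℝ × En N × En N → ℝ} {Df : Fin N → ℝ × En N × En N → ℝ} {f₀ : En N × En N → ℝ}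

/-- The integrand of the entropy production of the unregularized flux. -/
def driftDiffusion (a : Fin N → Fin N → SchwartzMap (En N) ℝ) (f : ℝ × En N × En N → ℝ)
    (Df : Fin N → ℝ × En N × En N → ℝ) (p : ℝ × En N × En N) : ℝ :=
  (∑ i, ∑ j, abarS a f i j p * Df i p * Df j p) / (f p * (1 - f p)) - ∑ j, bbarS a f j p * Df j p

lemma integrable_driftDiffusion (hfm : Measurable f) (hDfm : ∀ i, Measurable (Df i))
    (hI : ∀ᵐ p ∂slab N T, f p ∈ Ioo (0 : ℝ) 1)
    (hH : Integrable (fun p => f p * (1 - f p)) (slab N T))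
    (hD : Integrable (fun p => (∑ i, Df i p ^ 2) / (f p * (1 - f p))) (slab N T)) :
    Integrable (driftDiffusion a f Df) (slab N T) := by
  have mA := fun i j => measurable_abarS a hfm i j
  have mb := fun j => measurable_bbarS a hfm j
  obtain ⟨Λ, hΛ, hΛb⟩ := exists_abs_abarS_bbarS_le a
  have hm : Measurable (driftDiffusion a f Df) := by
    unfold driftDiffusion
    fun_prop
  refine ((hD.const_mul (Λ * (N * N))).add ((hD.add hH).const_mul (Λ * N))).mono'
    hm.aestronglyMeasurable ?_
  filter_upwards [ae_fiber hI, hI] with p hp hp1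
  have hh : 0 < f p * (1 - f p) := mul_pos hp1.1 (sub_pos.2 hp1.2)
  obtain ⟨hA, hb⟩ := hΛb f p hp
  set h := f p * (1 - f p) with hhd
  set s := ∑ i, Df i p ^ 2 with hsd
  have hsq : ∀ i, Df i p ^ 2 ≤ s := fun i => Finset.single_le_sum (f := fun i => Df i p ^ 2)
    (fun i _ => sq_nonneg _) (Finset.mem_univ i)
  have hs0 : 0 ≤ s := Finset.sum_nonneg fun i _ => sq_nonneg _
  have b1 : |∑ i, ∑ j, abarS a f i j p * Df i p * Df j p| ≤ Λ * (N * N) * s := by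
    have e1 : ∀ i j, |abarS a f i j p * Df i p * Df j p| ≤ Λ * s := fun i j => by
      rw [mul_assoc, abs_mul, abs_mul]
      refine mul_le_mul (hA i j) ?_ (by positivity) hΛ
      have := hsq i
      have := hsq j
      rw [← sq_abs] at *
      nlinarith [sq_nonneg (|Df i p| - |Df j p|), sq_abs (Df i p), sq_abs (Df j p), hsq i, hsq j]
    calc _ ≤ ∑ i : Fin N, ∑ j : Fin N, Λ * s := (Finset.abs_sum_le_sum_abs _ _).trans
          (Finset.sum_le_sum fun i _ => (Finset.abs_sum_le_sum_abs _ _).trans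
            (Finset.sum_le_sum fun j _ => e1 i j))
      _ = _ := by simp; ring
  have b2 : |∑ j, bbarS a f j p * Df j p| ≤ Λ * N * (s / h + h) := by
    have e1 : ∀ j, |bbarS a f j p * Df j p| ≤ Λ * (s / h + h) := fun j => by
      rw [abs_mul]
      refine mul_le_mul (hb j) ?_ (abs_nonneg _) hΛ
      have e2 : |Df j p| ≤ Df j p ^ 2 / h + h := by
        rw [← sq_abs, div_add' _ _ _ hh.ne', le_div_iff₀ hh]
        nlinarith [sq_nonneg (|Df j p| - h), abs_nonneg (Df j p)]
      exact e2.trans (add_le_add (div_le_div_of_nonneg_right (hsq j) hh.le) le_rfl)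
    calc _ ≤ ∑ j : Fin N, Λ * (s / h + h) := (Finset.abs_sum_le_sum_abs _ _).trans
            (Finset.sum_le_sum fun j _ => e1 j)
      _ = _ := by simp; ring
  simp only [Pi.add_apply]
  rw [Real.norm_eq_abs]
  refine (abs_sub _ _).trans (add_le_add ?_ b2)
  rw [abs_div, abs_of_pos hh, ← mul_div_assoc]
  exact div_le_div_of_nonneg_right b1 hh.le

/-- The dissipation on almost every time slice, in terms of the unregularized flux. -/
lemma ae_integral_dissipation_eq (heven : ∀ i j (z : En N), a i j (-z) = a i j z)
    (hfm : Measurable f) (hDfm : ∀ i, Measurable (Df i)) (hf : MemLp f 2 (slab N T))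
    (hDf : ∀ i, MemLp (Df i) 2 (slab N T))
    (hweakgrad : ∀ (i : Fin N) (φ : ℝ × En N × En N → ℝ), IsTest φ →
      ∫ p, f p * pV i φ p = -∫ p, Df i p * φ p)
    (hI : ∀ᵐ p ∂slab N T, f p ∈ Ioo (0 : ℝ) 1)
    (hD : Integrable (fun p => (∑ i, Df i p ^ 2) / (f p * (1 - f p))) (slab N T)) :
    ∀ᵐ τ ∂(volume.restrict (Ioo 0 T)), ∫ z : En N × En N, ∫ w : En N,
        (∑ i, ∑ j, a i j (z.2 - w)
          * (Df i (τ, z.1, z.2) / (f (τ, z.1, z.2) * (1 - f (τ, z.1, z.2)))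
              - Df i (τ, z.1, w) / (f (τ, z.1, w) * (1 - f (τ, z.1, w))))
          * (Df j (τ, z.1, z.2) / (f (τ, z.1, z.2) * (1 - f (τ, z.1, z.2)))
              - Df j (τ, z.1, w) / (f (τ, z.1, w) * (1 - f (τ, z.1, w)))))
        * (f (τ, z.1, z.2) * (1 - f (τ, z.1, z.2)))
        * (f (τ, z.1, w) * (1 - f (τ, z.1, w)))
      = 2 * ∫ z, driftDiffusion a f Df (τ, z) := by
  have hb := Measure.ae_ae_of_ae_prod
    (ae_sum_integral_grad_eq_bbarS a hfm hDfm hf hDf hweakgrad)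
  have hsq : ∀ᵐ τ ∂(volume.restrict (Ioo 0 T)), ∀ i, Integrable fun z => Df i (τ, z) ^ 2 :=
    ae_all_iff.2 fun i => (hDf i).integrable_sq.prod_right_ae
  filter_upwards [hb, hsq, Measure.ae_ae_of_ae_prod hI, hD.prod_right_ae] with τ h1 h2 h3 h4
  have := integral_dissipation_eq a heven (u := fun z => f (τ, z)) (g := fun i z => Df i (τ, z))
    (hfm.comp measurable_prodMk_left) (fun i => (hDfm i).comp measurable_prodMk_left) h3 h4 h2
  refine this.trans ?_
  congr 1
  refine integral_congr_ae ?_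
  filter_upwards [h1] with z hz
  simp only [driftDiffusion, ← hz]
  rfl

/-- The entropy inequality on a bounded time interval. -/
lemma ae_entropy_inequality (hε : 0 < ε)
    (hpsd : ∀ z η : En N, 0 ≤ ∑ i, ∑ j, a i j z * η i * η j)
    (heven : ∀ i j (z : En N), a i j (-z) = a i j z) {C₁ C₂ α : ℝ} (h₁ : 0 < C₁) (h₂ : 0 < C₂)
    (hα : 0 < α) (h : IsSlabSol T f Df (regFlux ε a f Df) f₀)
    (he₀ : Integrable fun z => ent (f₀ z))
    (hs : ∀ᵐ p ∂slab N T, GaussSandwich C₁ C₂ α p.2 (f p)) :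
    ∀ᵐ t, t ∈ Ioo 0 T → (∫ z, ent (f (t, z)))
      + (1 / 2) * (∫ τ in Ioc (0 : ℝ) t, ∫ z : En N × En N, ∫ w : En N,
          (∑ i, ∑ j, a i j (z.2 - w)
            * (Df i (τ, z.1, z.2) / (f (τ, z.1, z.2) * (1 - f (τ, z.1, z.2)))
                - Df i (τ, z.1, w) / (f (τ, z.1, w) * (1 - f (τ, z.1, w))))
            * (Df j (τ, z.1, z.2) / (f (τ, z.1, z.2) * (1 - f (τ, z.1, z.2)))
                - Df j (τ, z.1, w) / (f (τ, z.1, w) * (1 - f (τ, z.1, w)))))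
          * (f (τ, z.1, z.2) * (1 - f (τ, z.1, z.2)))
          * (f (τ, z.1, w) * (1 - f (τ, z.1, w)))) ≤ ∫ z, ent (f₀ z) := by
  obtain ⟨hw, hy, he, hH⟩ := integrable_slab_of_gaussSandwich h₁ h₂ hα h.measurable hs
  obtain ⟨Λ, hΛ, hΛb⟩ := exists_abs_abarS_bbarS_le a
  have hfib := ae_fiber h.ae_mem_Ioo
  have key := h.entropy_identity (A := abarS a f) (b := bbarS a f) hε hΛ (fun j p => rfl)
    (hfib.mono fun p hp => (hΛb f p hp).1) (hfib.mono fun p hp => (hΛb f p hp).2)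
    (hfib.mono fun p hp => sum_abarS_nonneg a hpsd h.measurable hp fun i => Df i p) hw hy he he₀
  filter_upwards [key] with t ht htT
  obtain ⟨hD, hid⟩ := ht htT
  have h' := h.mono htT.2.le
  have hG := integrable_driftDiffusion (a := a) h'.measurable h'.measurable_grad h'.ae_mem_Ioo
    (hH.mono_measure (slab_mono htT.2.le)) hD
  have hdis := ae_integral_dissipation_eq heven h'.measurable h'.measurable_grad h'.memLp
    h'.memLp_grad h'.weak_grad h'.ae_mem_Ioo hD
  rw [integral_Ioc_eq_integral_Ioo, integral_congr_ae hdis, integral_const_mul,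
    ← integral_prod _ hG]
  have e : ∫ p, ∑ j, regFlux ε a f Df j p * ((f p * (1 - f p))⁻¹ * Df j p) ∂slab N t
      = (∫ p, driftDiffusion a f Df p ∂slab N t)
        + ε * ∫ p, (∑ i, Df i p ^ 2) / (f p * (1 - f p)) ∂slab N t := by
    rw [← integral_const_mul, ← integral_add hG (hD.const_mul ε)]
    refine integral_congr_ae ?_
    filter_upwards [h'.ae_mem_Ioo] with p hp
    have := flux_mul_grad_eq (A := fun i j => abarS a f i j p) (d := fun i => Df i p)
      (b := fun j => bbarS a f j p) (ε := ε) (mul_pos hp.1 (sub_pos.2 hp.2))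
    simp only [regFlux, driftDiffusion]
    rw [this]
    ring
  have hD0 : 0 ≤ ∫ p, (∑ i, Df i p ^ 2) / (f p * (1 - f p)) ∂slab N t := by
    refine integral_nonneg_of_ae ?_
    filter_upwards [h'.ae_mem_Ioo] with p hp
    exact div_nonneg (Finset.sum_nonneg fun i _ => sq_nonneg _)
      (mul_pos hp.1 (sub_pos.2 hp.2)).le
  rw [e] at hid
  have := mul_nonneg hε.le hD0
  linarith

end EntropyInequality

/-- entropy inequality for the constructed solution of the regularized
problem. -/
theorem stmt_10 (N : ℕ) (hN : 1 ≤ N) (ε : ℝ) (hε : 0 < ε)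
    (a : Fin N → Fin N → SchwartzMap (En N) ℝ)
    (hsymm : ∀ i j z, a i j z = a j i z)
    (hpsd : ∀ (z η : En N), 0 ≤ ∑ i, ∑ j, a i j z * η i * η j)
    (heven : ∀ i j (z : En N), a i j (-z) = a i j z)
    (hnull : ∀ z : En N, ∑ i, ∑ j, a i j z * z i * z j = 0)
    (f₀ : En N × En N → ℝ) (hf₀S : ∃ S : SchwartzMap (En N × En N) ℝ, ⇑S = f₀)
    (C₁' C₂' α₀ : ℝ) (hC₁' : 0 < C₁') (hC₂' : 0 < C₂') (hα₀ : 0 < α₀)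
    (hf₀l : ∀ z : En N × En N,
      C₁' * Real.exp (-α₀ * (‖z.1‖ ^ 2 + ‖z.2‖ ^ 2)) ≤ f₀ z)
    (hf₀u : ∀ z : En N × En N,
      f₀ z ≤ C₂' * Real.exp (-α₀ * (‖z.1‖ ^ 2 + ‖z.2‖ ^ 2))
        / (1 + C₂' * Real.exp (-α₀ * (‖z.1‖ ^ 2 + ‖z.2‖ ^ 2))))
    (f : ℝ × En N × En N → ℝ) (Df : Fin N → ℝ × En N × En N → ℝ)
    (hfm : Measurable f) (hDfm : ∀ i, Measurable (Df i))
    (hweakgrad : ∀ (i : Fin N) (φ : ℝ × En N × En N → ℝ), IsTest φ →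
      ∫ p, f p * pV i φ p = -∫ p, Df i p * φ p)
    (hL2H1 : IntegrableOn (fun p => f p ^ 2 + ∑ i, Df i p ^ 2)
      {p : ℝ × En N × En N | 0 < p.1})
    (hcont : ContInDistributions f)
    (hsol : IsWeakReg ε a f Df) (hinit : TakesInitialData f f₀)
    (hbounds : ∀ T : ℝ, 0 < T → ∃ C C₁ C₂ α : ℝ, 0 < C ∧ 0 < C₁ ∧ 0 < C₂ ∧ 0 < α ∧
      (∫ p in Set.Ioc (0 : ℝ) T ×ˢ (Set.univ : Set (En N × En N)),
          Real.exp (α * (‖p.2.1‖ ^ 2 + ‖p.2.2‖ ^ 2)) * ∑ i, Df i p ^ 2) ≤ C ∧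
      (∀ᵐ p : ℝ × En N × En N, p.1 ∈ Set.Ioo 0 T →
        C₁ * Real.exp (-α * (‖p.2.1‖ ^ 2 + ‖p.2.2‖ ^ 2)) ≤ f p ∧
        f p ≤ C₂ * Real.exp (-α * (‖p.2.1‖ ^ 2 + ‖p.2.2‖ ^ 2))
          / (1 + C₂ * Real.exp (-α * (‖p.2.1‖ ^ 2 + ‖p.2.2‖ ^ 2))))) :
    -- entropy inequality: for a.e. `t > 0`,
    -- `∬ s(t) + (1/2)∫₀ᵗ ∬ d ≤ ∬ s(0)`
    ∀ᵐ t : ℝ, 0 < t →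
      (∫ z : En N × En N,
          (f (t, z.1, z.2) * Real.log (f (t, z.1, z.2))
            + (1 - f (t, z.1, z.2)) * Real.log (1 - f (t, z.1, z.2))))
        + (1 / 2) * (∫ τ in Set.Ioc (0 : ℝ) t, ∫ z : En N × En N,
            ∫ w : En N,
              (∑ i, ∑ j, a i j (z.2 - w)
                * (Df i (τ, z.1, z.2) / (f (τ, z.1, z.2) * (1 - f (τ, z.1, z.2)))
                    - Df i (τ, z.1, w) / (f (τ, z.1, w) * (1 - f (τ, z.1, w))))
                * (Df j (τ, z.1, z.2) / (f (τ, z.1, z.2) * (1 - f (τ, z.1, z.2)))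
                    - Df j (τ, z.1, w) / (f (τ, z.1, w) * (1 - f (τ, z.1, w)))))
              * (f (τ, z.1, z.2) * (1 - f (τ, z.1, z.2)))
              * (f (τ, z.1, w) * (1 - f (τ, z.1, w))))
        ≤ ∫ z : En N × En N,
            (f₀ z * Real.log (f₀ z) + (1 - f₀ z) * Real.log (1 - f₀ z)) := by
  have key : ∀ n : ℕ, ∀ᵐ t : ℝ, t ∈ Ioo (0 : ℝ) (n + 1) → _ := fun n => by
    obtain ⟨C, C₁, C₂, α, -, hC₁, hC₂, hα, -, hae⟩ := hbounds (n + 1) (by positivity)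
    have hs : ∀ᵐ p ∂slab N (n + 1), GaussSandwich C₁ C₂ α p.2 (f p) := by
      rw [slab_eq, ae_restrict_iff' (measurableSet_Ioo.prod .univ)]
      filter_upwards [hae] with p hp hpT using hp hpT.1
    have hs₀ : ∀ z, GaussSandwich C₁' C₂' α₀ z (f₀ z) := fun z => ⟨hf₀l z, hf₀u z⟩
    have h := isSlabSol_of_isWeakReg hC₁ hC₂ hα hC₁' hC₂' hα₀ hf₀S hs₀ hfm hDfm hweakgrad hL2H1
      hcont hsol hinit hs
    exact ae_entropy_inequality hε hpsd heven hC₁ hC₂ hα h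
      (integrable_ent_of_gaussSandwich hC₁' hC₂' hα₀ h.measurable_init hs₀) hs
  filter_upwards [ae_all_iff.2 key] with t ht h0
  obtain ⟨n, hn⟩ := exists_nat_gt t
  exact ht n ⟨h0, hn.trans (lt_add_one _)⟩
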